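/- arXiv:1205.0669 — 3 statements merged into one kernel-verified Lean document; each statement's English description precedes it below -/
import Mathlib

section
/- No MAD 𝔪 of the twisted affine Kac–Moody Lie algebra L̂(𝔤,σ) is contained in the subalgebra L̃(𝔤,σ) = L(𝔤,σ) ⊕ kc; equivalently, every MAD of L̂(𝔤,σ) contains an element of the form x' + d with x' ∈ L(𝔤,σ) (up to a nonzero scalar multiple of the d-component). -/
open LaurentPolynomial TensorProduct

noncomputable section

/-- The weight space of a subalgebra `𝔪` of `M` attached to a linear functional
`α ∈ 𝔪*`: `M_α = {l ∈ M : ⁅z, l⁆ = α(z) • l for all z ∈ 𝔪}`. -/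
def adWeightSpace {k M : Type} [Field k] [LieRing M] [LieAlgebra k M]
    (𝔪 : LieSubalgebra k M) (α : Module.Dual k ↥𝔪) : Submodule k M :=
  ⨅ z : ↥𝔪, LinearMap.ker
    ((LieAlgebra.ad k M (z : M)) - α z • (1 : Module.End k M))

/-- A subalgebra `𝔪` of a Lie algebra `M` over `k` is diagonalizable if
`M = ⊕_{α ∈ 𝔪*} M_α`. -/
def IsDiagonalizableSubalgebra {k M : Type} [Field k] [LieRing M] [LieAlgebra k M]
    (𝔪 : LieSubalgebra k M) : Prop :=
  (⨆ α : Module.Dual k ↥𝔪, adWeightSpace 𝔪 α) = ⊤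

/-- A MAD: a maximal (abelian) diagonalizable subalgebra. -/
def IsMAD {k M : Type} [Field k] [LieRing M] [LieAlgebra k M]
    (𝔪 : LieSubalgebra k M) : Prop :=
  IsDiagonalizableSubalgebra 𝔪 ∧
    ∀ 𝔪' : LieSubalgebra k M, IsDiagonalizableSubalgebra 𝔪' → 𝔪 ≤ 𝔪' → 𝔪' = 𝔪

section Laurent

variable {k V : Type} [Field k] [AddCommGroup V] [Module k[T;T⁻¹] V] [Module k V]
  [IsScalarTower k k[T;T⁻¹] V]

theorem laurent_eq_sum (f : k[T;T⁻¹]) :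
    f = ∑ r ∈ f.coeff.support, f.coeff r • (T r : k[T;T⁻¹]) := by
  classical
  ext n
  simp only [AddMonoidAlgebra.coeff_sum, AddMonoidAlgebra.coeff_smul, Finsupp.coe_finsetSum,
    Finset.sum_apply, Finsupp.smul_apply, T_apply, smul_eq_mul, mul_ite, mul_one, mul_zero,
    Finset.sum_ite_eq', Finsupp.mem_support_iff, ne_eq, ite_not]
  split_ifs with h <;> simp_all

theorem laurent_smul_eq_sum (f : k[T;T⁻¹]) (v : V) :
    f • v = ∑ r ∈ f.coeff.support, f.coeff r • ((T r : k[T;T⁻¹]) • v) := by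
  conv_lhs => rw [laurent_eq_sum f, Finset.sum_smul]
  simp only [smul_assoc]

end Laurent

theorem T_smul_T_smul {k V : Type} [Field k] [AddCommGroup V] [Module k[T;T⁻¹] V] (r s : ℤ)
    (v : V) :
    (T r : k[T;T⁻¹]) • (T s : k[T;T⁻¹]) • v = (T (r + s) : k[T;T⁻¹]) • v := by
  rw [smul_smul, ← T_add]

theorem T_neg_smul_T_smul {k V : Type} [Field k] [AddCommGroup V] [Module k[T;T⁻¹] V] (r : ℤ)
    (v : V) :
    (T (-r) : k[T;T⁻¹]) • (T r : k[T;T⁻¹]) • v = v := by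
  simp [T_smul_T_smul]

theorem T_smul_T_neg_smul {k V : Type} [Field k] [AddCommGroup V] [Module k[T;T⁻¹] V] (r : ℤ)
    (v : V) :
    (T r : k[T;T⁻¹]) • (T (-r) : k[T;T⁻¹]) • v = v := by
  simp [T_smul_T_smul]

theorem exists_relative_compl {k V : Type} [Field k] [AddCommGroup V] [Module k V]
    {N M : Submodule k V} :
    ∃ C : Submodule k V, C ≤ M ∧ C ⊓ N = ⊥ ∧ (N ≤ M → M ≤ C ⊔ N) := by
  obtain ⟨K, hK⟩ := N.exists_isCompl
  refine ⟨K ⊓ M, inf_le_right, ?_, fun h => ?_⟩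
  · rw [eq_bot_iff]
    intro x hx
    have := hK.inf_eq_bot
    rw [eq_bot_iff] at this
    exact this ⟨hx.2, hx.1.1⟩
  · intro x hx
    have hx' : x ∈ N ⊔ K := by rw [hK.sup_eq_top]; trivial
    obtain ⟨n, hn, c, hc, rfl⟩ := Submodule.mem_sup.1 hx'
    refine Submodule.mem_sup.2 ⟨c, ⟨hc, ?_⟩, n, hn, add_comm _ _⟩
    have := M.sub_mem hx (h hn)
    simpa using this

section Birkhoff

variable {k V : Type} [Field k] [AddCommGroup V] [Module k[T;T⁻¹] V] [Module k V]
  [IsScalarTower k k[T;T⁻¹] V]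

/-- Two opposite periodic filtrations have a common adapted `k[t, t⁻¹]`-basis. -/
theorem exists_adapted_basis {m : ℤ} (hm : 0 < m) {P Q : ℤ → Submodule k V}
    (hP : Antitone P) (hQ : Antitone Q)
    (hPT : ∀ a r v, v ∈ P a → (T r : k[T;T⁻¹]) • v ∈ P (a + m * r))
    (hQT : ∀ b r v, v ∈ Q b → (T r : k[T;T⁻¹]) • v ∈ Q (b - m * r))
    (hPe : ∀ v, ∃ a, v ∈ P a) (hQe : ∀ v, ∃ b, v ∈ Q b)
    {K : ℤ} (hK : ∀ a b, K ≤ a + b → P a ⊓ Q b = ⊥) :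
    ∃ (ι : Type) (B : Module.Basis ι k[T;T⁻¹] V) (α β : ι → ℤ),
      (∀ v a, v ∈ P a ↔ ∀ j r, (B.repr v j).coeff r ≠ 0 → a ≤ α j + m * r) ∧
      (∀ v b, v ∈ Q b ↔ ∀ j r, (B.repr v j).coeff r ≠ 0 → b ≤ β j - m * r) := by
  classical
  let M : ℤ → ℤ → Submodule k V := fun a b => P a ⊓ Q b
  let N : ℤ → ℤ → Submodule k V := fun a b => M (a + 1) b ⊔ M a (b + 1)
  have hMmono : ∀ {a b a' b'}, a ≤ a' → b ≤ b' → M a' b' ≤ M a b := fun h h' =>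
    inf_le_inf (hP h) (hQ h')
  have hNM : ∀ a b, N a b ≤ M a b := fun a b =>
    sup_le (hMmono (by lia) le_rfl) (hMmono le_rfl (by lia))
  have hMT : ∀ a b r v, v ∈ M a b → (T r : k[T;T⁻¹]) • v ∈ M (a + m * r) (b - m * r) :=
    fun a b r v hv => ⟨hPT _ _ _ hv.1, hQT _ _ _ hv.2⟩
  have hNT : ∀ a b r v, v ∈ N a b → (T r : k[T;T⁻¹]) • v ∈ N (a + m * r) (b - m * r) := by
    intro a b r v hv
    obtain ⟨x, hx, y, hy, rfl⟩ := Submodule.mem_sup.1 hv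
    rw [smul_add]
    refine Submodule.add_mem_sup ?_ ?_
    · convert hMT _ _ r _ hx using 2; ring
    · convert hMT _ _ r _ hy using 2; ring
  choose C hCM hCN hCsup using fun a b => exists_relative_compl (N := N a b) (M := M a b)
  let ι : Type := Σ p : {a : ℤ // 0 ≤ a ∧ a < m} × ℤ,
    Module.Basis.ofVectorSpaceIndex k (C p.1 p.2)
  let e : ι → V := fun j => (Module.Basis.ofVectorSpace k (C j.1.1 j.1.2) j.2 : C j.1.1 j.1.2)
  let α : ι → ℤ := fun j => j.1.1
  let β : ι → ℤ := fun j => j.1.2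
  have he : ∀ j, e j ∈ M (α j) (β j) := fun j => hCM _ _ (Subtype.property _)
  have heT : ∀ j r, (T r : k[T;T⁻¹]) • e j ∈ M (α j + m * r) (β j - m * r) :=
    fun j r => hMT _ _ _ _ (he j)
  let S : ℤ → ℤ → Submodule k V := fun a b =>
    Submodule.span k {v | ∃ j r, a ≤ α j + m * r ∧ b ≤ β j - m * r ∧ (T r : k[T;T⁻¹]) • e j = v}
  have hSmono : ∀ {a b a' b'}, a ≤ a' → b ≤ b' → S a' b' ≤ S a b := by
    intro a b a' b' h h'
    refine Submodule.span_mono ?_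
    rintro v ⟨j, r, h1, h2, h3⟩
    exact ⟨j, r, h.trans h1, h'.trans h2, h3⟩
  have hMS : ∀ a b, M a b ≤ S a b ⊔ N a b := by
    intro a b v hv
    set r := a / m with hr
    have ha : a % m = a - m * r := by rw [Int.emod_def]
    have h0 : (T (-r) : k[T;T⁻¹]) • v ∈ M (a % m) (b + m * r) := by
      convert hMT _ _ (-r) _ hv using 2
      · rw [ha]; ring
      · ring
    obtain ⟨c, hc, n, hn, hcn⟩ := Submodule.mem_sup.1 (hCsup _ _ (hNM _ _) h0)
    have hv' : v = (T r : k[T;T⁻¹]) • c + (T r : k[T;T⁻¹]) • n := by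
      rw [← smul_add, hcn, T_smul_T_neg_smul]
    rw [hv']
    refine Submodule.add_mem_sup ?_ ?_
    · let p : {a : ℤ // 0 ≤ a ∧ a < m} × ℤ :=
        (⟨a % m, Int.emod_nonneg _ hm.ne', Int.emod_lt_of_pos _ hm⟩, b + m * r)
      let bs := Module.Basis.ofVectorSpace k (C p.1 p.2)
      have hsum := bs.linearCombination_repr ⟨c, hc⟩
      have hsum' := congrArg (Submodule.subtype _) hsum
      rw [Finsupp.linearCombination_apply, Finsupp.sum, map_sum] at hsum'
      simp only [Submodule.subtype_apply, Submodule.coe_smul] at hsum'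
      rw [← hsum', Finset.smul_sum]
      refine Submodule.sum_mem _ fun i _ => ?_
      rw [smul_comm]
      refine Submodule.smul_mem _ _ (Submodule.subset_span ?_)
      let j : ι := Sigma.mk p i
      refine ⟨j, r, ?_, ?_, rfl⟩
      · change a ≤ a % m + m * r
        rw [ha]; lia
      · change b ≤ b + m * r - m * r
        lia
    · convert hNT _ _ r _ hn using 2
      · rw [ha]; ring
      · ring
  have hspan : ∀ n : ℕ, ∀ a b, K ≤ a + b + n → M a b ≤ S a b := by
    intro n
    induction n with
    | zero =>
      intro a b h
      change P a ⊓ Q b ≤ _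
      rw [hK a b (by simpa using h)]
      exact bot_le
    | succ n ih =>
      intro a b h
      push_cast at h
      refine (hMS a b).trans (sup_le le_rfl (sup_le ?_ ?_))
      · exact (ih (a + 1) b (by lia)).trans (hSmono (by lia) le_rfl)
      · exact (ih a (b + 1) (by lia)).trans (hSmono le_rfl (by lia))
  have hMS' : ∀ a b, M a b ≤ S a b := fun a b => hspan (K - a - b).toNat a b (by lia)
  have htop : ⊤ ≤ Submodule.span k[T;T⁻¹] (Set.range e) := by
    intro v _
    obtain ⟨a, ha⟩ := hPe v
    obtain ⟨b, hb⟩ := hQe v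
    have hv := hMS' a b ⟨ha, hb⟩
    have : S a b ≤ (Submodule.span k[T;T⁻¹] (Set.range e)).restrictScalars k := by
      refine Submodule.span_le.2 ?_
      rintro _ ⟨j, r, _, _, rfl⟩
      exact Submodule.smul_mem (Submodule.span k[T;T⁻¹] (Set.range e)) _
        (Submodule.subset_span (Set.mem_range_self j))
    exact this hv
  have hli : LinearIndependent k[T;T⁻¹] e := by
    rw [linearIndependent_iff']
    intro s g hg
    by_contra hne
    push Not at hne
    obtain ⟨j₀, hj₀, hgj₀⟩ := hne
    let X : Finset (ι × ℤ) := s.biUnion fun j => (g j).coeff.support.image fun r => (j, r)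
    have hX : ∀ x : ι × ℤ, x ∈ X ↔ x.1 ∈ s ∧ (g x.1).coeff x.2 ≠ 0 := by
      rintro ⟨j, r⟩
      simp [X]
    have hsum : ∑ x ∈ X, (g x.1).coeff x.2 • ((T x.2 : k[T;T⁻¹]) • e x.1) = 0 := by
      rw [← hg, Finset.sum_biUnion]
      · refine Finset.sum_congr rfl fun j _ => ?_
        rw [Finset.sum_image (by intro a _ b _ h; exact (Prod.mk.inj h).2),
          laurent_smul_eq_sum (g j)]
      · intro j _ j' _ hjj'
        simp only [Function.onFun, Finset.disjoint_left, Finset.mem_image, not_exists]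
        rintro _ ⟨r, _, rfl⟩ r' ⟨_, h⟩
        exact hjj' (Prod.mk.inj h).1.symm
    have hXne : X.Nonempty := by
      obtain ⟨r, hr⟩ : ∃ r, (g j₀).coeff r ≠ 0 := by
        by_contra h
        push Not at h
        exact hgj₀ (LaurentPolynomial.ext h)
      exact ⟨(j₀, r), (hX _).2 ⟨hj₀, hr⟩⟩
    let key : ι × ℤ → ℤ ×ₗ ℤ := fun x => toLex (α x.1 + m * x.2, β x.1 - m * x.2)
    obtain ⟨x₀, hx₀, hmin⟩ := X.exists_min_image key hXne
    set a := α x₀.1 + m * x₀.2 with ha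
    set b := β x₀.1 - m * x₀.2 with hb
    have hkey : ∀ x : ι × ℤ, key x = key x₀ → x.1.1 = x₀.1.1 ∧ x.2 = x₀.2 := by
      rintro ⟨⟨⟨⟨a₁, h1⟩, b₁⟩, i₁⟩, r₁⟩ h
      obtain ⟨⟨⟨⟨a₂, h2⟩, b₂⟩, i₂⟩, r₂⟩ := x₀
      have h' := toLex.injective h
      obtain ⟨h3, h4⟩ := Prod.mk.inj h'
      simp only [α, β] at h3 h4
      have hr : r₁ = r₂ := by
        by_contra hne
        rcases lt_or_gt_of_ne hne with hlt | hlt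
        · have : m * (r₁ + 1) ≤ m * r₂ := mul_le_mul_of_nonneg_left (by lia) hm.le
          nlinarith
        · have : m * (r₂ + 1) ≤ m * r₁ := mul_le_mul_of_nonneg_left (by lia) hm.le
          nlinarith
      subst hr
      refine ⟨?_, rfl⟩
      have : a₁ = a₂ := by linarith
      subst this
      have : b₁ = b₂ := by linarith
      subst this
      rfl
    set u := ∑ x ∈ X with key x = key x₀, (g x.1).coeff x.2 • ((T x.2 : k[T;T⁻¹]) • e x.1) with hu
    set w := ∑ x ∈ X with ¬ key x = key x₀,
      (g x.1).coeff x.2 • ((T x.2 : k[T;T⁻¹]) • e x.1) with hw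
    have huw : u + w = 0 := by rw [hu, hw, Finset.sum_filter_add_sum_filter_not, hsum]
    have hwmem : w ∈ P (a + 1) ⊔ M a (b + 1) := by
      refine Submodule.sum_mem _ fun x hx => Submodule.smul_mem _ _ ?_
      obtain ⟨hxX, hxk⟩ := Finset.mem_filter.1 hx
      have hlt := lt_of_le_of_ne (hmin x hxX) (Ne.symm hxk)
      rw [Prod.Lex.lt_iff] at hlt
      have hxm := heT x.1 x.2
      rcases hlt with hlt | ⟨heq, hlt⟩
      · refine Submodule.mem_sup_left (hP ?_ hxm.1)
        change a < _ at hlt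
        exact hlt
      · refine Submodule.mem_sup_right (hMmono ?_ ?_ hxm)
        · exact le_of_eq heq
        · change b < _ at hlt
          exact hlt
    have hterm : ∀ x ∈ X.filter (fun x => key x = key x₀),
        (g x.1).coeff x.2 • ((T x.2 : k[T;T⁻¹]) • e x.1) =
          (T x₀.2 : k[T;T⁻¹]) • ((g x.1).coeff x₀.2 • e x.1) := by
      intro x hx
      rw [(hkey x (Finset.mem_filter.1 hx).2).2, smul_comm]
    set u₀ := ∑ x ∈ X with key x = key x₀, (g x.1).coeff x₀.2 • e x.1 with hu₀
    have huu₀ : u = (T x₀.2 : k[T;T⁻¹]) • u₀ := by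
      rw [hu, hu₀, Finset.smul_sum]
      exact Finset.sum_congr rfl hterm
    have hu₀C : u₀ ∈ C x₀.1.1.1 x₀.1.1.2 := by
      refine Submodule.sum_mem _ fun x hx => Submodule.smul_mem _ _ ?_
      rw [← (hkey x (Finset.mem_filter.1 hx).2).1]
      exact Subtype.property _
    have humem : u ∈ M a b := by
      rw [huu₀]
      exact hMT _ _ _ _ (hCM _ _ hu₀C)
    have huN : u ∈ N a b := by
      have : u ∈ P (a + 1) ⊔ M a (b + 1) := by
        rw [eq_neg_of_add_eq_zero_left huw]
        exact Submodule.neg_mem _ hwmem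
      obtain ⟨f, hf, n, hn, hfn⟩ := Submodule.mem_sup.1 this
      refine Submodule.mem_sup.2 ⟨f, ⟨hf, ?_⟩, n, hn, hfn⟩
      rw [eq_sub_of_add_eq hfn]
      exact Submodule.sub_mem _ humem.2 (hQ (by lia) hn.2)
    have hu₀N : u₀ ∈ N x₀.1.1.1 x₀.1.1.2 := by
      have := hNT _ _ (-x₀.2) _ huN
      rw [huu₀, T_neg_smul_T_smul] at this
      convert this using 2
      · simp [ha, α]
      · simp [hb, β]
    have hu₀z : u₀ = 0 := by
      have : u₀ ∈ C x₀.1.1.1 x₀.1.1.2 ⊓ N x₀.1.1.1 x₀.1.1.2 := ⟨hu₀C, hu₀N⟩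
      rwa [hCN, Submodule.mem_bot] at this
    let bs := Module.Basis.ofVectorSpace k (C x₀.1.1.1 x₀.1.1.2)
    let emb : Module.Basis.ofVectorSpaceIndex k (C x₀.1.1.1 x₀.1.1.2) → ι × ℤ :=
      fun i => (⟨x₀.1.1, i⟩, x₀.2)
    have hemb : Function.Injective emb := by
      intro i i' h
      have h1 : (⟨x₀.1.1, i⟩ : ι) = ⟨x₀.1.1, i'⟩ := (Prod.mk.inj h).1
      exact eq_of_heq (Sigma.mk.inj h1).2
    have hz : ∑ i ∈ X.preimage emb hemb.injOn, (g (emb i).1).coeff x₀.2 • bs i = 0 := by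
      apply Subtype.val_injective
      rw [Submodule.coe_sum, Submodule.coe_zero, ← hu₀z, hu₀]
      simp only [Submodule.coe_smul]
      have h1 := Finset.sum_preimage emb X hemb.injOn
        (fun x => if key x = key x₀ then (g x.1).coeff x₀.2 • e x.1 else 0) ?_
      · rw [Finset.sum_filter, ← h1]
        refine Finset.sum_congr rfl fun i _ => ?_
        rw [if_pos rfl]
      · rintro ⟨⟨p, i⟩, r⟩ _ hx
        rw [if_neg]
        intro h
        obtain ⟨h2, h3⟩ := hkey _ h
        simp only at h2 h3
        subst h2 h3
        exact hx ⟨i, rfl⟩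
    have hx₀' : x₀.1.2 ∈ X.preimage emb hemb.injOn := by
      rw [Finset.mem_preimage]
      exact hx₀
    have := linearIndependent_iff'.1 bs.linearIndependent _ _ hz _ hx₀'
    exact ((hX _).1 hx₀).2 this
  let B := Module.Basis.mk hli htop
  have hBe : ∀ j, B j = e j := fun j => Module.Basis.mk_apply hli htop j
  have hexp : ∀ v, v = ∑ j ∈ (B.repr v).support, ∑ r ∈ (B.repr v j).coeff.support,
      (B.repr v j).coeff r • ((T r : k[T;T⁻¹]) • e j) := by
    intro v
    conv_lhs => rw [← B.linearCombination_repr v, Finsupp.linearCombination_apply, Finsupp.sum]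
    refine Finset.sum_congr rfl fun j _ => ?_
    rw [hBe, laurent_smul_eq_sum]
  have hScoef : ∀ a b v, v ∈ S a b → ∀ j r, (B.repr v j).coeff r ≠ 0 →
      a ≤ α j + m * r ∧ b ≤ β j - m * r := by
    intro a b v hv j r
    induction hv using Submodule.span_induction with
    | mem x hx =>
      obtain ⟨j', r', h1, h2, rfl⟩ := hx
      rw [← hBe, map_smul, B.repr_self]
      intro h
      by_cases hj : j' = j
      · subst hj
        by_cases hr : r' = r
        · subst hr; exact ⟨h1, h2⟩
        · simp [T_apply, hr] at h
      · simp [hj] at h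
    | zero => simp
    | add x y _ _ hx hy =>
      intro h
      by_cases h1 : (B.repr x j).coeff r = 0
      · refine hy fun h2 => h ?_
        simp [h1, h2]
      · exact hx h1
    | smul c x _ hx =>
      intro h
      refine hx fun h2 => h ?_
      have : B.repr (c • x) = c • B.repr x :=
        ((B.repr : V ≃ₗ[k[T;T⁻¹]] _).restrictScalars k).map_smul c x
      simp [this, h2]
  refine ⟨ι, B, α, β, fun v a => ⟨fun hv j r h => ?_, fun h => ?_⟩,
    fun v b => ⟨fun hv j r h => ?_, fun h => ?_⟩⟩
  · obtain ⟨b, hb⟩ := hQe v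
    exact (hScoef a b v (hMS' a b ⟨hv, hb⟩) j r h).1
  · rw [hexp v]
    refine Submodule.sum_mem _ fun j _ => Submodule.sum_mem _ fun r hr =>
      Submodule.smul_mem _ _ (hP (h j r (Finsupp.mem_support_iff.1 hr)) (heT j r).1)
  · obtain ⟨a, ha⟩ := hPe v
    exact (hScoef a b v (hMS' a b ⟨ha, hv⟩) j r h).2
  · rw [hexp v]
    refine Submodule.sum_mem _ fun j _ => Submodule.sum_mem _ fun r hr =>
      Submodule.smul_mem _ _ (hQ (h j r (Finsupp.mem_support_iff.1 hr)) (heT j r).2)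

end Birkhoff

/-- A Lie algebra over `k[t, t⁻¹]` with a compatible `ℤ`-grading (given by its projections `pr`)
and the associated degree derivation `δ`, whose Killing form is nondegenerate in degree zero. -/
structure LoopGrading (k L : Type) [Field k] [LieRing L] [LieAlgebra k[T;T⁻¹] L]
    [LieAlgebra k L] (m : ℤ) where
  pr : ℤ → L →ₗ[k] L
  δ : L →ₗ[k] L
  m_pos : 0 < m
  pr_self : ∀ p l, pr p (pr p l) = pr p l
  pr_ne : ∀ p q l, p ≠ q → pr p (pr q l) = 0
  exists_sum : ∀ l, ∃ s : Finset ℤ, l = ∑ p ∈ s, pr p l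
  pr_T : ∀ p l, pr (p + m) ((T 1 : k[T;T⁻¹]) • l) = (T 1 : k[T;T⁻¹]) • pr p l
  pr_lie : ∀ p q x y, pr (p + q) ⁅pr p x, pr q y⁆ = ⁅pr p x, pr q y⁆
  pr_finite : ∀ p, FiniteDimensional k (LinearMap.range (pr p))
  pr_δ : ∀ p l, pr p (δ l) = (p : k) • pr p l
  nondeg : ∀ x, (∀ y, (killingForm k[T;T⁻¹] L x y).coeff 0 = 0) → x = 0

/-- The degree zero coefficient of the trace. -/
def tau {k L : Type} [Field k] [AddCommGroup L] [Module k[T;T⁻¹] L]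
    (φ : Module.End k[T;T⁻¹] L) : k :=
  (LinearMap.trace k[T;T⁻¹] L φ).coeff 0

section Tau

variable {k L : Type} [Field k] [AddCommGroup L] [Module k[T;T⁻¹] L]

theorem tau_add (φ ψ : Module.End k[T;T⁻¹] L) : tau (φ + ψ) = tau φ + tau ψ := by
  simp [tau]

theorem tau_sub (φ ψ : Module.End k[T;T⁻¹] L) : tau (φ - ψ) = tau φ - tau ψ := by
  simp [tau]

theorem tau_mul_comm (φ ψ : Module.End k[T;T⁻¹] L) : tau (φ * ψ) = tau (ψ * φ) := by
  simp [tau, LinearMap.trace_mul_comm]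

theorem tau_zero : tau (0 : Module.End k[T;T⁻¹] L) = 0 := by
  simp [tau]

theorem tau_sum {ι : Type} (s : Finset ι) (f : ι → Module.End k[T;T⁻¹] L) :
    tau (∑ i ∈ s, f i) = ∑ i ∈ s, tau (f i) := by
  simp [tau]

end Tau

section LieTau

variable {k L : Type} [Field k] [LieRing L] [LieAlgebra k[T;T⁻¹] L]
  [LieAlgebra k L] [IsScalarTower k k[T;T⁻¹] L]

theorem tau_ad_smul_left (φ : Module.End k[T;T⁻¹] L) (c : k) (x : L) :
    tau (LieAlgebra.ad k[T;T⁻¹] L (c • x) * φ) = c * tau (LieAlgebra.ad k[T;T⁻¹] L x * φ) := by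
  rw [← algebraMap_smul k[T;T⁻¹] c x, map_smul, smul_mul_assoc, tau, map_smul,
    algebraMap_smul, AddMonoidAlgebra.coeff_smul]
  rfl

theorem tau_ad_smul_right (φ : Module.End k[T;T⁻¹] L) (c : k) (x : L) :
    tau (φ * LieAlgebra.ad k[T;T⁻¹] L (c • x)) = c * tau (φ * LieAlgebra.ad k[T;T⁻¹] L x) := by
  rw [tau_mul_comm, tau_ad_smul_left, tau_mul_comm]

/-- The degree zero coefficient of the Killing form over `k[t, t⁻¹]`. -/
def form (k L : Type) [Field k] [LieRing L] [LieAlgebra k[T;T⁻¹] L]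
    [LieAlgebra k L] [IsScalarTower k k[T;T⁻¹] L] : L →ₗ[k] L →ₗ[k] k :=
  LinearMap.mk₂ k (fun x y => tau (LieAlgebra.ad k[T;T⁻¹] L x * LieAlgebra.ad k[T;T⁻¹] L y))
    (fun x y z => by simp only [map_add, add_mul, tau_add])
    (fun c x y => tau_ad_smul_left _ c x)
    (fun x y z => by simp only [map_add, mul_add, tau_add])
    (fun c x y => tau_ad_smul_right _ c y)

theorem form_apply (x y : L) : form k L x y =
    tau (LieAlgebra.ad k[T;T⁻¹] L x * LieAlgebra.ad k[T;T⁻¹] L y) := rfl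

theorem form_eq_killingForm (x y : L) :
    form k L x y = (killingForm k[T;T⁻¹] L x y).coeff 0 := rfl

theorem form_comm (x y : L) : form k L x y = form k L y x := by
  rw [form_apply, tau_mul_comm, form_apply]

theorem form_lie (x y z : L) : form k L ⁅x, y⁆ z = form k L x ⁅y, z⁆ := by
  rw [form_eq_killingForm, form_eq_killingForm, LieModule.traceForm_apply_lie_apply]

end LieTau

theorem ad_lie_eq {k L : Type} [Field k] [LieRing L] [LieAlgebra k[T;T⁻¹] L] (y z : L) :
    LieAlgebra.ad k[T;T⁻¹] L ⁅y, z⁆ =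
    LieAlgebra.ad k[T;T⁻¹] L y * LieAlgebra.ad k[T;T⁻¹] L z -
      LieAlgebra.ad k[T;T⁻¹] L z * LieAlgebra.ad k[T;T⁻¹] L y := by
  ext w
  simp

namespace LoopGrading

variable {k L : Type} [Field k] [LieRing L] [LieAlgebra k[T;T⁻¹] L]
  [LieAlgebra k L] {m : ℤ} (G : LoopGrading k L m)

theorem eq_zero_of_pr {x : L} (h : ∀ p, G.pr p x = 0) : x = 0 := by
  obtain ⟨s, hs⟩ := G.exists_sum x
  rw [hs]
  exact Finset.sum_eq_zero fun p _ => h p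

theorem ext_pr {x y : L} (h : ∀ p, G.pr p x = G.pr p y) : x = y :=
  sub_eq_zero.1 (G.eq_zero_of_pr fun p => by rw [map_sub, h, sub_self])

theorem pr_pr (p q : ℤ) (l : L) : G.pr p (G.pr q l) = if p = q then G.pr q l else 0 := by
  split_ifs with h
  · rw [h, G.pr_self]
  · exact G.pr_ne p q l h

theorem pr_lie' (r p q : ℤ) (x y : L) :
    G.pr r ⁅G.pr p x, G.pr q y⁆ = if r = p + q then ⁅G.pr p x, G.pr q y⁆ else 0 := by
  rw [← G.pr_lie, G.pr_pr]

/-- An additive property holds everywhere if it holds for homogeneous elements. -/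
theorem induction_pr {motive : L → Prop} (hadd : ∀ x y, motive x → motive y → motive (x + y))
    (h0 : motive 0) (h : ∀ p l, motive (G.pr p l)) (l : L) : motive l := by
  obtain ⟨s, hs⟩ := G.exists_sum l
  rw [hs]
  exact Finset.sum_induction _ motive hadd h0 fun p _ => h p l

theorem δ_pr (p : ℤ) (l : L) : G.δ (G.pr p l) = (p : k) • G.pr p l := by
  refine G.ext_pr fun q => ?_
  rw [G.pr_δ, map_smul, G.pr_pr]
  split_ifs with h
  · rw [h]
  · simp

theorem δ_lie (x y : L) : G.δ ⁅x, y⁆ = ⁅G.δ x, y⁆ + ⁅x, G.δ y⁆ := by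
  refine G.induction_pr (motive := fun x => G.δ ⁅x, y⁆ = ⁅G.δ x, y⁆ + ⁅x, G.δ y⁆) ?_ ?_ ?_ x
  · intro x x' h h'
    simp only [add_lie, map_add, h, h']
    abel
  · simp
  · intro p x
    refine G.induction_pr (motive := fun y => G.δ ⁅G.pr p x, y⁆ =
      ⁅G.δ (G.pr p x), y⁆ + ⁅G.pr p x, G.δ y⁆) ?_ ?_ ?_ y
    · intro y y' h h'
      simp only [lie_add, map_add, h, h']
      abel
    · simp
    · intro q y
      rw [← G.pr_lie, G.δ_pr, G.pr_lie, G.δ_pr, G.δ_pr, smul_lie, lie_smul, ← add_smul]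
      push_cast
      rfl

theorem pr_T_zpow (r p : ℤ) (l : L) :
    G.pr (p + m * r) ((T r : k[T;T⁻¹]) • l) = (T r : k[T;T⁻¹]) • G.pr p l := by
  induction r using Int.induction_on generalizing p l with
  | zero => simp
  | succ r ih =>
    rw [add_comm (r : ℤ) 1, ← T_smul_T_smul, ← T_smul_T_smul, ← ih, ← G.pr_T]
    congr 1
    ring_nf
  | pred r ih =>
    have h := G.pr_T (p + m * (-r - 1)) ((T (-r - 1) : k[T;T⁻¹]) • l)
    rw [T_smul_T_smul] at h
    have h2 := congrArg (fun x => (T (-1) : k[T;T⁻¹]) • x) h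
    simp only [T_neg_smul_T_smul] at h2
    rw [← h2, show (1 : ℤ) + (-r - 1) = -r by ring,
      show p + m * (-r - 1) + m = p + m * (-r) by ring, ih, T_smul_T_smul]
    congr 2
    ring

theorem pr_T_smul (r p : ℤ) (l : L) :
    G.pr p ((T r : k[T;T⁻¹]) • l) = (T r : k[T;T⁻¹]) • G.pr (p - m * r) l := by
  rw [← G.pr_T_zpow, sub_add_cancel]

theorem δ_T (r : ℤ) (l : L) [IsScalarTower k k[T;T⁻¹] L] :
    G.δ ((T r : k[T;T⁻¹]) • l) = (T r : k[T;T⁻¹]) • G.δ l +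
      ((m * r : ℤ) : k) • (T r : k[T;T⁻¹]) • l := by
  refine G.ext_pr fun p => ?_
  simp only [G.pr_δ, map_add, map_smul, G.pr_T_smul]
  rw [smul_comm (T r : k[T;T⁻¹]), ← add_smul]
  push_cast
  ring_nf

/-- The filtration by degree, increasing (`ε = 1`) or decreasing (`ε = -1`). -/
def Fil (ε a : ℤ) : Submodule k L where
  carrier := {l | ∀ p, ε * p < a → G.pr p l = 0}
  add_mem' := fun {x y} hx hy p hp => by rw [map_add, hx p hp, hy p hp, add_zero]
  zero_mem' := fun p _ => map_zero _
  smul_mem' := fun c x hx p hp => by rw [map_smul, hx p hp, smul_zero]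

theorem Fil_anti (ε : ℤ) : Antitone (G.Fil ε) := fun _ _ h _ hl p hp => hl p (hp.trans_le h)

theorem T_mem_Fil {ε a : ℤ} (r : ℤ) {l : L} (hl : l ∈ G.Fil ε a) :
    (T r : k[T;T⁻¹]) • l ∈ G.Fil ε (a + ε * m * r) := by
  intro p hp
  rw [G.pr_T_smul, hl _ (by linarith), smul_zero]

theorem lie_mem_Fil {ε a b : ℤ} {x y : L} (hx : x ∈ G.Fil ε a) (hy : y ∈ G.Fil ε b) :
    ⁅x, y⁆ ∈ G.Fil ε (a + b) := by
  intro r hr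
  obtain ⟨s, hs⟩ := G.exists_sum x
  obtain ⟨t, ht⟩ := G.exists_sum y
  rw [hs, ht]
  simp only [sum_lie, lie_sum, map_sum]
  refine Finset.sum_eq_zero fun q _ => Finset.sum_eq_zero fun p _ => ?_
  rw [G.pr_lie']
  split_ifs with h
  · subst h
    rcases lt_or_ge (ε * p) a with h1 | h1
    · rw [hx p h1, zero_lie]
    · rw [hy q (by linarith), lie_zero]
  · rfl

theorem pr_mem_Fil {ε a p : ℤ} (h : a ≤ ε * p) (l : L) : G.pr p l ∈ G.Fil ε a := by
  intro q hq
  rw [G.pr_ne]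
  rintro rfl
  exact absurd hq (not_lt.2 h)

theorem exists_mem_Fil (ε : ℤ) (l : L) : ∃ a, l ∈ G.Fil ε a := by
  refine G.induction_pr (motive := fun l => ∃ a, l ∈ G.Fil ε a) ?_ ⟨0, zero_mem _⟩
    (fun p l => ⟨ε * p, G.pr_mem_Fil le_rfl l⟩) l
  rintro x y ⟨a, ha⟩ ⟨b, hb⟩
  exact ⟨min a b, add_mem (G.Fil_anti ε (min_le_left a b) ha)
    (G.Fil_anti ε (min_le_right a b) hb)⟩

theorem Fil_inf {ε a b : ℤ} (h : 0 < a + b) : G.Fil ε a ⊓ G.Fil (-ε) b = ⊥ := by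
  rw [eq_bot_iff]
  rintro x ⟨hx, hy⟩
  refine (Submodule.mem_bot k).2 (G.eq_zero_of_pr fun p => ?_)
  rcases lt_or_ge (ε * p) a with h1 | h1
  · exact hx p h1
  · exact hy p (by linarith)

theorem finite_Fil_inf (a b : ℤ) : FiniteDimensional k ↥(G.Fil 1 a ⊓ G.Fil (-1) b) := by
  have := G.pr_finite
  have hfin : FiniteDimensional k ↥(⨆ p ∈ Finset.Icc a (-b), LinearMap.range (G.pr p)) := by
    rw [← Finset.sup_eq_iSup]
    exact Submodule.finiteDimensional_finset_sup _ _
  refine Submodule.finiteDimensional_of_le (S₂ := ⨆ p ∈ Finset.Icc a (-b),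
    LinearMap.range (G.pr p)) ?_
  rintro l ⟨h1, h2⟩
  obtain ⟨s, hs⟩ := G.exists_sum l
  rw [hs]
  refine Submodule.sum_mem _ fun p _ => ?_
  by_cases hp : p ∈ Finset.Icc a (-b)
  · exact Submodule.mem_iSup_of_mem p (Submodule.mem_iSup_of_mem hp ⟨l, rfl⟩)
  · have : G.pr p l = 0 := by
      rw [Finset.mem_Icc, not_and_or] at hp
      rcases hp with hp | hp
      · exact h1 p (by lia)
      · exact h2 p (by lia)
    rw [this]
    exact zero_mem _

/-- A periodic filtration commensurable with the filtration by degree. -/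
structure Lat (ε : ℤ) (Q : ℤ → Submodule k L) : Prop where
  anti : Antitone Q
  T_mem : ∀ a r v, v ∈ Q a → (T r : k[T;T⁻¹]) • v ∈ Q (a + ε * m * r)
  bound : ∃ C, ∀ a, G.Fil ε (a + C) ≤ Q a ∧ Q a ≤ G.Fil ε (a - C)

theorem lat_Fil (ε : ℤ) : G.Lat ε (G.Fil ε) where
  anti := G.Fil_anti ε
  T_mem := fun _ r _ hv => G.T_mem_Fil r hv
  bound := ⟨0, by simp⟩

variable {G}

theorem Lat.exists_mem {ε : ℤ} {Q : ℤ → Submodule k L} (hQ : G.Lat ε Q) (l : L) :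
    ∃ a, l ∈ Q a := by
  obtain ⟨a, ha⟩ := G.exists_mem_Fil ε l
  obtain ⟨C, hC⟩ := hQ.bound
  exact ⟨a - C, (hC _).1 (by simpa using ha)⟩

theorem Lat.exists_inf {ε : ℤ} {P Q : ℤ → Submodule k L} (hP : G.Lat ε P)
    (hQ : G.Lat (-ε) Q) : ∃ K, ∀ a b, K ≤ a + b → P a ⊓ Q b = ⊥ := by
  obtain ⟨C, hC⟩ := hP.bound
  obtain ⟨C', hC'⟩ := hQ.bound
  refine ⟨C + C' + 1, fun a b h => ?_⟩
  rw [eq_bot_iff, ← G.Fil_inf (ε := ε) (a := a - C) (b := b - C') (by linarith)]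
  exact inf_le_inf (hC _).2 (hC' _).2

variable [IsScalarTower k k[T;T⁻¹] L]

theorem Lat.exists_basis {ε : ℤ} (hε : ε = 1 ∨ ε = -1) {P Q : ℤ → Submodule k L}
    (hP : G.Lat ε P) (hQ : G.Lat (-ε) Q) :
    ∃ (ι : Type) (B : Module.Basis ι k[T;T⁻¹] L) (α β : ι → ℤ),
      (∀ v a, v ∈ P a ↔ ∀ j r, (B.repr v j).coeff r ≠ 0 → a ≤ α j + ε * m * r) ∧
      (∀ v b, v ∈ Q b ↔ ∀ j r, (B.repr v j).coeff r ≠ 0 → b ≤ β j - ε * m * r) := by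
  obtain ⟨K, hK⟩ := hP.exists_inf hQ
  rcases hε with rfl | rfl
  · obtain ⟨ι, B, α, β, h1, h2⟩ := exists_adapted_basis G.m_pos hP.anti hQ.anti
      (fun a r v hv => by simpa using hP.T_mem a r v hv)
      (fun a r v hv => by simpa [sub_eq_add_neg] using hQ.T_mem a r v hv)
      hP.exists_mem hQ.exists_mem hK
    exact ⟨ι, B, α, β, by simpa using h1, by simpa using h2⟩
  · obtain ⟨ι, B, α, β, h1, h2⟩ := exists_adapted_basis G.m_pos hQ.anti hP.anti
      (fun a r v hv => by simpa using hQ.T_mem a r v hv)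
      (fun a r v hv => by simpa [sub_eq_add_neg] using hP.T_mem a r v hv)
      hQ.exists_mem hP.exists_mem (fun a b h => by rw [inf_comm]; exact hK b a (by linarith))
    exact ⟨ι, B, β, α, by simpa [sub_eq_add_neg] using h2, by simpa using h1⟩

theorem eq_zero_of_form (G : LoopGrading k L m)
    {x : L} (h : ∀ y, form k L x y = 0) : x = 0 := G.nondeg x h

theorem Lat.tau_eq_zero [Module.Finite k[T;T⁻¹] L] {ε : ℤ} (hε : ε = 1 ∨ ε = -1)
    {Q : ℤ → Submodule k L} (hQ : G.Lat ε Q) {φ : Module.End k[T;T⁻¹] L}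
    (hφ : ∀ a v, v ∈ Q a → φ v ∈ Q (a + 1)) : tau φ = 0 := by
  classical
  obtain ⟨ι, B, α, β, h1, -⟩ := hQ.exists_basis hε (G.lat_Fil (-ε))
  have : Finite ι := Module.Finite.finite_basis B
  have : Fintype ι := Fintype.ofFinite ι
  rw [tau, LinearMap.trace_eq_matrix_trace _ B, Matrix.trace]
  simp only [Matrix.diag_apply, LinearMap.toMatrix_apply, AddMonoidAlgebra.coeff_sum,
    Finsupp.coe_finsetSum, Finset.sum_apply]
  refine Finset.sum_eq_zero fun j _ => ?_
  by_contra hne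
  have hBj : B j ∈ Q (α j) := by
    rw [h1]
    intro j' r h
    rw [B.repr_self] at h
    by_cases hj : j = j'
    · subst hj
      by_cases hr : r = 0
      · subst hr; simp
      · rw [Finsupp.single_eq_same, ← T_zero, T_apply] at h
        simp [Ne.symm hr] at h
    · simp [hj] at h
  have := (h1 _ _).1 (hφ _ _ hBj) j 0 hne
  simp at this

end LoopGrading

namespace LoopGrading

variable {k L : Type} [Field k] [LieRing L] [LieAlgebra k[T;T⁻¹] L]
  [LieAlgebra k L] [IsScalarTower k k[T;T⁻¹] L] [Module.Finite k[T;T⁻¹] L]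
  {m : ℤ} (G : LoopGrading k L m)

theorem form_eq_zero_of_mem_Fil {ε : ℤ} (hε : ε = 1 ∨ ε = -1) {a b : ℤ} (hab : 1 ≤ a + b) {x y : L}
    (hx : x ∈ G.Fil ε a) (hy : y ∈ G.Fil ε b) : form k L x y = 0 := by
  refine (G.lat_Fil ε).tau_eq_zero hε fun c v hv => ?_
  have := G.lie_mem_Fil hx (G.lie_mem_Fil hy hv)
  exact G.Fil_anti ε (by linarith) this

theorem form_pr_pr {p q : ℤ} (h : p + q ≠ 0) (x y : L) :
    form k L (G.pr p x) (G.pr q y) = 0 := by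
  rcases lt_or_gt_of_ne h with h | h
  · exact G.form_eq_zero_of_mem_Fil (ε := -1) (Or.inr rfl) (a := -p) (b := -q) (by lia)
      (G.pr_mem_Fil (by lia) _) (G.pr_mem_Fil (by lia) _)
  · exact G.form_eq_zero_of_mem_Fil (ε := 1) (Or.inl rfl) (a := p) (b := q) (by lia)
      (G.pr_mem_Fil (by lia) _) (G.pr_mem_Fil (by lia) _)

theorem form_pr_left (p : ℤ) (x y : L) : form k L (G.pr p x) y = form k L x (G.pr (-p) y) := by
  refine G.induction_pr (motive := fun x => form k L (G.pr p x) y = form k L x (G.pr (-p) y))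
    ?_ ?_ ?_ x
  · intro x x' h h'
    simp only [map_add, LinearMap.add_apply, h, h']
  · simp
  · intro q x
    refine G.induction_pr (motive := fun y => form k L (G.pr p (G.pr q x)) y =
      form k L (G.pr q x) (G.pr (-p) y)) ?_ ?_ ?_ y
    · intro y y' h h'
      simp only [map_add, h, h']
    · simp
    · intro r y
      rw [G.pr_pr, G.pr_pr]
      split_ifs with h1 h2 h2
      · rfl
      · rw [map_zero, G.form_pr_pr]
        lia
      · rw [map_zero, LinearMap.zero_apply, G.form_pr_pr]
        lia
      · simp

theorem mem_Fil_of_form {ε a : ℤ} (hε : ε = 1 ∨ ε = -1) {x : L}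
    (h : ∀ y ∈ G.Fil ε a, form k L x y = 0) : x ∈ G.Fil ε (1 - a) := by
  intro p hp
  refine G.eq_zero_of_form fun y => ?_
  rw [G.form_pr_left]
  refine h _ (G.pr_mem_Fil ?_ _)
  rcases hε with rfl | rfl <;> lia

theorem exists_form_eq_of_degree (f : L →ₗ[k] k) (p : ℤ) :
    ∃ x, ∀ y, form k L x y = f (G.pr (-p) y) := by
  have := G.pr_finite p
  have := G.pr_finite (-p)
  let Φ : LinearMap.range (G.pr p) →ₗ[k] LinearMap.range (G.pr (-p)) →ₗ[k] k :=
    (form k L).domRestrict₁₂ _ _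
  have hΦ : Φ.IsPerfPair := by
    refine LinearMap.IsPerfPair.of_injective ?_ ?_
    · rw [← LinearMap.ker_eq_bot, eq_bot_iff]
      rintro ⟨_, x, rfl⟩ hx
      rw [LinearMap.mem_ker] at hx
      refine (Submodule.mem_bot k).2 (Subtype.ext (G.eq_zero_of_form fun y => ?_))
      change form k L (G.pr p x) y = 0
      have := LinearMap.congr_fun hx ⟨_, y, rfl⟩
      change form k L (G.pr p x) (G.pr (-p) y) = 0 at this
      rw [← G.pr_self, G.form_pr_left]
      exact this
    · rw [← LinearMap.ker_eq_bot, eq_bot_iff]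
      rintro ⟨_, x, rfl⟩ hx
      rw [LinearMap.mem_ker] at hx
      refine (Submodule.mem_bot k).2 (Subtype.ext (G.eq_zero_of_form fun y => ?_))
      change form k L (G.pr (-p) x) y = 0
      have := LinearMap.congr_fun hx ⟨_, y, rfl⟩
      change form k L (G.pr p y) (G.pr (-p) x) = 0 at this
      rw [← G.pr_self, G.form_pr_left, neg_neg, form_comm]
      exact this
  obtain ⟨⟨_, x, rfl⟩, hx⟩ := Φ.toPerfPair.surjective (f ∘ₗ Submodule.subtype _)
  refine ⟨G.pr p x, fun y => ?_⟩
  rw [← G.pr_self, G.form_pr_left]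
  exact LinearMap.congr_fun hx ⟨_, y, rfl⟩

/-- A functional vanishing in large positive and negative degrees is represented by the form. -/
theorem exists_form_eq (f : L →ₗ[k] k)
    (h : ∀ ε : ℤ, ε = 1 ∨ ε = -1 → ∃ N, ∀ l ∈ G.Fil ε N, f l = 0) :
    ∃ x, ∀ y, form k L x y = f y := by
  obtain ⟨N, hN⟩ := h 1 (Or.inl rfl)
  obtain ⟨N', hN'⟩ := h (-1) (Or.inr rfl)
  choose X hX using G.exists_form_eq_of_degree f
  refine ⟨∑ p ∈ Finset.Icc (-N) N', X p, fun y => ?_⟩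
  refine G.induction_pr (motive := fun y =>
    form k L (∑ p ∈ Finset.Icc (-N) N', X p) y = f y) ?_ ?_ ?_ y
  · intro y y' h h'
    rw [map_add, map_add, h, h']
  · simp
  · intro q y
    rw [map_sum, LinearMap.sum_apply]
    simp only [hX, G.pr_pr]
    by_cases hq : -q ∈ Finset.Icc (-N) N'
    · rw [Finset.sum_eq_single_of_mem _ hq]
      · simp
      · intro p _ hp
        rw [if_neg, map_zero]
        lia
    · have : f (G.pr q y) = 0 := by
        rw [Finset.mem_Icc, not_and_or] at hq
        rcases hq with hq | hq
        · exact hN _ (G.pr_mem_Fil (by lia) _)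
        · exact hN' _ (G.pr_mem_Fil (by lia) _)
      rw [this]
      refine Finset.sum_eq_zero fun p _ => ?_
      split_ifs
      · exact this
      · simp

theorem exists_bound {ε : ℤ} (hε : ε = 1 ∨ ε = -1) (ψ : Module.End k[T;T⁻¹] L) :
    ∃ C, ∀ a v, v ∈ G.Fil ε a → ψ v ∈ G.Fil ε (a - C) := by
  obtain ⟨ι, B, α, β, h1, -⟩ := (G.lat_Fil ε).exists_basis hε (G.lat_Fil (-ε))
  have : Finite ι := Module.Finite.finite_basis B
  have : Fintype ι := Fintype.ofFinite ι
  choose A hA using fun j => G.exists_mem_Fil ε (ψ (B j))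
  obtain ⟨C, hC⟩ := Finite.exists_le fun j => α j - A j
  refine ⟨C, fun a v hv => ?_⟩
  rw [← B.sum_repr v, map_sum]
  refine Submodule.sum_mem _ fun j _ => ?_
  rw [map_smul, laurent_smul_eq_sum]
  refine Submodule.sum_mem _ fun r hr => Submodule.smul_mem _ _ ?_
  have := (h1 v a).1 hv j r (Finsupp.mem_support_iff.1 hr)
  exact G.Fil_anti ε (by linarith [hC j]) (G.T_mem_Fil r (hA j))

theorem exists_form_eq_tau (G : LoopGrading k L m) (ψ : Module.End k[T;T⁻¹] L) :
    ∃ x, ∀ y, form k L x y = tau (ψ * LieAlgebra.ad k[T;T⁻¹] L y) := by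
  let f : L →ₗ[k] k :=
    { toFun := fun y => tau (ψ * LieAlgebra.ad k[T;T⁻¹] L y)
      map_add' := fun x y => by simp only [map_add, mul_add, tau_add]
      map_smul' := fun c y => tau_ad_smul_right _ c y }
  refine G.exists_form_eq f fun ε hε => ?_
  obtain ⟨C, hC⟩ := G.exists_bound hε ψ
  refine ⟨C + 1, fun l hl => (G.lat_Fil ε).tau_eq_zero hε fun a v hv => ?_⟩
  have := hC _ _ (G.lie_mem_Fil hl hv)
  exact G.Fil_anti ε (by linarith) this

/-- Derivations over `k[t, t⁻¹]` are inner. -/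
theorem exists_ad_eq (G : LoopGrading k L m) (φ : Module.End k[T;T⁻¹] L)
    (hφ : ∀ x y, φ ⁅x, y⁆ = ⁅φ x, y⁆ + ⁅x, φ y⁆) : ∃ x : L, ∀ y, φ y = ⁅x, y⁆ := by
  obtain ⟨x, hx⟩ := G.exists_form_eq_tau φ
  refine ⟨x, fun y => sub_eq_zero.1 (G.eq_zero_of_form fun z => ?_)⟩
  have had : LieAlgebra.ad k[T;T⁻¹] L (φ y) =
      φ * LieAlgebra.ad k[T;T⁻¹] L y - LieAlgebra.ad k[T;T⁻¹] L y * φ := by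
    ext w
    simp [hφ]
  rw [map_sub, LinearMap.sub_apply, form_lie, hx, form_apply, had, sub_mul, tau_sub,
    ad_lie_eq, mul_sub, tau_sub, mul_assoc,
    mul_assoc, tau_mul_comm _ (φ * _), mul_assoc, sub_self]

variable {G}

theorem Lat.exists_separating {ε : ℤ} (hε : ε = 1 ∨ ε = -1) {Q : ℤ → Submodule k L}
    (hQ : G.Lat ε Q) {a : ℤ} {v : L} (hv : v ∉ Q a) :
    ∃ y, (∀ w ∈ Q a, form k L y w = 0) ∧ form k L y v ≠ 0 := by
  obtain ⟨ι, B, α, β, h1, h2⟩ := hQ.exists_basis hε (G.lat_Fil (-ε))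
  rw [h1] at hv
  push Not at hv
  obtain ⟨j, r, hjr, hlt⟩ := hv
  let f : L →ₗ[k] k :=
    { toFun := fun y => (B.repr y j).coeff r
      map_add' := fun x y => by simp
      map_smul' := fun c y => by
        have : B.repr (c • y) = c • B.repr y :=
          ((B.repr : L ≃ₗ[k[T;T⁻¹]] _).restrictScalars k).map_smul c y
        simp [this] }
  have hfQ : ∀ w ∈ Q a, f w = 0 := by
    intro w hw
    by_contra hne
    exact absurd ((h1 w a).1 hw j r hne) (not_le.2 hlt)
  obtain ⟨C, hC⟩ := hQ.bound
  have hf1 : ∃ N, ∀ l ∈ G.Fil ε N, f l = 0 := ⟨a + C, fun l hl => hfQ l ((hC a).1 hl)⟩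
  have hf2 : ∃ N, ∀ l ∈ G.Fil (-ε) N, f l = 0 := by
    refine ⟨β j - ε * m * r + 1, fun l hl => ?_⟩
    by_contra hne
    have := (h2 l _).1 hl j r hne
    linarith
  obtain ⟨y, hy⟩ := G.exists_form_eq f fun ε' hε' => by
    rcases hε with rfl | rfl <;> rcases hε' with rfl | rfl
    · exact hf1
    · exact hf2
    · exact hf2
    · exact hf1
  refine ⟨y, fun w hw => by rw [hy, hfQ w hw], ?_⟩
  rw [hy]
  exact hjr

end LoopGrading

/-- A grading by finitely many rational numbers of a Lie algebra over `k[t, t⁻¹]`, given by its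
projections. -/
structure FinGrading (k L : Type) [Field k] [LieRing L] [LieAlgebra k[T;T⁻¹] L] where
  s : Finset ℚ
  e : ℚ → Module.End k[T;T⁻¹] L
  e_off : ∀ q, q ∉ s → e q = 0
  sum_e : ∀ l, ∑ q ∈ s, e q l = l
  e_e : ∀ p q l, e p (e q l) = if p = q then e q l else 0
  e_lie : ∀ p q x y, e (p + q) ⁅e p x, e q y⁆ = ⁅e p x, e q y⁆

namespace FinGrading

variable {k L : Type} [Field k] [LieRing L] [LieAlgebra k[T;T⁻¹] L] (E : FinGrading k L)

theorem e_self (p : ℚ) (l : L) : E.e p (E.e p l) = E.e p l := by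
  rw [E.e_e, if_pos rfl]

theorem e_ne {p q : ℚ} (h : p ≠ q) (l : L) : E.e p (E.e q l) = 0 := by
  rw [E.e_e, if_neg h]

theorem e_apply_off {q : ℚ} (h : q ∉ E.s) (l : L) : E.e q l = 0 := by
  rw [E.e_off q h, LinearMap.zero_apply]

theorem ext_e {x y : L} (h : ∀ q, E.e q x = E.e q y) : x = y := by
  rw [← E.sum_e x, ← E.sum_e y]
  exact Finset.sum_congr rfl fun q _ => h q

theorem e_lie_e (i p q : ℚ) (x y : L) :
    E.e i ⁅E.e p x, E.e q y⁆ = if i = p + q then ⁅E.e p x, E.e q y⁆ else 0 := by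
  rw [← E.e_lie, E.e_e]

theorem e_lie_fixed {p q r : ℚ} (h : r = p + q) {x y : L} (hx : E.e p x = x) (hy : E.e q y = y) :
    E.e r ⁅x, y⁆ = ⁅x, y⁆ := by
  rw [h, ← hx, ← hy, E.e_lie]

theorem e_sum_filter (P : ℚ → Prop) [DecidablePred P] (i : ℚ) (l : L) :
    E.e i (∑ q ∈ E.s with P q, E.e q l) = if P i then E.e i l else 0 := by
  rw [map_sum]
  simp only [E.e_e]
  rw [Finset.sum_filter]
  by_cases hi : i ∈ E.s
  · rw [Finset.sum_eq_single_of_mem i hi]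
    · simp
    · intro q _ hq
      simp [Ne.symm hq]
  · rw [E.e_apply_off hi, ite_self]
    refine Finset.sum_eq_zero fun q hq => ?_
    rw [if_neg (c := i = q), ite_self]
    rintro rfl
    exact hi hq

theorem lie_eq_sum (x y : L) : ⁅x, y⁆ = ∑ p ∈ E.s, ∑ q ∈ E.s, ⁅E.e p x, E.e q y⁆ := by
  conv_lhs => rw [← E.sum_e x, ← E.sum_e y]
  simp only [sum_lie, lie_sum]
  exact Finset.sum_comm

theorem tau_eq_zero {c : ℚ} (hc : c ≠ 0) {φ : Module.End k[T;T⁻¹] L}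
    (h : ∀ r v, E.e (r + c) (φ (E.e r v)) = φ (E.e r v)) : tau φ = 0 := by
  have h1 : φ = ∑ r ∈ E.s, φ * E.e r := by
    ext v
    conv_lhs => rw [← E.sum_e v]
    simp
  rw [h1, tau_sum]
  refine Finset.sum_eq_zero fun r _ => ?_
  have h2 : φ * E.e r = E.e (r + c) * (φ * E.e r) := by
    ext v
    exact (h r v).symm
  have h3 : φ * E.e r * E.e (r + c) = 0 := by
    ext v
    simp only [Module.End.mul_apply]
    rw [E.e_ne (by simpa using hc), map_zero, LinearMap.zero_apply]
  rw [h2, tau_mul_comm, h3, tau_zero]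

variable [LieAlgebra k L] [IsScalarTower k k[T;T⁻¹] L]

theorem form_e_e {p q : ℚ} (h : p + q ≠ 0) (x y : L) : form k L (E.e p x) (E.e q y) = 0 := by
  refine E.tau_eq_zero h fun r v => ?_
  simp only [Module.End.mul_apply, LieAlgebra.ad_apply]
  rw [← E.e_lie q r y v, ← E.e_lie p (q + r), show r + (p + q) = p + (q + r) by ring, E.e_self]

theorem form_e_left (q : ℚ) (x y : L) : form k L (E.e q x) y = form k L x (E.e (-q) y) := by
  have h1 : form k L (E.e q x) y = form k L (E.e q x) (E.e (-q) y) := by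
    conv_lhs => rw [← E.sum_e y, map_sum]
    by_cases hq : -q ∈ E.s
    · refine Finset.sum_eq_single_of_mem _ hq fun r _ hr => E.form_e_e (fun h => hr ?_) _ _
      linarith
    · rw [E.e_apply_off hq, map_zero]
      refine Finset.sum_eq_zero fun r hr => E.form_e_e (fun h => hq ?_) _ _
      rwa [show -q = r by linarith]
  have h2 : form k L x (E.e (-q) y) = form k L (E.e q x) (E.e (-q) y) := by
    conv_lhs => rw [← E.sum_e x, map_sum, LinearMap.sum_apply]
    by_cases hq : q ∈ E.s
    · refine Finset.sum_eq_single_of_mem _ hq fun r _ hr => E.form_e_e (fun h => hr ?_) _ _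
      linarith
    · rw [E.e_apply_off hq, map_zero, LinearMap.zero_apply]
      refine Finset.sum_eq_zero fun r hr => E.form_e_e (fun h => hq ?_) _ _
      rwa [show q = r by linarith]
  rw [h1, h2]

end FinGrading

namespace LoopGrading

variable {k L : Type} [Field k] [LieRing L] [LieAlgebra k[T;T⁻¹] L]
  [LieAlgebra k L] [IsScalarTower k k[T;T⁻¹] L]
  {m : ℤ} (G : LoopGrading k L m) (E : FinGrading k L)

/-- The filtration associated with the graded pieces of `Fil` for the filtration by
the degree of `E`. -/
def GFil (ε a : ℤ) : Submodule k L where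
  carrier := {l | ∀ i, ∃ f ∈ G.Fil ε a, (∀ q < i, E.e q f = 0) ∧ E.e i f = E.e i l}
  add_mem' := fun {x y} hx hy i => by
    obtain ⟨f, hf, hf1, hf2⟩ := hx i
    obtain ⟨g, hg, hg1, hg2⟩ := hy i
    exact ⟨f + g, add_mem hf hg, fun q hq => by rw [map_add, hf1 q hq, hg1 q hq, add_zero],
      by rw [map_add, map_add, hf2, hg2]⟩
  zero_mem' := fun i => ⟨0, zero_mem _, fun q _ => map_zero _, rfl⟩
  smul_mem' := fun c x hx i => by
    obtain ⟨f, hf, hf1, hf2⟩ := hx i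
    refine ⟨c • f, Submodule.smul_mem _ c hf, fun q hq => ?_, ?_⟩
    · rw [LinearMap.map_smul_of_tower, hf1 q hq, smul_zero]
    · rw [LinearMap.map_smul_of_tower, hf2, LinearMap.map_smul_of_tower]

theorem e_mem_GFil {ε a : ℤ} {l : L} (hl : l ∈ G.GFil E ε a) (q : ℚ) :
    E.e q l ∈ G.GFil E ε a := by
  intro i
  by_cases h : i = q
  · subst h
    rw [E.e_self]
    exact hl i
  · exact ⟨0, zero_mem _, fun q _ => map_zero _, by rw [map_zero, E.e_ne h]⟩

theorem lie_mem_GFil {ε a b : ℤ} {x y : L} (hx : x ∈ G.GFil E ε a) (hy : y ∈ G.GFil E ε b) :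
    ⁅x, y⁆ ∈ G.GFil E ε (a + b) := by
  rw [E.lie_eq_sum]
  refine Submodule.sum_mem _ fun p _ => Submodule.sum_mem _ fun q _ => ?_
  intro i
  by_cases hi : i = p + q
  · subst hi
    obtain ⟨f, hf, hf1, hf2⟩ := hx p
    obtain ⟨g, hg, hg1, hg2⟩ := hy q
    refine ⟨⁅f, g⁆, G.lie_mem_Fil hf hg, fun j hj => ?_, ?_⟩
    · rw [E.lie_eq_sum]
      simp only [map_sum]
      refine Finset.sum_eq_zero fun r _ => Finset.sum_eq_zero fun r' _ => ?_
      rw [E.e_lie_e]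
      split_ifs with h
      · rcases lt_or_ge r p with h1 | h1
        · rw [hf1 r h1, zero_lie]
        · rw [hg1 r' (by linarith), lie_zero]
      · rfl
    · rw [E.e_lie, ← hf2, ← hg2, E.lie_eq_sum f g]
      simp only [map_sum]
      have h0 : ∀ r r', ¬ (r = p ∧ r' = q) → E.e (p + q) ⁅E.e r f, E.e r' g⁆ = 0 := by
        intro r r' hrr
        rw [E.e_lie_e]
        split_ifs with h
        · rcases lt_or_ge r p with h1 | h1
          · rw [hf1 r h1, zero_lie]
          · rcases eq_or_lt_of_le h1 with h1 | h1
            · exact absurd ⟨h1.symm, by linarith⟩ hrr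
            · rw [hg1 r' (by linarith), lie_zero]
        · rfl
      rw [Finset.sum_eq_single p, Finset.sum_eq_single q]
      · rw [E.e_lie]
      · intro r' _ hr'
        exact h0 _ _ fun h => hr' h.2
      · intro hq
        rw [E.e_apply_off hq, lie_zero, map_zero]
      · intro r _ hr
        exact Finset.sum_eq_zero fun r' _ => h0 _ _ fun h => hr h.1
      · intro hp
        refine Finset.sum_eq_zero fun r' _ => ?_
        rw [E.e_apply_off hp, zero_lie, map_zero]
  · exact ⟨0, zero_mem _, fun q _ => map_zero _, by rw [map_zero, E.e_lie_e, if_neg hi]⟩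

/-- The filtration of `L` obtained by splitting `Fil` along a cut of the grading. -/
def SplitFil (P : ℚ → Prop) [DecidablePred P] (ε a : ℤ) : Submodule k L :=
  (G.Fil ε a).map ((∑ q ∈ E.s with P q, E.e q).restrictScalars k) ⊔
    (G.Fil ε a).map ((∑ q ∈ E.s with ¬ P q, E.e q).restrictScalars k)

theorem mem_SplitFil {P : ℚ → Prop} [DecidablePred P] {ε a : ℤ} {l : L} :
    l ∈ G.SplitFil E P ε a ↔ ∃ f ∈ G.Fil ε a, ∃ g ∈ G.Fil ε a,
      ∑ q ∈ E.s with P q, E.e q f + ∑ q ∈ E.s with ¬ P q, E.e q g = l := by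
  simp [SplitFil, Submodule.mem_sup]

variable [Module.Finite k[T;T⁻¹] L]

theorem exists_e_bound {ε : ℤ} (hε : ε = 1 ∨ ε = -1) :
    ∃ C, 0 ≤ C ∧ ∀ i a v, v ∈ G.Fil ε a → E.e i v ∈ G.Fil ε (a - C) := by
  choose C hC using fun i => G.exists_bound hε (E.e i)
  refine ⟨∑ i ∈ E.s, |C i|, Finset.sum_nonneg fun i _ => abs_nonneg _, fun i a v hv => ?_⟩
  by_cases hi : i ∈ E.s
  · refine G.Fil_anti ε ?_ (hC i a v hv)
    have := Finset.single_le_sum (f := fun i => |C i|) (fun i _ => abs_nonneg _) hi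
    linarith [le_abs_self (C i)]
  · rw [E.e_apply_off hi]
    exact zero_mem _

theorem lat_GFil {ε : ℤ} (hε : ε = 1 ∨ ε = -1) : G.Lat ε (G.GFil E ε) where
  anti := fun a b h l hl i => by
    obtain ⟨f, hf, hf1, hf2⟩ := hl i
    exact ⟨f, G.Fil_anti ε h hf, hf1, hf2⟩
  T_mem := fun a r v hv i => by
    obtain ⟨f, hf, hf1, hf2⟩ := hv i
    exact ⟨(T r : k[T;T⁻¹]) • f, G.T_mem_Fil r hf,
      fun q hq => by rw [map_smul, hf1 q hq, smul_zero], by rw [map_smul, map_smul, hf2]⟩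
  bound := by
    obtain ⟨C, -, hC⟩ := G.exists_e_bound E hε
    refine ⟨C, fun a => ⟨fun l hl i => ⟨E.e i l, ?_, fun q hq => E.e_ne hq.ne l, E.e_self i l⟩,
      fun l hl => ?_⟩⟩
    · simpa using hC i _ l hl
    · rw [← E.sum_e l]
      refine Submodule.sum_mem _ fun i _ => ?_
      obtain ⟨f, hf, -, hf2⟩ := hl i
      rw [← hf2]
      exact hC i a f hf

theorem lat_SplitFil (P : ℚ → Prop) [DecidablePred P] {ε : ℤ} (hε : ε = 1 ∨ ε = -1) :
    G.Lat ε (G.SplitFil E P ε) where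
  anti := fun a b h => sup_le_sup (Submodule.map_mono (G.Fil_anti ε h))
    (Submodule.map_mono (G.Fil_anti ε h))
  T_mem := fun a r v hv => by
    obtain ⟨f, hf, g, hg, rfl⟩ := (G.mem_SplitFil E).1 hv
    refine (G.mem_SplitFil E).2 ⟨_, G.T_mem_Fil r hf, _, G.T_mem_Fil r hg, ?_⟩
    simp only [map_smul, smul_add, Finset.smul_sum]
  bound := by
    obtain ⟨C, hC0, hC⟩ := G.exists_e_bound E hε
    refine ⟨C, fun a => ⟨fun l hl => ?_, fun l hl => ?_⟩⟩
    · have hl' := G.Fil_anti ε (by linarith) hl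
      refine (G.mem_SplitFil E).2 ⟨l, hl', l, hl', ?_⟩
      rw [Finset.sum_filter_add_sum_filter_not, E.sum_e]
    · obtain ⟨f, hf, g, hg, rfl⟩ := (G.mem_SplitFil E).1 hl
      exact add_mem (Submodule.sum_mem _ fun q _ => hC q a f hf)
        (Submodule.sum_mem _ fun q _ => hC q a g hg)

theorem mem_GFil_of_form {ε a : ℤ} (hε : ε = 1 ∨ ε = -1) {l : L}
    (h : ∀ w ∈ G.GFil E ε (1 - a), form k L l w = 0) : l ∈ G.GFil E ε a := by
  classical
  intro i
  by_contra hne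
  have hnot : E.e i l ∉ G.SplitFil E (· ≤ i) ε a := by
    intro hmem
    obtain ⟨f, hf, g, hg, hfg⟩ := (G.mem_SplitFil E).1 hmem
    have key : ∀ q ≤ i, E.e q f = E.e q (E.e i l) := by
      intro q hq
      rw [← hfg, map_add, E.e_sum_filter (· ≤ i), E.e_sum_filter (fun q => ¬ q ≤ i), if_pos hq,
        if_neg (not_not.2 hq), add_zero]
    refine hne ⟨f, hf, fun q hq => ?_, ?_⟩
    · rw [key q hq.le, E.e_ne hq.ne]
    · rw [key i le_rfl, E.e_self]
  obtain ⟨y, hy, hyl⟩ := (G.lat_SplitFil E (· ≤ i) hε).exists_separating hε hnot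
  have hi : i ∈ E.s := by
    by_contra hi
    rw [E.e_apply_off hi, map_zero] at hyl
    exact hyl rfl
  have hw : E.e (-i) y ∈ G.GFil E ε (1 - a) := by
    intro j
    by_cases hj : j = -i
    · subst hj
      have hsum : ∀ j, E.e j (∑ q ∈ E.s with q ≤ i, E.e (-q) y) =
          if -j ∈ E.s ∧ -j ≤ i then E.e j y else 0 := by
        intro j
        rw [map_sum]
        simp only [E.e_e]
        split_ifs with hji
        · rw [Finset.sum_eq_single_of_mem (-j) (Finset.mem_filter.2 hji)]
          · simp
          · intro q _ hq
            rw [if_neg]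
            rintro rfl
            simp at hq
        · refine Finset.sum_eq_zero fun q hq => ?_
          rw [if_neg]
          rintro rfl
          rw [neg_neg] at hji
          exact hji (Finset.mem_filter.1 hq)
      refine ⟨∑ q ∈ E.s with q ≤ i, E.e (-q) y, G.mem_Fil_of_form hε fun f hf => ?_,
        fun q hq => ?_, ?_⟩
      · rw [map_sum, LinearMap.sum_apply]
        simp only [E.form_e_left, neg_neg]
        rw [← map_sum]
        exact hy _ ((G.mem_SplitFil E).2 ⟨f, hf, 0, zero_mem _, by simp⟩)
      · rw [hsum, if_neg]
        rintro ⟨-, h⟩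
        linarith
      · rw [hsum, if_pos, E.e_self]
        simpa using hi
    · exact ⟨0, zero_mem _, fun q _ => map_zero _, by rw [map_zero, E.e_ne hj]⟩
  have h1 := h _ hw
  rw [form_comm, E.form_e_left, neg_neg] at h1
  exact hyl h1

end LoopGrading

/-- A `k`-linear map commuting with all powers of `t` is linear over `k[t, t⁻¹]`. -/
def linearOfCommute {k V : Type} [Field k] [AddCommGroup V] [Module k[T;T⁻¹] V] [Module k V]
    [IsScalarTower k k[T;T⁻¹] V] (φ : V →ₗ[k] V)
    (h : ∀ r v, φ ((T r : k[T;T⁻¹]) • v) = (T r : k[T;T⁻¹]) • φ v) : Module.End k[T;T⁻¹] V where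
  toFun := φ
  map_add' := map_add φ
  map_smul' := fun f v => by
    rw [laurent_smul_eq_sum, RingHom.id_apply, laurent_smul_eq_sum, map_sum]
    simp only [map_smul, h]

theorem linearOfCommute_apply {k V : Type} [Field k] [AddCommGroup V] [Module k[T;T⁻¹] V]
    [Module k V] [IsScalarTower k k[T;T⁻¹] V] (φ : V →ₗ[k] V)
    (h : ∀ r v, φ ((T r : k[T;T⁻¹]) • v) = (T r : k[T;T⁻¹]) • φ v) (v : V) :
    linearOfCommute φ h v = φ v := rfl

/-- The operator acting by `μ` on the `μ`-th piece of a decomposition. -/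
theorem exists_semisimple {k V : Type} [Field k] [AddCommGroup V] [Module k V]
    (W : k → Submodule k V) (hW : iSupIndep W) (hW' : ⨆ μ, W μ = ⊤) :
    ∃ S : V →ₗ[k] V, ∀ μ, ∀ v ∈ W μ, S v = μ • v := by
  classical
  have hI := DirectSum.isInternal_submodule_of_iSupIndep_of_iSup_eq_top hW hW'
  let e := LinearEquiv.ofBijective (DirectSum.coeLinearMap W) hI
  refine ⟨(DirectSum.toModule k k V fun μ => μ • (W μ).subtype) ∘ₗ e.symm.toLinearMap,
    fun μ v hv => ?_⟩
  have : e.symm v = DirectSum.lof k k (fun μ => W μ) μ ⟨v, hv⟩ := by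
    rw [LinearEquiv.symm_apply_eq]
    exact (DirectSum.coeLinearMap_lof W μ ⟨v, hv⟩).symm
  rw [LinearMap.comp_apply, LinearEquiv.coe_coe, this, DirectSum.toModule_lof]
  rfl

theorem pow_sub_smul_lie_eq_zero {k L : Type} [Field k] [LieRing L] [LieAlgebra k L]
    {D : Module.End k L} (hD : ∀ x y, D ⁅x, y⁆ = ⁅D x, y⁆ + ⁅x, D y⁆) (lam mu : k) (n : ℕ) :
    ∀ (a b : ℕ) (x y : L), a + b = n → ((D - lam • (1 : Module.End k L)) ^ a) x = 0 →
      ((D - mu • (1 : Module.End k L)) ^ b) y = 0 →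
      ((D - (lam + mu) • (1 : Module.End k L)) ^ n) ⁅x, y⁆ = 0 := by
  induction n with
  | zero =>
    intro a b x y h hx _
    obtain ⟨rfl, rfl⟩ : a = 0 ∧ b = 0 := by lia
    have hx0 : x = 0 := by simpa using hx
    rw [hx0, zero_lie, map_zero]
  | succ n ih =>
    intro a b x y h hx hy
    rw [pow_succ, Module.End.mul_apply]
    have h1 : (D - (lam + mu) • (1 : Module.End k L)) ⁅x, y⁆ =
        ⁅(D - lam • (1 : Module.End k L)) x, y⁆ + ⁅x, (D - mu • (1 : Module.End k L)) y⁆ := by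
      simp only [LinearMap.sub_apply, LinearMap.smul_apply, Module.End.one_apply, hD, sub_lie,
        lie_sub, smul_lie, lie_smul]
      rw [add_smul]
      abel
    rw [h1, map_add]
    have h2 : ((D - (lam + mu) • (1 : Module.End k L)) ^ n)
        ⁅(D - lam • (1 : Module.End k L)) x, y⁆ = 0 := by
      rcases a with _ | a
      · have hx0 : x = 0 := by simpa using hx
        rw [hx0, map_zero, zero_lie, map_zero]
      · refine ih a b _ _ (by lia) ?_ hy
        rwa [pow_succ, Module.End.mul_apply] at hx
    have h3 : ((D - (lam + mu) • (1 : Module.End k L)) ^ n)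
        ⁅x, (D - mu • (1 : Module.End k L)) y⁆ = 0 := by
      rcases b with _ | b
      · have hy0 : y = 0 := by simpa using hy
        rw [hy0, map_zero, lie_zero, map_zero]
      · refine ih a b _ _ (by lia) hx ?_
        rwa [pow_succ, Module.End.mul_apply] at hy
    rw [h2, h3, add_zero]

namespace LoopGrading

variable {k L : Type} [Field k] [LieRing L] [LieAlgebra k[T;T⁻¹] L]
  [LieAlgebra k L] [IsScalarTower k k[T;T⁻¹] L]
  {m : ℤ} (G : LoopGrading k L m) (E : FinGrading k L)

variable [Module.Finite k[T;T⁻¹] L]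

/-- There is an operator, differing from `δ` by a `k[t, t⁻¹]`-linear map, which preserves
the two filtrations `GFil` and the grading. -/
theorem exists_adapted_operator : ∃ A : L →ₗ[k] L,
    (∀ r v, A ((T r : k[T;T⁻¹]) • v) = (T r : k[T;T⁻¹]) • A v +
      ((m * r : ℤ) : k) • (T r : k[T;T⁻¹]) • v) ∧
    (∀ ε : ℤ, ε = 1 ∨ ε = -1 → ∀ a, ∀ v ∈ G.GFil E ε a, A v ∈ G.GFil E ε a) ∧
    (∀ q v, E.e q (A v) = A (E.e q v)) := by
  obtain ⟨ι, B, α, β, h1, h2⟩ := (G.lat_GFil E (Or.inl rfl)).exists_basis (Or.inl rfl)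
    (G.lat_GFil E (Or.inr rfl))
  let ψ : Module.End k[T;T⁻¹] L := B.constr k[T;T⁻¹] fun j => G.δ (B j)
  let A₀ : L →ₗ[k] L := G.δ - ψ.restrictScalars k
  have hA₀T : ∀ r v, A₀ ((T r : k[T;T⁻¹]) • v) = (T r : k[T;T⁻¹]) • A₀ v +
      ((m * r : ℤ) : k) • (T r : k[T;T⁻¹]) • v := by
    intro r v
    simp only [A₀, LinearMap.sub_apply, LinearMap.restrictScalars_apply, G.δ_T, map_smul, smul_sub]
    abel
  have hA₀B : ∀ j, A₀ (B j) = 0 := by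
    intro j
    simp only [A₀, LinearMap.sub_apply, LinearMap.restrictScalars_apply, ψ, B.constr_basis,
      sub_self]
  have hA₀v : ∀ v, A₀ v = ∑ j ∈ (B.repr v).support, ∑ r ∈ (B.repr v j).coeff.support,
      (B.repr v j).coeff r • ((m * r : ℤ) : k) • ((T r : k[T;T⁻¹]) • B j) := by
    intro v
    conv_lhs => rw [← B.linearCombination_repr v, Finsupp.linearCombination_apply, Finsupp.sum]
    simp only [laurent_smul_eq_sum (B.repr v _), map_sum, map_smul, hA₀T, hA₀B, smul_zero,
      zero_add]
  have hBrepr : ∀ j j' r, ((B.repr (B j)) j').coeff r ≠ 0 → j = j' ∧ r = 0 := by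
    intro j j' r h
    rw [B.repr_self] at h
    by_cases hj : j = j'
    · subst hj
      by_cases hr : r = 0
      · exact ⟨rfl, hr⟩
      · rw [Finsupp.single_eq_same, ← T_zero, T_apply] at h
        simp [Ne.symm hr] at h
    · simp [hj] at h
  have hA₀F : ∀ ε : ℤ, ε = 1 ∨ ε = -1 → ∀ a, ∀ v ∈ G.GFil E ε a, A₀ v ∈ G.GFil E ε a := by
    rintro ε (rfl | rfl) a v hv
    · rw [hA₀v]
      refine Submodule.sum_mem _ fun j _ => Submodule.sum_mem _ fun r hr =>
        Submodule.smul_mem _ _ (Submodule.smul_mem _ _ ?_)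
      have h3 := (h1 v a).1 hv j r (Finsupp.mem_support_iff.1 hr)
      have hB : B j ∈ G.GFil E 1 (α j) := by
        rw [h1]
        intro j' r' h
        obtain ⟨rfl, rfl⟩ := hBrepr j j' r' h
        simp
      exact (G.lat_GFil E (Or.inl rfl)).anti h3 ((G.lat_GFil E (Or.inl rfl)).T_mem _ _ _ hB)
    · rw [hA₀v]
      refine Submodule.sum_mem _ fun j _ => Submodule.sum_mem _ fun r hr =>
        Submodule.smul_mem _ _ (Submodule.smul_mem _ _ ?_)
      have h3 := (h2 v a).1 hv j r (Finsupp.mem_support_iff.1 hr)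
      have hB : B j ∈ G.GFil E (-1) (β j) := by
        rw [h2]
        intro j' r' h
        obtain ⟨rfl, rfl⟩ := hBrepr j j' r' h
        simp
      exact (G.lat_GFil E (Or.inr rfl)).anti (by linarith)
        ((G.lat_GFil E (Or.inr rfl)).T_mem _ _ _ hB)
  let A : L →ₗ[k] L := ∑ q ∈ E.s, (E.e q).restrictScalars k ∘ₗ A₀ ∘ₗ (E.e q).restrictScalars k
  have hA : ∀ v, A v = ∑ q ∈ E.s, E.e q (A₀ (E.e q v)) := by
    intro v
    simp [A]
  refine ⟨A, fun r v => ?_, fun ε hε a v hv => ?_, fun q v => ?_⟩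
  · simp only [hA, map_smul, hA₀T, map_add, Finset.sum_add_distrib]
    congr 1
    · rw [Finset.smul_sum]
    · simp only [LinearMap.map_smul_of_tower, map_smul, E.e_self]
      rw [← Finset.smul_sum, ← Finset.smul_sum, E.sum_e]
  · rw [hA]
    exact Submodule.sum_mem _ fun q _ =>
      G.e_mem_GFil E (hA₀F ε hε a _ (G.e_mem_GFil E hv q)) q
  · rw [hA, hA, map_sum]
    refine Finset.sum_congr rfl fun p _ => ?_
    rw [E.e_e, E.e_e]
    split_ifs with h1 h2 h2
    · rw [h2]
    · exact absurd h1.symm h2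
    · exact absurd h2.symm h1
    · simp

/-- There is a derivation of the form `δ + ad x` which preserves the two filtrations `GFil`
and the grading. -/
theorem exists_adapted_derivation : ∃ x : L,
    (∀ ε : ℤ, ε = 1 ∨ ε = -1 → ∀ a, ∀ v ∈ G.GFil E ε a, G.δ v + ⁅x, v⁆ ∈ G.GFil E ε a) ∧
    (∀ q v, E.e q (G.δ v + ⁅x, v⁆) = G.δ (E.e q v) + ⁅x, E.e q v⁆) := by
  obtain ⟨A, hAT, hAF, hAe⟩ := G.exists_adapted_operator E
  let ψ : Module.End k[T;T⁻¹] L := linearOfCommute (A - G.δ) fun r v => by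
    simp only [LinearMap.sub_apply, hAT, G.δ_T, smul_sub]
    abel
  have hψ : ∀ v, ψ v = A v - G.δ v := fun v => rfl
  obtain ⟨x, hx⟩ := G.exists_form_eq_tau ψ
  let D : L →ₗ[k] L := G.δ + LieAlgebra.ad k L x
  have hD : ∀ v, G.δ v + ⁅x, v⁆ = D v := fun v => rfl
  let C : L → Module.End k[T;T⁻¹] L := fun y => ψ * LieAlgebra.ad k[T;T⁻¹] L y -
    LieAlgebra.ad k[T;T⁻¹] L y * ψ + LieAlgebra.ad k[T;T⁻¹] L (G.δ y)
  have hC : ∀ y v, C y v = A ⁅y, v⁆ - ⁅y, A v⁆ := by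
    intro y v
    simp only [C, LinearMap.add_apply, LinearMap.sub_apply, Module.End.mul_apply,
      LieAlgebra.ad_apply, hψ, G.δ_lie, lie_sub]
    abel
  have hform : ∀ y z, form k L (D y) z = tau (C y * LieAlgebra.ad k[T;T⁻¹] L z) := by
    intro y z
    have h1 : tau (LieAlgebra.ad k[T;T⁻¹] L y * ψ * LieAlgebra.ad k[T;T⁻¹] L z) =
        tau (ψ * (LieAlgebra.ad k[T;T⁻¹] L z * LieAlgebra.ad k[T;T⁻¹] L y)) := by
      rw [← mul_assoc ψ, tau_mul_comm (ψ * _), ← mul_assoc]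
    rw [← hD, map_add, LinearMap.add_apply, form_lie, hx, ad_lie_eq, mul_sub, tau_sub]
    simp only [C, add_mul, sub_mul, tau_add, tau_sub]
    rw [h1, mul_assoc ψ, form_apply]
    ring
  refine ⟨x, fun ε hε a y hy => ?_, fun q v => ?_⟩
  · refine G.mem_GFil_of_form E hε fun w hw => ?_
    rw [hD, hform]
    refine (G.lat_GFil E hε).tau_eq_zero hε fun b v hv => ?_
    have h1 := G.lie_mem_GFil E hw hv
    have h2 := hAF ε hε _ _ (G.lie_mem_GFil E hy h1)
    have h3 := G.lie_mem_GFil E hy (hAF ε hε _ _ h1)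
    rw [show a + (1 - a + b) = b + 1 by ring] at h2 h3
    rw [Module.End.mul_apply, hC]
    exact sub_mem h2 h3
  · have h0 : ∀ p q v, p ≠ q → E.e p (D (E.e q v)) = 0 := by
      intro p q v hpq
      refine G.eq_zero_of_form fun z => ?_
      rw [E.form_e_left, hform]
      refine E.tau_eq_zero (c := q - p) (sub_ne_zero.2 hpq.symm) fun r w => ?_
      have hu := E.e_lie (-p) r z w
      have hA : E.e (-p + r) (A ⁅E.e (-p) z, E.e r w⁆) = A ⁅E.e (-p) z, E.e r w⁆ := by
        rw [hAe, hu]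
      rw [Module.End.mul_apply, LieAlgebra.ad_apply, hC, map_sub, hAe,
        E.e_lie_fixed (by ring) (E.e_self q v) hu, E.e_lie_fixed (by ring) (E.e_self q v) hA]
    rw [hD, hD]
    have h1 : E.e q (D v) = E.e q (D (E.e q v)) := by
      conv_lhs => rw [← E.sum_e v, map_sum, map_sum]
      by_cases hq : q ∈ E.s
      · exact Finset.sum_eq_single_of_mem q hq fun p _ hp => h0 _ _ _ hp.symm
      · rw [E.e_apply_off hq]
        exact Finset.sum_eq_zero fun p _ => E.e_apply_off hq _
    have h2 : D (E.e q v) = E.e q (D (E.e q v)) := by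
      refine E.ext_e fun p => ?_
      rw [E.e_e]
      split_ifs with hp
      · rw [hp]
      · exact h0 _ _ _ hp
    rw [h1, ← h2]

end LoopGrading

namespace LoopGrading

variable {k L : Type} [Field k] [IsAlgClosed k] [LieRing L] [LieAlgebra k[T;T⁻¹] L]
  [LieAlgebra k L] [IsScalarTower k k[T;T⁻¹] L] [Module.Finite k[T;T⁻¹] L]
  {m : ℤ} (G : LoopGrading k L m) (E : FinGrading k L)

theorem iSup_maxGenEigenspace_eq_top {D : Module.End k L}
    (hD : ∀ ε : ℤ, ε = 1 ∨ ε = -1 → ∀ a, ∀ v ∈ G.GFil E ε a, D v ∈ G.GFil E ε a) :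
    ⨆ μ, D.maxGenEigenspace μ = ⊤ := by
  rw [eq_top_iff]
  intro l _
  obtain ⟨a, ha⟩ := (G.lat_GFil E (Or.inl rfl)).exists_mem l
  obtain ⟨b, hb⟩ := (G.lat_GFil E (Or.inr rfl)).exists_mem l
  obtain ⟨C, hC⟩ := (G.lat_GFil E (Or.inl rfl)).bound
  obtain ⟨C', hC'⟩ := (G.lat_GFil E (Or.inr rfl)).bound
  let W : Submodule k L := G.GFil E 1 a ⊓ G.GFil E (-1) b
  have hW : ∀ v ∈ W, D v ∈ W := fun v hv =>
    ⟨hD 1 (Or.inl rfl) a v hv.1, hD (-1) (Or.inr rfl) b v hv.2⟩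
  have := G.finite_Fil_inf (a - C) (b - C')
  have hfin : FiniteDimensional k W :=
    Submodule.finiteDimensional_of_le (inf_le_inf (hC a).2 (hC' b).2)
  let DW : Module.End k W := LinearMap.restrict D hW
  have htop := Module.End.iSup_maxGenEigenspace_eq_top DW
  have hl : (⟨l, ha, hb⟩ : W) ∈ ⨆ μ, DW.maxGenEigenspace μ := by
    rw [htop]
    trivial
  have hmap := Submodule.mem_map_of_mem (f := W.subtype) hl
  rw [Submodule.map_iSup] at hmap
  refine SetLike.le_def.mp (iSup_mono fun μ => ?_) hmap
  rintro _ ⟨w, hw, rfl⟩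
  rw [SetLike.mem_coe, Module.End.mem_maxGenEigenspace] at hw
  obtain ⟨n, hn⟩ := hw
  rw [Module.End.mem_maxGenEigenspace]
  refine ⟨n, ?_⟩
  have key : ∀ (n : ℕ) (w : W), ((D - μ • (1 : Module.End k L)) ^ n) (w : L) =
      (((DW - μ • (1 : Module.End k W)) ^ n) w : W) := by
    intro n
    induction n with
    | zero => intro w; rfl
    | succ n ih =>
      intro w
      rw [pow_succ, pow_succ, Module.End.mul_apply, Module.End.mul_apply, ← ih]
      rfl
  rw [Submodule.subtype_apply, key, hn, Submodule.coe_zero]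

/-- There is a semisimple derivation of the form `δ + ad x` which preserves the grading. -/
theorem exists_semisimple_derivation : ∃ x : L,
    (∀ q v, E.e q (G.δ v + ⁅x, v⁆) = G.δ (E.e q v) + ⁅x, E.e q v⁆) ∧
    (⨆ μ, Module.End.eigenspace (G.δ + LieAlgebra.ad k L x) μ = ⊤) := by
  obtain ⟨x, hxF, hxe⟩ := G.exists_adapted_derivation E
  let D : Module.End k L := G.δ + LieAlgebra.ad k L x
  have hDv : ∀ v, D v = G.δ v + ⁅x, v⁆ := fun v => rfl
  have hDlie : ∀ y z, D ⁅y, z⁆ = ⁅D y, z⁆ + ⁅y, D z⁆ := by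
    intro y z
    simp only [hDv, G.δ_lie, add_lie, lie_add, leibniz_lie x y z]
    abel
  have hDT : ∀ r v, D ((T r : k[T;T⁻¹]) • v) = (T r : k[T;T⁻¹]) • D v +
      ((m * r : ℤ) : k) • (T r : k[T;T⁻¹]) • v := by
    intro r v
    simp only [hDv, G.δ_T, lie_smul, smul_add]
    abel
  have htop := G.iSup_maxGenEigenspace_eq_top E (D := D) hxF
  obtain ⟨S, hS⟩ := exists_semisimple _ (Module.End.independent_maxGenEigenspace D) htop
  have hind : ∀ {P : L → Prop}, (∀ μ, ∀ v ∈ D.maxGenEigenspace μ, P v) → P 0 →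
      (∀ v w, P v → P w → P (v + w)) → ∀ v, P v := by
    intro P h1 h2 h3 v
    have hv : v ∈ ⨆ μ, D.maxGenEigenspace μ := by
      rw [htop]
      trivial
    exact Submodule.iSup_induction _ (motive := P) hv h1 h2 h3
  have hSlie : ∀ y z, S ⁅y, z⁆ = ⁅S y, z⁆ + ⁅y, S z⁆ := by
    intro y z
    refine hind (P := fun y => S ⁅y, z⁆ = ⁅S y, z⁆ + ⁅y, S z⁆) (fun lam y hy => ?_) (by simp)
      (fun y y' h h' => by simp only [add_lie, map_add, h, h']; abel) y
    refine hind (P := fun z => S ⁅y, z⁆ = ⁅S y, z⁆ + ⁅y, S z⁆) (fun mu z hz => ?_) (by simp)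
      (fun z z' h h' => by simp only [lie_add, map_add, h, h']; abel) z
    have hyz : ⁅y, z⁆ ∈ D.maxGenEigenspace (lam + mu) := by
      rw [Module.End.mem_maxGenEigenspace] at hy hz ⊢
      obtain ⟨a, ha⟩ := hy
      obtain ⟨b, hb⟩ := hz
      exact ⟨a + b, pow_sub_smul_lie_eq_zero hDlie lam mu _ a b y z rfl ha hb⟩
    rw [hS _ _ hyz, hS _ _ hy, hS _ _ hz, smul_lie, lie_smul, add_smul]
  have hST : ∀ r v, S ((T r : k[T;T⁻¹]) • v) = (T r : k[T;T⁻¹]) • S v +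
      ((m * r : ℤ) : k) • (T r : k[T;T⁻¹]) • v := by
    intro r v
    refine hind (P := fun v => S ((T r : k[T;T⁻¹]) • v) = (T r : k[T;T⁻¹]) • S v +
      ((m * r : ℤ) : k) • (T r : k[T;T⁻¹]) • v) (fun mu v hv => ?_) (by simp)
      (fun v w h h' => by simp only [smul_add, map_add, h, h']; abel) v
    have hTv : (T r : k[T;T⁻¹]) • v ∈ D.maxGenEigenspace (mu + ((m * r : ℤ) : k)) := by
      rw [Module.End.mem_maxGenEigenspace] at hv ⊢
      obtain ⟨n, hn⟩ := hv
      refine ⟨n, ?_⟩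
      have key : ∀ (n : ℕ) (v : L), ((D - (mu + ((m * r : ℤ) : k)) • (1 : Module.End k L)) ^ n)
          ((T r : k[T;T⁻¹]) • v) =
          (T r : k[T;T⁻¹]) • ((D - mu • (1 : Module.End k L)) ^ n) v := by
        intro n
        induction n with
        | zero => intro v; rfl
        | succ n ih =>
          intro v
          rw [pow_succ, pow_succ, Module.End.mul_apply, Module.End.mul_apply, ← ih]
          congr 1
          simp only [LinearMap.sub_apply, LinearMap.smul_apply, Module.End.one_apply, hDT,
            smul_sub]
          rw [add_smul, smul_comm mu (T r : k[T;T⁻¹])]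
          abel
      rw [key, hn, smul_zero]
    rw [hS _ _ hTv, hS _ _ hv, add_smul, smul_comm mu]
  have hSe : ∀ q v, E.e q (S v) = S (E.e q v) := by
    intro q v
    refine hind (P := fun v => E.e q (S v) = S (E.e q v)) (fun mu v hv => ?_) (by simp)
      (fun v w h h' => by simp only [map_add, h, h']) v
    have hev : E.e q v ∈ D.maxGenEigenspace mu := by
      rw [Module.End.mem_maxGenEigenspace] at hv ⊢
      obtain ⟨n, hn⟩ := hv
      refine ⟨n, ?_⟩
      have key : ∀ (n : ℕ) (v : L), ((D - mu • (1 : Module.End k L)) ^ n) (E.e q v) =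
          E.e q (((D - mu • (1 : Module.End k L)) ^ n) v) := by
        intro n
        induction n with
        | zero => intro v; rfl
        | succ n ih =>
          intro v
          rw [pow_succ, Module.End.mul_apply, Module.End.mul_apply, ← ih]
          congr 1
          simp only [LinearMap.sub_apply, LinearMap.smul_apply, Module.End.one_apply, hDv,
            map_sub, ← hxe, LinearMap.map_smul_of_tower]
      rw [key, hn, map_zero]
    rw [hS _ _ hev, hS _ _ hv, LinearMap.map_smul_of_tower]
  obtain ⟨y, hy⟩ := G.exists_ad_eq (linearOfCommute (S - G.δ) fun r v => by
    simp only [LinearMap.sub_apply, hST, G.δ_T, smul_sub]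
    abel) fun v w => by
      simp only [linearOfCommute_apply, LinearMap.sub_apply, hSlie, G.δ_lie, sub_lie, lie_sub]
      abel
  have hSy : ∀ v, S v = G.δ v + ⁅y, v⁆ := by
    intro v
    rw [← hy, linearOfCommute_apply, LinearMap.sub_apply, add_sub_cancel]
  refine ⟨y, fun q v => by rw [← hSy, ← hSy, hSe], ?_⟩
  rw [eq_top_iff, ← htop]
  refine iSup_mono fun μ v hv => ?_
  rw [Module.End.mem_eigenspace_iff, ← hS μ v hv, hSy]
  rfl

end LoopGrading

/-- Data exhibiting `L` as the twisted loop algebra of `𝔤` with respect to an automorphism of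
order dividing `m`. -/
structure TwistedLoop (k 𝔤 L : Type) [Field k] [LieRing 𝔤] [LieAlgebra k 𝔤] [LieRing L]
    [LieAlgebra k[T;T⁻¹] L] [LieAlgebra k L] (m : ℕ) where
  m_pos : 0 < m
  σ : 𝔤 ≃ₗ⁅k⁆ 𝔤
  iterate_σ : ∀ y : 𝔤, (⇑σ)^[m] y = y
  ζ : k
  isPrimitiveRoot : IsPrimitiveRoot ζ m
  u : ℤ → 𝔤 →ₗ[k] L
  u_lie : ∀ (p q : ℤ) (y z : 𝔤), σ y = ζ ^ p • y → σ z = ζ ^ q • z →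
    ⁅u p y, u q z⁆ = u (p + q) ⁅y, z⁆
  T_u : ∀ (p : ℤ) (y : 𝔤), σ y = ζ ^ p • y → (T 1 : k[T;T⁻¹]) • u p y = u (p + m) y
  u_span : ∀ l : L, ∃ f : ℤ →₀ 𝔤, (∀ i, σ (f i) = ζ ^ i • f i) ∧ l = f.sum fun i yi => u i yi
  u_ind : ∀ f : ℤ →₀ 𝔤, (∀ i, σ (f i) = ζ ^ i • f i) → (f.sum fun i yi => u i yi) = 0 → f = 0

namespace TwistedLoop

section Components

variable {k 𝔤 L : Type} [Field k] [LieRing 𝔤] [LieAlgebra k 𝔤] [LieRing L]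
    [LieAlgebra k[T;T⁻¹] L] [LieAlgebra k L] {m : ℕ} (H : TwistedLoop k 𝔤 L m)

/-- The graded component of `𝔤` of degree `p` modulo `m`. -/
def piece (p : ℤ) : Submodule k 𝔤 :=
  LinearMap.ker ((H.σ : 𝔤 →ₗ[k] 𝔤) - H.ζ ^ p • (1 : Module.End k 𝔤))

theorem mem_piece {p : ℤ} {y : 𝔤} : y ∈ H.piece p ↔ H.σ y = H.ζ ^ p • y := by
  simp only [piece, LinearMap.mem_ker, LinearMap.sub_apply, LinearMap.smul_apply,
    Module.End.one_apply, sub_eq_zero]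
  rfl

theorem ζ_ne_zero : H.ζ ≠ 0 := H.isPrimitiveRoot.ne_zero H.m_pos.ne'

theorem ζ_zpow_eq {p q : ℤ} : H.ζ ^ p = H.ζ ^ q ↔ (m : ℤ) ∣ p - q := by
  rw [← H.isPrimitiveRoot.zpow_eq_one_iff_dvd, zpow_sub₀ H.ζ_ne_zero,
    div_eq_one_iff_eq (zpow_ne_zero _ H.ζ_ne_zero)]

theorem piece_congr {p q : ℤ} (h : (m : ℤ) ∣ p - q) : H.piece p = H.piece q := by
  rw [piece, piece, H.ζ_zpow_eq.mpr h]

theorem lie_mem_piece {p q : ℤ} {y z : 𝔤} (hy : y ∈ H.piece p) (hz : z ∈ H.piece q) :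
    ⁅y, z⁆ ∈ H.piece (p + q) := by
  rw [mem_piece] at *
  rw [LieEquiv.map_lie, hy, hz, smul_lie, lie_smul, smul_smul, zpow_add₀ H.ζ_ne_zero]

theorem lie_u {p q : ℤ} {y z : 𝔤} (hy : y ∈ H.piece p) (hz : z ∈ H.piece q) :
    ⁅H.u p y, H.u q z⁆ = H.u (p + q) ⁅y, z⁆ :=
  H.u_lie p q y z (H.mem_piece.mp hy) (H.mem_piece.mp hz)

theorem T_smul_u {p : ℤ} {y : 𝔤} (hy : y ∈ H.piece p) (n : ℤ) :
    (T n : k[T;T⁻¹]) • H.u p y = H.u (p + m * n) y := by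
  have key : ∀ q : ℤ, y ∈ H.piece q → (T 1 : k[T;T⁻¹]) • H.u q y = H.u (q + m) y :=
    fun q hq => H.T_u q y (H.mem_piece.mp hq)
  have hp : ∀ n : ℤ, y ∈ H.piece (p + m * n) := fun n => by
    rwa [H.piece_congr (q := p) (by simp)]
  induction n with
  | zero => simp
  | succ n ih =>
    rw [add_comm (n : ℤ) 1, T_add, mul_smul, ih, key _ (hp _)]
    congr 2
    ring
  | pred n ih =>
    have h := key _ (hp (-n - 1))
    rw [show p + m * (-n - 1 : ℤ) + m = p + m * (-n : ℤ) by ring, ← ih] at h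
    rw [show (-n - 1 : ℤ) = -1 + -n by ring, T_add, mul_smul, ← h, smul_smul, ← T_add,
      show (-1 : ℤ) + -n = -n - 1 by ring]
    simp

/-- The finitely supported families representing elements of the loop algebra. -/
def families : Submodule k (ℤ →₀ 𝔤) where
  carrier := {f | ∀ i, f i ∈ H.piece i}
  add_mem' := fun hf hg i => add_mem (hf i) (hg i)
  zero_mem' := fun _ => zero_mem _
  smul_mem' := fun c _ hf i => Submodule.smul_mem _ c (hf i)

/-- The loop algebra is isomorphic to the space of families of homogeneous elements. -/
def equivFamilies : H.families ≃ₗ[k] L :=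
  LinearEquiv.ofBijective ((Finsupp.lsum k H.u).comp H.families.subtype) <| by
    constructor
    · rw [← LinearMap.ker_eq_bot, LinearMap.ker_eq_bot']
      rintro ⟨f, hf⟩ h
      exact Subtype.ext (H.u_ind f (fun i => H.mem_piece.mp (hf i)) h)
    · intro l
      obtain ⟨f, hf, rfl⟩ := H.u_span l
      exact ⟨⟨f, fun i => H.mem_piece.mpr (hf i)⟩, rfl⟩

/-- The homogeneous components of an element of the loop algebra. -/
def comp : L →ₗ[k] ℤ →₀ 𝔤 := H.families.subtype.comp H.equivFamilies.symm.toLinearMap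

theorem comp_mem (l : L) (p : ℤ) : H.comp l p ∈ H.piece p :=
  (H.equivFamilies.symm l).2 p

theorem eq_sum_comp (l : L) : l = (H.comp l).sum fun p y => H.u p y :=
  (H.equivFamilies.apply_symm_apply l).symm

theorem comp_u {p : ℤ} {y : 𝔤} (hy : y ∈ H.piece p) : H.comp (H.u p y) = Finsupp.single p y := by
  have hmem : Finsupp.single p y ∈ H.families := by
    intro i
    by_cases h : p = i
    · subst h
      rwa [Finsupp.single_eq_same]
    · rw [Finsupp.single_eq_of_ne (Ne.symm h)]
      exact zero_mem _
  have h : H.equivFamilies ⟨Finsupp.single p y, hmem⟩ = H.u p y :=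
    (Finsupp.sum_single_index (map_zero _))
  rw [← h]
  simp [comp]

theorem u_eq_zero {p : ℤ} {y : 𝔤} (hy : y ∈ H.piece p) (h : H.u p y = 0) : y = 0 := by
  have h1 := H.comp_u hy
  rw [h, map_zero] at h1
  exact (Finsupp.single_eq_zero.mp h1.symm)

theorem induction_u {P : L → Prop} (hu : ∀ p, ∀ y ∈ H.piece p, P (H.u p y)) (h0 : P 0)
    (hadd : ∀ x y, P x → P y → P (x + y)) (l : L) : P l := by
  rw [H.eq_sum_comp l]
  refine Finset.sum_induction _ P (fun x y => hadd x y) h0 fun p _ => hu p _ (H.comp_mem l p)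

/-- The projection onto the component of degree `p`. -/
def pr (p : ℤ) : L →ₗ[k] L := (H.u p).comp ((Finsupp.lapply p).comp H.comp)

theorem pr_apply (p : ℤ) (l : L) : H.pr p l = H.u p (H.comp l p) := rfl

theorem pr_u (p : ℤ) {q : ℤ} {y : 𝔤} (hy : y ∈ H.piece q) :
    H.pr p (H.u q y) = if p = q then H.u q y else 0 := by
  rw [pr_apply, H.comp_u hy]
  split_ifs with h
  · rw [h, Finsupp.single_eq_same]
  · rw [Finsupp.single_eq_of_ne h, map_zero]

/-- The degree derivation. -/
def deg : L →ₗ[k] L := (Finsupp.lsum k fun p : ℤ => (p : k) • H.u p).comp H.comp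

theorem deg_u {p : ℤ} {y : 𝔤} (hy : y ∈ H.piece p) : H.deg (H.u p y) = (p : k) • H.u p y := by
  rw [deg, LinearMap.comp_apply, H.comp_u hy]
  simp

end Components

end TwistedLoop

namespace TwistedLoop

variable {k 𝔤 L : Type} [Field k] [LieRing 𝔤] [LieAlgebra k 𝔤] [LieRing L]
    [LieAlgebra k[T;T⁻¹] L] [LieAlgebra k L] {m : ℕ} (H : TwistedLoop k 𝔤 L m)

theorem iSup_piece [IsAlgClosed k] [CharZero k] [FiniteDimensional k 𝔤] :
    ⨆ p, H.piece p = ⊤ := by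
  have hpow : ((H.σ : 𝔤 →ₗ[k] 𝔤) : Module.End k 𝔤) ^ m = 1 := by
    ext y
    rw [Module.End.pow_apply]
    exact H.iterate_σ y
  have hss : Module.End.IsSemisimple ((H.σ : 𝔤 →ₗ[k] 𝔤) : Module.End k 𝔤) := by
    refine Module.End.isSemisimple_of_squarefree_aeval_eq_zero
      (p := Polynomial.X ^ m - Polynomial.C 1) ?_ ?_
    · refine (Polynomial.separable_X_pow_sub_C (1 : k) ?_ one_ne_zero).squarefree
      exact_mod_cast H.m_pos.ne'
    · simp [hpow]
  rw [eq_top_iff, ← Module.End.iSup_maxGenEigenspace_eq_top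
    ((H.σ : 𝔤 →ₗ[k] 𝔤) : Module.End k 𝔤)]
  refine iSup_le fun μ y hy => ?_
  rw [hss.isFinitelySemisimple.maxGenEigenspace_eq_eigenspace,
    Module.End.mem_eigenspace_iff] at hy
  by_cases hy0 : y = 0
  · rw [hy0]
    exact zero_mem _
  have hμ : μ ^ m = 1 := by
    have h : ∀ n : ℕ, (((H.σ : 𝔤 →ₗ[k] 𝔤) : Module.End k 𝔤) ^ n) y = μ ^ n • y := by
      intro n
      induction n with
      | zero => simp
      | succ n ih => rw [pow_succ', Module.End.mul_apply, ih, map_smul, hy, smul_smul, pow_succ]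
    have h1 := h m
    rw [hpow, Module.End.one_apply] at h1
    have h2 : (μ ^ m - 1) • y = 0 := by rw [sub_smul, one_smul, ← h1, sub_self]
    rcases smul_eq_zero.mp h2 with h3 | h3
    · exact sub_eq_zero.mp h3
    · exact absurd h3 hy0
  have : NeZero m := ⟨H.m_pos.ne'⟩
  obtain ⟨i, -, rfl⟩ := H.isPrimitiveRoot.eq_pow_of_pow_eq_one hμ
  refine Submodule.mem_iSup_of_mem (i : ℤ) ?_
  rw [mem_piece, zpow_natCast]
  exact hy

theorem exists_homogeneous_basis [IsAlgClosed k] [CharZero k] [FiniteDimensional k 𝔤] :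
    ∃ (ι : Type) (_ : Fintype ι) (b : Module.Basis ι k 𝔤) (deg : ι → ℤ),
      (∀ i, b i ∈ H.piece (deg i)) ∧ ∀ i j, (m : ℤ) ∣ deg i - deg j → deg i = deg j := by
  have hs : ⊤ ≤ Submodule.span k {y | ∃ p, y ∈ H.piece p} := by
    rw [← H.iSup_piece]
    exact iSup_le fun p y hy => Submodule.subset_span ⟨p, hy⟩
  let b := Module.Basis.ofSpan hs
  have hb : ∀ i, ∃ p, b i ∈ H.piece p := fun i => Module.Basis.ofSpan_subset hs ⟨i, rfl⟩
  choose p hp using hb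
  refine ⟨_, FiniteDimensional.fintypeBasisIndex b, b, fun i => p i % m, fun i => ?_,
    fun i j h => ?_⟩
  · rw [H.piece_congr (q := p i)]
    · exact hp i
    · exact ⟨-(p i / m), by have := Int.emod_add_mul_ediv (p i) m; linarith⟩
  · have := Int.ModEq.symm (Int.modEq_iff_dvd.mpr h)
    simpa [Int.ModEq] using this

theorem killingForm_eq_zero {p q : ℤ} {y z : 𝔤} (hy : y ∈ H.piece p) (hz : z ∈ H.piece q)
    (h : ¬ (m : ℤ) ∣ p + q) : killingForm k 𝔤 y z = 0 := by
  have h1 := LieAlgebra.killingForm_of_equiv_apply H.σ y z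
  rw [H.mem_piece.mp hy, H.mem_piece.mp hz, map_smul, map_smul, LinearMap.smul_apply, smul_smul,
    ← zpow_add₀ H.ζ_ne_zero, smul_eq_mul] at h1
  by_contra h2
  have h3 := mul_right_cancel₀ h2 (h1.trans (one_mul _).symm)
  have h4 := H.ζ_zpow_eq.mp (h3.trans (zpow_zero _).symm)
  rw [sub_zero, add_comm] at h4
  exact h h4

theorem repr_eq_zero {ι : Type} [Fintype ι] (b : Module.Basis ι k 𝔤) {deg : ι → ℤ}
    (hb : ∀ i, b i ∈ H.piece (deg i)) {r : ℤ} {w : 𝔤} (hw : w ∈ H.piece r) {i : ι}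
    (hi : ¬ (m : ℤ) ∣ r - deg i) : b.repr w i = 0 := by
  classical
  have h : ∀ w, b.repr (H.σ w) i = H.ζ ^ deg i * b.repr w i := by
    intro w
    conv_lhs => rw [← b.sum_repr w]
    simp only [map_sum, Finsupp.coe_finsetSum, Finset.sum_apply, map_smul, H.mem_piece.mp (hb _),
      Finsupp.smul_apply, b.repr_self, smul_eq_mul, Finsupp.single_apply]
    rw [Finset.sum_eq_single i (fun j _ hj => by simp [hj]) (by simp)]
    simp [mul_comm]
  have h1 := h w
  rw [H.mem_piece.mp hw, map_smul, Finsupp.smul_apply, smul_eq_mul] at h1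
  by_contra h2
  exact hi (H.ζ_zpow_eq.mp (mul_right_cancel₀ h2 h1))

theorem pr_T_smul_u (r : ℤ) {q n : ℤ} {y : 𝔤} (hy : y ∈ H.piece q) :
    H.pr r ((T n : k[T;T⁻¹]) • H.u q y) = if r = q + m * n then H.u (q + m * n) y else 0 := by
  rw [H.T_smul_u hy, H.pr_u]
  rwa [H.piece_congr (q := q) (by simp)]

variable [IsScalarTower k k[T;T⁻¹] L]

theorem pr_laurent_smul_u (f : k[T;T⁻¹]) {q n : ℤ} {y : 𝔤} (hy : y ∈ H.piece q) :
    H.pr (q + m * n) (f • H.u q y) = f.coeff n • H.u (q + m * n) y := by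
  have hm : (m : ℤ) ≠ 0 := by exact_mod_cast H.m_pos.ne'
  rw [laurent_smul_eq_sum, map_sum]
  simp only [map_smul, H.pr_T_smul_u _ hy, add_right_inj, mul_right_inj' hm]
  rw [Finset.sum_eq_single n]
  · simp
  · intro j _ hj
    rw [if_neg (Ne.symm hj), smul_zero]
  · intro hn
    rw [Finsupp.notMem_support_iff.mp hn, zero_smul]

theorem pr_laurent_smul_u_eq_zero (f : k[T;T⁻¹]) {q r : ℤ} {y : 𝔤} (hy : y ∈ H.piece q)
    (h : ¬ (m : ℤ) ∣ r - q) : H.pr r (f • H.u q y) = 0 := by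
  rw [laurent_smul_eq_sum, map_sum]
  refine Finset.sum_eq_zero fun n _ => ?_
  rw [map_smul, H.pr_T_smul_u _ hy, if_neg, smul_zero]
  rintro rfl
  exact h ⟨n, by ring⟩

theorem linearIndependent_u {ι : Type} [Fintype ι] (b : Module.Basis ι k 𝔤) {deg : ι → ℤ}
    (hb : ∀ i, b i ∈ H.piece (deg i))
    (hdeg : ∀ i j, (m : ℤ) ∣ deg i - deg j → deg i = deg j) :
    LinearIndependent k[T;T⁻¹] fun i => H.u (deg i) (b i) := by
  classical
  rw [Fintype.linearIndependent_iff]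
  intro g hg j
  ext n
  have h := congrArg (H.pr (deg j + m * n)) hg
  rw [map_sum, map_zero] at h
  have h1 : ∀ i, H.pr (deg j + m * n) (g i • H.u (deg i) (b i)) =
      H.u (deg j + m * n) ((if deg i = deg j then (g i).coeff n else 0) • b i) := by
    intro i
    split_ifs with hij
    · rw [← hij, H.pr_laurent_smul_u _ (hb i), map_smul]
    · rw [H.pr_laurent_smul_u_eq_zero _ (hb i), zero_smul, map_zero]
      intro hd
      refine hij (hdeg _ _ ?_)
      have := dvd_sub (Dvd.intro n rfl : (m : ℤ) ∣ m * n) hd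
      rwa [show (m : ℤ) * n - (deg j + m * n - deg i) = deg i - deg j by ring] at this
  rw [Finset.sum_congr rfl fun i _ => h1 i, ← map_sum] at h
  have h2 := H.u_eq_zero (sum_mem fun i _ => ?_) h
  · have h3 := Fintype.linearIndependent_iff.mp b.linearIndependent _ h2 j
    simpa using h3
  · split_ifs with hij
    · refine Submodule.smul_mem _ _ ?_
      rw [H.piece_congr (q := deg i) (by rw [hij]; simp)]
      exact hb i
    · rw [zero_smul]
      exact zero_mem _

theorem u_eq_sum {ι : Type} [Fintype ι] (b : Module.Basis ι k 𝔤) {deg : ι → ℤ}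
    (hb : ∀ i, b i ∈ H.piece (deg i)) {r : ℤ} {w : 𝔤} (hw : w ∈ H.piece r) :
    H.u r w = ∑ i, (b.repr w i • (T ((r - deg i) / m) : k[T;T⁻¹])) • H.u (deg i) (b i) := by
  conv_lhs => rw [← b.sum_repr w, map_sum]
  refine Finset.sum_congr rfl fun i _ => ?_
  by_cases hi : (m : ℤ) ∣ r - deg i
  · rw [map_smul, smul_assoc, H.T_smul_u (hb i), Int.mul_ediv_cancel' hi, add_sub_cancel]
  · rw [H.repr_eq_zero b hb hw hi, zero_smul, zero_smul, zero_smul, map_zero]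

theorem top_le_span_u {ι : Type} [Fintype ι] (b : Module.Basis ι k 𝔤) {deg : ι → ℤ}
    (hb : ∀ i, b i ∈ H.piece (deg i)) :
    ⊤ ≤ Submodule.span k[T;T⁻¹] (Set.range fun i => H.u (deg i) (b i)) := by
  intro l _
  refine H.induction_u (fun p y hy => ?_) (zero_mem _) (fun x y => add_mem) l
  rw [H.u_eq_sum b hb hy]
  exact sum_mem fun i _ => Submodule.smul_mem _ _ (Submodule.subset_span ⟨i, rfl⟩)

theorem module_finite (H : TwistedLoop k 𝔤 L m) [IsAlgClosed k] [CharZero k]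
    [FiniteDimensional k 𝔤] :
    Module.Finite k[T;T⁻¹] L := by
  obtain ⟨ι, _, b, deg, hb, -⟩ := H.exists_homogeneous_basis
  exact ⟨Submodule.fg_def.mpr ⟨_, Set.finite_range _, top_le_iff.mp (H.top_le_span_u b hb)⟩⟩

theorem killingForm_u [IsAlgClosed k] [CharZero k] [FiniteDimensional k 𝔤] {p q : ℤ} {y z : 𝔤}
    (hy : y ∈ H.piece p) (hz : z ∈ H.piece q) :
    (killingForm k[T;T⁻¹] L (H.u p y) (H.u q z)).coeff 0 =
      if p + q = 0 then killingForm k 𝔤 y z else 0 := by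
  classical
  obtain ⟨ι, _, b, deg, hb, hdeg⟩ := H.exists_homogeneous_basis
  let B := Module.Basis.mk (H.linearIndependent_u b hb hdeg) (H.top_le_span_u b hb)
  have hB : ∀ i, B i = H.u (deg i) (b i) := fun i => Module.Basis.mk_apply _ _ _
  have hm : (m : ℤ) ≠ 0 := by exact_mod_cast H.m_pos.ne'
  rw [killingForm_apply_apply, killingForm_apply_apply, LinearMap.trace_eq_matrix_trace _ B,
    LinearMap.trace_eq_matrix_trace _ b, Matrix.trace, Matrix.trace,
    AddMonoidAlgebra.coeff_sum, Finsupp.coe_finsetSum, Finset.sum_apply]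
  have key : ∀ j, (B.repr ⁅H.u p y, ⁅H.u q z, B j⁆⁆ j).coeff 0 =
      if p + q = 0 then b.repr ⁅y, ⁅z, b j⁆⁆ j else 0 := by
    intro j
    have hmem := H.lie_mem_piece hy (H.lie_mem_piece hz (hb j))
    rw [hB, H.lie_u hz (hb j), H.lie_u hy (H.lie_mem_piece hz (hb j)), H.u_eq_sum b hb hmem]
    simp only [← hB, map_sum, map_smul, Finsupp.coe_finsetSum, Finset.sum_apply,
      Finsupp.smul_apply, B.repr_self, Finsupp.single_apply]
    rw [Finset.sum_eq_single j (fun i _ hi => by simp [hi]) (by simp)]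
    rw [if_pos rfl, smul_eq_mul, mul_one, AddMonoidAlgebra.coeff_smul, Finsupp.smul_apply,
      T_apply, show p + (q + deg j) - deg j = p + q by ring]
    by_cases hd : (m : ℤ) ∣ p + q
    · obtain ⟨n, hn⟩ := hd
      rw [hn, Int.mul_ediv_cancel_left _ hm]
      by_cases hn0 : n = 0
      · simp [hn0]
      · simp [hn0, H.m_pos.ne']
    · rw [H.repr_eq_zero b hb hmem, zero_smul, ite_self]
      rwa [show p + (q + deg j) - deg j = p + q by ring]
  split_ifs with h
  · refine Finset.sum_congr rfl fun j _ => ?_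
    rw [Matrix.diag_apply, Matrix.diag_apply, LinearMap.toMatrix_apply, LinearMap.toMatrix_apply]
    have := key j
    rw [if_pos h] at this
    exact this
  · refine Finset.sum_eq_zero fun j _ => ?_
    rw [Matrix.diag_apply, LinearMap.toMatrix_apply]
    have := key j
    rw [if_neg h] at this
    exact this

/-- The loop grading of a twisted loop algebra. -/
def loopGrading [IsAlgClosed k] [CharZero k] [FiniteDimensional k 𝔤] [LieAlgebra.IsKilling k 𝔤] :
    LoopGrading k L m where
  pr := H.pr
  δ := H.deg
  m_pos := by exact_mod_cast H.m_pos
  pr_self p l := by rw [H.pr_apply p l, H.pr_u _ (H.comp_mem l p), if_pos rfl]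
  pr_ne p q l h := by rw [H.pr_apply q l, H.pr_u _ (H.comp_mem l q), if_neg h]
  exists_sum l := ⟨(H.comp l).support, H.eq_sum_comp l⟩
  pr_T p l := by
    refine H.induction_u
      (P := fun l : L => H.pr (p + m) ((T 1 : k[T;T⁻¹]) • l) = (T 1 : k[T;T⁻¹]) • H.pr p l)
      (fun q y hy => ?_) (by simp) (fun x y hx hy => ?_) l
    · have h := H.pr_T_smul_u (p + m) (n := 1) hy
      rw [H.pr_u _ hy, h]
      simp only [mul_one, add_left_inj]
      split_ifs
      · rw [H.T_smul_u hy, mul_one]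
      · rw [smul_zero]
    · simp only [smul_add, map_add, hx, hy]
  pr_lie p q x y := by
    rw [H.pr_apply p x, H.pr_apply q y, H.lie_u (H.comp_mem x p) (H.comp_mem y q),
      H.pr_u _ (H.lie_mem_piece (H.comp_mem x p) (H.comp_mem y q)), if_pos rfl]
  pr_finite p := Submodule.finiteDimensional_of_le (LinearMap.range_comp_le_range _ _)
  pr_δ p l := by
    refine H.induction_u (P := fun l : L => H.pr p (H.deg l) = (p : k) • H.pr p l)
      (fun q y hy => ?_) (by simp) (fun x y hx hy => ?_) l
    · rw [H.deg_u hy, map_smul, H.pr_u _ hy]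
      split_ifs with h
      · rw [h]
      · rw [smul_zero, smul_zero]
    · simp only [smul_add, map_add, hx, hy]
  nondeg x hx := by
    have hx0 : H.comp x = 0 := by
      ext p
      have h : ∀ z, killingForm k 𝔤 (H.comp x p) z = 0 := by
        intro z
        have hz : z ∈ ⨆ q, H.piece q := by
          rw [H.iSup_piece]
          trivial
        refine Submodule.iSup_induction _ (motive := fun z => killingForm k 𝔤 (H.comp x p) z = 0)
          hz (fun q z hz => ?_) (map_zero _) (fun y z hy hz => by rw [map_add, hy, hz, add_zero])
        by_cases hq : (m : ℤ) ∣ p + q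
        · rw [H.piece_congr (q := -p) (by rwa [sub_neg_eq_add, add_comm])] at hz
          have h1 := hx (H.u (-p) z)
          rw [H.eq_sum_comp x, Finsupp.sum, map_sum, LinearMap.sum_apply,
            AddMonoidAlgebra.coeff_sum, Finsupp.coe_finsetSum, Finset.sum_apply] at h1
          simp only [H.killingForm_u (H.comp_mem x _) hz, add_neg_eq_zero] at h1
          rw [Finset.sum_ite_eq'] at h1
          split_ifs at h1 with hp
          · exact h1
          · rw [Finsupp.notMem_support_iff.mp hp, map_zero, LinearMap.zero_apply]
        · exact H.killingForm_eq_zero (H.comp_mem x p) hz hq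
      have hker : H.comp x p ∈ LinearMap.ker (killingForm k 𝔤) := LinearMap.ext h
      rwa [LieAlgebra.IsKilling.ker_killingForm_eq_bot, Submodule.mem_bot] at hker
    rw [H.eq_sum_comp x, hx0, Finsupp.sum_zero_index]

end TwistedLoop

/-- A finitely supported grading by a torsion-free divisible group can be coarsened to a grading
by rational numbers without merging components. -/
theorem exists_finGrading {k L I : Type} [Field k] [LieRing L] [LieAlgebra k[T;T⁻¹] L]
    [AddCommGroup I] [Module ℚ I] [DecidableEq I] (W : I → Submodule k[T;T⁻¹] L)
    (hW : DirectSum.IsInternal W) (hfin : {α | W α ≠ ⊥}.Finite)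
    (hlie : ∀ α β, ∀ x ∈ W α, ∀ y ∈ W β, ⁅x, y⁆ ∈ W (α + β)) :
    ∃ E : FinGrading k L, ∀ α, ∀ v ∈ W α, v ≠ 0 →
      ∃ q, E.e q v = v ∧ ∀ w, E.e q w ∈ W α := by
  classical
  have : Finite {α | W α ≠ ⊥} := hfin
  let s := hfin.toFinset
  have hs : ∀ {α v}, v ∈ W α → v ≠ 0 → α ∈ s := fun {α v} hv hv0 =>
    hfin.mem_toFinset.mpr fun h => hv0 (by rwa [h, Submodule.mem_bot] at hv)
  have hpairs : Finite {p : I × I // (p.1 ∈ s ∧ p.2 ∈ s) ∧ p.1 - p.2 ≠ 0} :=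
    Set.Finite.subset (s ×ˢ s).finite_toSet fun p hp => by simpa using hp.1
  obtain ⟨φ, hφ⟩ := Module.exists_dual_forall_apply_ne_zero (K := ℚ)
    (fun p : {p : I × I // (p.1 ∈ s ∧ p.2 ∈ s) ∧ p.1 - p.2 ≠ 0} => p.1.1 - p.1.2) fun p => p.2.2
  have hinj : ∀ {α β}, α ∈ s → β ∈ s → φ α = φ β → α = β := by
    intro α β hα hβ h
    by_contra hne
    exact hφ ⟨(α, β), ⟨hα, hβ⟩, sub_ne_zero.mpr hne⟩ (by simp [h])
  let := hW.chooseDecomposition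
  let pr : I → Module.End k[T;T⁻¹] L := fun α =>
    (W α).subtype.comp ((DirectSum.component k[T;T⁻¹] I (fun i => W i) α).comp
      (DirectSum.decomposeLinearEquiv W).toLinearMap)
  have hpr : ∀ α v, pr α v = (DirectSum.decompose W v α : L) := fun _ _ => rfl
  have hpr_mem : ∀ α v, pr α v ∈ W α := fun α v => (DirectSum.decompose W v α).2
  have hpr_same : ∀ {α v}, v ∈ W α → pr α v = v := fun hv =>
    DirectSum.decompose_of_mem_same W hv
  have hpr_ne : ∀ {α β v}, v ∈ W α → α ≠ β → pr β v = 0 := fun hv h =>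
    DirectSum.decompose_of_mem_ne W hv h
  let e : ℚ → Module.End k[T;T⁻¹] L := fun q => ∑ α ∈ s with φ α = q, pr α
  have he : ∀ {α}, α ∈ s → e (φ α) = pr α := by
    intro α hα
    have : {β ∈ s | φ β = φ α} = {α} := by
      ext β
      simp only [Finset.mem_filter, Finset.mem_singleton]
      exact ⟨fun h => hinj h.1 hα h.2, by rintro rfl; exact ⟨hα, rfl⟩⟩
    simp only [e, this, Finset.sum_singleton]
  have hcases : ∀ q, e q = 0 ∨ ∃ α ∈ s, φ α = q := by
    intro q
    by_cases h : ∃ α ∈ s, φ α = q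
    · exact Or.inr h
    · refine Or.inl (Finset.sum_eq_zero fun α hα => absurd ?_ h)
      exact ⟨α, Finset.mem_filter.mp hα⟩
  refine ⟨{ s := s.image φ, e := e, e_off := ?_, sum_e := ?_, e_e := ?_, e_lie := ?_ }, ?_⟩
  · intro q hq
    rcases hcases q with h | ⟨α, hα, rfl⟩
    · exact h
    · exact absurd (Finset.mem_image_of_mem φ hα) hq
  · intro l
    rw [Finset.sum_image fun α hα β hβ => hinj hα hβ]
    conv_rhs => rw [← DirectSum.sum_support_decompose W l]
    symm
    refine (Finset.sum_subset (fun α hα => ?_) fun α _ hα => ?_).trans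
      (Finset.sum_congr rfl fun α hα => by rw [he hα, hpr])
    · refine hs (DirectSum.decompose W l α).2 fun h => ?_
      rw [DFinsupp.mem_support_toFun] at hα
      exact hα (Subtype.ext h)
    · rw [DFinsupp.notMem_support_iff.mp hα, ZeroMemClass.coe_zero]
  · intro p q l
    rcases hcases q with hq | ⟨β, hβ, rfl⟩
    · rw [hq, LinearMap.zero_apply, map_zero, ite_self]
    rcases hcases p with hp | ⟨α, hα, rfl⟩
    · rw [hp, LinearMap.zero_apply]
      split_ifs with h
      · rw [← h, hp, LinearMap.zero_apply]
      · rfl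
    rw [he hα, he hβ]
    split_ifs with h
    · rw [hinj hα hβ h, hpr_same (hpr_mem β l)]
    · exact hpr_ne (hpr_mem β l) fun h' => h (by rw [h'])
  · intro p q x y
    rcases hcases q with hq | ⟨β, hβ, rfl⟩
    · simp [hq]
    rcases hcases p with hp | ⟨α, hα, rfl⟩
    · simp [hp]
    rw [he hα, he hβ]
    have hmem := hlie α β _ (hpr_mem α x) _ (hpr_mem β y)
    by_cases h0 : ⁅pr α x, pr β y⁆ = 0
    · rw [h0, map_zero]
    · rw [← map_add, he (hs hmem h0), hpr_same hmem]
  · intro α v hv hv0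
    refine ⟨φ α, ?_, fun w => ?_⟩
    · change e (φ α) v = v
      rw [he (hs hv hv0), hpr_same hv]
    · change e (φ α) w ∈ W α
      rw [he (hs hv hv0)]
      exact hpr_mem α w

theorem apply_eq_zero_of_apply_apply_eq_zero {k V : Type} [Field k] [AddCommGroup V] [Module k V]
    {f : Module.End k V} (hf : ⨆ μ, f.eigenspace μ = ⊤) {v : V} (hv : f (f v) = 0) : f v = 0 := by
  have hle : ∀ μ, f.eigenspace μ ≤ f.maxGenEigenspace μ := fun μ =>
    (f.genEigenspace μ).mono le_top
  have hmem : v ∈ f.maxGenEigenspace 0 := by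
    rw [Module.End.mem_maxGenEigenspace]
    exact ⟨2, by simpa [pow_two] using hv⟩
  have hdisj := (Module.End.independent_maxGenEigenspace f) 0
  have htop : v ∈ f.eigenspace 0 ⊔ ⨆ (μ) (_ : μ ≠ 0), f.maxGenEigenspace μ := by
    have : ⨆ μ, f.eigenspace μ ≤ f.eigenspace 0 ⊔ ⨆ (μ) (_ : μ ≠ 0), f.maxGenEigenspace μ := by
      refine iSup_le fun μ => ?_
      by_cases h : μ = 0
      · rw [h]
        exact le_sup_left
      · exact (hle μ).trans ((le_iSup₂ (f := fun μ (_ : μ ≠ 0) => f.maxGenEigenspace μ) μ h).trans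
          le_sup_right)
    rw [hf] at this
    exact this trivial
  obtain ⟨a, ha, b, hb, rfl⟩ := Submodule.mem_sup.mp htop
  have hb0 : b ∈ f.maxGenEigenspace 0 := by
    have := sub_mem hmem (hle 0 ha)
    rwa [add_sub_cancel_left] at this
  rw [Submodule.disjoint_def.mp hdisj b hb0 hb, add_zero]
  rw [Module.End.mem_eigenspace_iff, zero_smul] at ha
  exact ha

section Diagonalizable

variable {k M : Type} [Field k] [LieRing M] [LieAlgebra k M] {𝔪 : LieSubalgebra k M}

theorem mem_adWeightSpace {α : Module.Dual k 𝔪} {v : M} :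
    v ∈ adWeightSpace 𝔪 α ↔ ∀ z : 𝔪, ⁅(z : M), v⁆ = α z • v := by
  simp [adWeightSpace, Submodule.mem_iInf, sub_eq_zero]

theorem IsDiagonalizableSubalgebra.induction (h : IsDiagonalizableSubalgebra 𝔪) {P : M → Prop}
    (hP : ∀ (α : Module.Dual k 𝔪) (v : M), (∀ z : 𝔪, ⁅(z : M), v⁆ = α z • v) → P v) (h0 : P 0)
    (hadd : ∀ v w, P v → P w → P (v + w)) (v : M) : P v := by
  have hv : v ∈ ⨆ α : Module.Dual k 𝔪, adWeightSpace 𝔪 α := by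
    rw [h]
    trivial
  exact Submodule.iSup_induction _ (motive := P) hv
    (fun α v hv => hP α v (mem_adWeightSpace.mp hv)) h0 hadd

theorem IsDiagonalizableSubalgebra.lie_eq_zero_of_lie_lie (h : IsDiagonalizableSubalgebra 𝔪)
    {z : M} (hz : z ∈ 𝔪) {v : M} (hv : ⁅z, ⁅z, v⁆⁆ = 0) : ⁅z, v⁆ = 0 := by
  refine apply_eq_zero_of_apply_apply_eq_zero (f := LieAlgebra.ad k M z) ?_ hv
  rw [eq_top_iff, ← h]
  refine iSup_le fun α v hv => Submodule.mem_iSup_of_mem (α ⟨z, hz⟩) ?_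
  rw [Module.End.mem_eigenspace_iff]
  exact mem_adWeightSpace.mp hv ⟨z, hz⟩

theorem IsDiagonalizableSubalgebra.lie_eq_zero (h : IsDiagonalizableSubalgebra 𝔪)
    {z w : M} (hz : z ∈ 𝔪) (hw : w ∈ 𝔪) : ⁅z, w⁆ = 0 := by
  refine h.lie_eq_zero_of_lie_lie hz ?_
  have hcentral : ∀ v : M, ⁅⁅z, w⁆, v⁆ = 0 := by
    refine h.induction (P := fun v => ⁅⁅z, w⁆, v⁆ = 0) (fun α v hv => ?_) (lie_zero _)
      fun v w hv hw => by
      rw [lie_add, hv, hw, add_zero]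
    have h1 := hv ⟨z, hz⟩
    have h2 := hv ⟨w, hw⟩
    simp only at h1 h2
    rw [lie_lie, h1, h2, lie_smul, lie_smul, h1, h2, smul_comm, sub_self]
  rw [← lie_skew, hcentral, neg_zero]

theorem mem_iSup_adWeightSpace {v : M} (h : ∀ z ∈ 𝔪, ∃ a : k, ⁅z, v⁆ = a • v) :
    v ∈ ⨆ α : Module.Dual k 𝔪, adWeightSpace 𝔪 α := by
  by_cases hv : v = 0
  · rw [hv]
    exact zero_mem _
  choose a ha using fun z : 𝔪 => h z z.2
  let α : Module.Dual k 𝔪 :=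
    { toFun := a
      map_add' := fun z w => smul_left_injective k hv <| by
        simp only [add_smul, ← ha, ← add_lie]
        rfl
      map_smul' := fun r z => smul_left_injective k hv <| by
        simp only [RingHom.id_apply, smul_eq_mul, mul_smul, ← ha, ← smul_lie]
        rfl }
  exact Submodule.mem_iSup_of_mem α (mem_adWeightSpace.mpr ha)

end Diagonalizable

section JointEigenspaces

variable {k L J : Type} [Field k] [LieRing L] [LieAlgebra k[T;T⁻¹] L] [LieAlgebra k L]
  [IsScalarTower k k[T;T⁻¹] L] [AddCommGroup J] [Module k J]

/-- The joint eigenspaces of a family of elements acting by the adjoint representation. -/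
def jointEigenspace (a : J →ₗ[k] L) (α : Module.Dual k J) : Submodule k[T;T⁻¹] L where
  carrier := {l | ∀ z, ⁅a z, l⁆ = α z • l}
  add_mem' {l l'} h h' z := by rw [lie_add, h z, h' z, smul_add]
  zero_mem' z := by simp
  smul_mem' r l h z := by rw [lie_smul, h z, smul_comm]

theorem lie_mem_jointEigenspace {a : J →ₗ[k] L} {α β : Module.Dual k J} {x y : L}
    (hx : x ∈ jointEigenspace a α) (hy : y ∈ jointEigenspace a β) :
    ⁅x, y⁆ ∈ jointEigenspace a (α + β) := fun z => by
  rw [leibniz_lie, hx z, hy z, smul_lie, lie_smul, LinearMap.add_apply, add_smul]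

theorem iSupIndep_jointEigenspace {a : J →ₗ[k] L} (ha : ∀ z w, ⁅a z, a w⁆ = 0) :
    iSupIndep (jointEigenspace a) := by
  have hcomm : ∀ z w, Commute (LieAlgebra.ad k L (a z)) (LieAlgebra.ad k L (a w)) := by
    intro z w
    ext l
    have := leibniz_lie (a z) (a w) l
    rw [ha, zero_lie, zero_add] at this
    exact this
  have hind := (Module.End.independent_iInf_maxGenEigenspace_of_forall_mapsTo
    (fun z => LieAlgebra.ad k L (a z))
    fun z w φ => Module.End.mapsTo_maxGenEigenspace_of_comm (hcomm w z) φ).comp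
      (DFunLike.coe_injective (F := Module.Dual k J))
  rw [iSupIndep_iff_finsetSum_eq_zero_imp_eq_zero] at hind ⊢
  refine fun s v hv => hind s v fun α hα => ?_
  simp only [Function.comp_apply, Submodule.mem_iInf]
  intro z
  refine (Module.End.genEigenspace _ _).mono (le_top : (1 : ℕ∞) ≤ ⊤) ?_
  exact Module.End.mem_eigenspace_iff.mpr (hv α hα z)

theorem isNoetherianRing_laurentPolynomial (k : Type) [Field k] :
    IsNoetherianRing k[T;T⁻¹] :=
  IsLocalization.isNoetherianRing (Submonoid.powers (Polynomial.X : Polynomial k)) _ inferInstance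

theorem exists_finGrading_jointEigenspace [CharZero k] [Module.Finite k[T;T⁻¹] L]
    {a : J →ₗ[k] L} (ha : ∀ z w, ⁅a z, a w⁆ = 0) (htop : ⨆ α, jointEigenspace a α = ⊤) :
    ∃ E : FinGrading k L, ∀ α, ∀ v ∈ jointEigenspace a α, v ≠ 0 →
      ∃ q, E.e q v = v ∧ ∀ w, E.e q w ∈ jointEigenspace a α := by
  classical
  have := isNoetherianRing_laurentPolynomial k
  let : Module ℚ (Module.Dual k J) := Module.compHom _ (algebraMap ℚ k)
  have hind := iSupIndep_jointEigenspace ha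
  exact exists_finGrading _
    (DirectSum.isInternal_submodule_of_iSupIndep_of_iSup_eq_top hind htop)
    (WellFoundedGT.finite_ne_bot_of_iSupIndep hind)
    fun α β x hx y hy => lie_mem_jointEigenspace hx hy

/-- A family of commuting `ad`-diagonalizable elements is annihilated by some diagonalizable
derivation `δ + ad x`, which can be diagonalized simultaneously with the family. -/
theorem LoopGrading.exists_derivation {m : ℤ} (G : LoopGrading k L m) [IsAlgClosed k] [CharZero k]
    [Module.Finite k[T;T⁻¹] L]
    {a : J →ₗ[k] L} (ha : ∀ z w, ⁅a z, a w⁆ = 0) (htop : ⨆ α, jointEigenspace a α = ⊤) :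
    ∃ x : L, (∀ z, G.δ (a z) + ⁅x, a z⁆ = 0) ∧
      ∀ P : L → Prop,
        (∀ (α : Module.Dual k J) (μ : k) (v : L), v ∈ jointEigenspace a α →
          G.δ v + ⁅x, v⁆ = μ • v → P v) →
        P 0 → (∀ v w, P v → P w → P (v + w)) → ∀ v, P v := by
  obtain ⟨E, hE⟩ := exists_finGrading_jointEigenspace ha htop
  obtain ⟨x, hx, hxtop⟩ := G.exists_semisimple_derivation E
  have hmem : ∀ v : L, v ∈ ⨆ α, jointEigenspace a α := fun v => by rw [htop]; trivial
  have hstable : ∀ α, ∀ v ∈ jointEigenspace a α, G.δ v + ⁅x, v⁆ ∈ jointEigenspace a α := by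
    intro α v hv
    by_cases hv0 : v = 0
    · simp [hv0]
    obtain ⟨q, hq, hq'⟩ := hE α v hv hv0
    rw [← hq, ← hx]
    exact hq' _
  refine ⟨x, fun z => ?_, fun P hP h0 hadd v => ?_⟩
  · have hcentral : ∀ v : L, ⁅G.δ (a z) + ⁅x, a z⁆, v⁆ = 0 := by
      intro v
      refine Submodule.iSup_induction _ (motive := fun v => ⁅G.δ (a z) + ⁅x, a z⁆, v⁆ = 0)
        (hmem v) (fun α v hv => ?_) (lie_zero _) fun v w h h' => by rw [lie_add, h, h', add_zero]
      have h1 := hstable α v hv z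
      rw [lie_add, leibniz_lie (a z) x v, hv z, lie_smul, ← lie_skew (a z) x, neg_lie] at h1
      have h2 := G.δ_lie (a z) v
      rw [hv z, map_smul] at h2
      rw [add_lie]
      linear_combination (norm := module) -h1 - h2
    refine G.eq_zero_of_form fun y => ?_
    have had : LieAlgebra.ad k[T;T⁻¹] L (G.δ (a z) + ⁅x, a z⁆) = 0 :=
      LinearMap.ext hcentral
    rw [form_apply, had, zero_mul, tau_zero]
  · refine Submodule.iSup_induction _ (motive := P) (hmem v) (fun α v hv => ?_) h0 hadd
    by_cases hv0 : v = 0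
    · rwa [hv0]
    obtain ⟨q, hq, hq'⟩ := hE α v hv hv0
    have hv' : v ∈ ⨆ μ, Module.End.eigenspace (G.δ + LieAlgebra.ad k L x) μ := by
      rw [hxtop]
      trivial
    rw [← hq]
    refine Submodule.iSup_induction _ (motive := fun w => P (E.e q w)) hv' (fun μ w hw => ?_)
      (by rwa [map_zero]) fun v w h h' => by
        rw [map_add]
        exact hadd _ _ h h'
    refine hP α μ _ (hq' w) ?_
    rw [Module.End.mem_eigenspace_iff] at hw
    replace hw : G.δ w + ⁅x, w⁆ = μ • w := hw
    rw [← hx, hw, LinearMap.map_smul_of_tower]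

end JointEigenspaces

theorem LoopGrading.form_δ_left {k L : Type} [Field k] [LieRing L] [LieAlgebra k[T;T⁻¹] L]
    [LieAlgebra k L] [IsScalarTower k k[T;T⁻¹] L] [Module.Finite k[T;T⁻¹] L] {m : ℤ}
    (G : LoopGrading k L m) (x y : L) : form k L (G.δ x) y = -form k L x (G.δ y) := by
  refine G.induction_pr (motive := fun x => form k L (G.δ x) y = -form k L x (G.δ y))
    (fun x x' h h' => ?_) (by simp) (fun p x => ?_) x
  · simp only [map_add, LinearMap.add_apply, h, h', neg_add]
  · rw [G.δ_pr, map_smul, LinearMap.smul_apply, G.form_pr_left, G.form_pr_left, G.pr_δ, map_smul]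
    simp

/-- The extension of a loop algebra by a central element `c` and the degree derivation `d`. -/
structure AffineExtension {k L : Type} [Field k] [LieRing L] [LieAlgebra k[T;T⁻¹] L]
    [LieAlgebra k L] [IsScalarTower k k[T;T⁻¹] L] {m : ℤ} (G : LoopGrading k L m)
    (M : Type) [LieRing M] [LieAlgebra k M] where
  c : M
  d : M
  ι : L →ₗ[k] M
  c_lie : ∀ z : M, ⁅c, z⁆ = 0
  d_lie : ∀ l, ⁅d, ι l⁆ = ι (G.δ l)
  ι_lie : ∀ x y, ⁅ι x, ι y⁆ = ι ⁅x, y⁆ + form k L (G.δ x) y • c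
  exists_eq : ∀ z, ∃ (l : L) (a b : k), z = ι l + a • c + b • d
  unique : ∀ (l : L) (a b : k), ι l + a • c + b • d = 0 → l = 0 ∧ a = 0 ∧ b = 0

namespace AffineExtension

variable {k L M : Type} [Field k] [LieRing L] [LieAlgebra k[T;T⁻¹] L] [LieAlgebra k L]
  [IsScalarTower k k[T;T⁻¹] L] {m : ℤ} {G : LoopGrading k L m} [LieRing M] [LieAlgebra k M]
  (A : AffineExtension G M)

/-- The coordinates of an element of the extension. -/
def equiv : (L × k × k) ≃ₗ[k] M :=
  LinearEquiv.ofBijective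
    (LinearMap.coprod A.ι
      (LinearMap.coprod (LinearMap.toSpanSingleton k M A.c) (LinearMap.toSpanSingleton k M A.d)))
    ⟨(injective_iff_map_eq_zero _).mpr fun v hv => by
      obtain ⟨h1, h2, h3⟩ := A.unique v.1 v.2.1 v.2.2 (by simpa [add_assoc] using hv)
      exact Prod.ext h1 (Prod.ext h2 h3),
    fun z => by
      obtain ⟨l, a, b, rfl⟩ := A.exists_eq z
      exact ⟨(l, a, b), by simp [add_assoc]⟩⟩

theorem equiv_apply (l : L) (a b : k) :
    A.equiv (l, a, b) = A.ι l + a • A.c + b • A.d := by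
  rw [add_assoc]
  rfl

/-- The loop algebra coordinate. -/
def prL : M →ₗ[k] L := LinearMap.fst k L (k × k) ∘ₗ A.equiv.symm.toLinearMap

/-- The coefficient of the degree derivation. -/
def prD : M →ₗ[k] k := LinearMap.snd k k k ∘ₗ LinearMap.snd k L (k × k) ∘ₗ
  A.equiv.symm.toLinearMap

theorem prL_apply (l : L) (a b : k) : A.prL (A.ι l + a • A.c + b • A.d) = l := by
  rw [← equiv_apply]
  simp [prL]

theorem prD_apply (l : L) (a b : k) : A.prD (A.ι l + a • A.c + b • A.d) = b := by
  rw [← equiv_apply]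
  simp [prD]

theorem prL_ι (l : L) : A.prL (A.ι l) = l := by
  simpa using A.prL_apply l 0 0

theorem prD_ι (l : L) : A.prD (A.ι l) = 0 := by
  simpa using A.prD_apply l 0 0

theorem lie_c (z : M) : ⁅z, A.c⁆ = 0 := by
  rw [← lie_skew, A.c_lie, neg_zero]

theorem exists_coords (z : M) : ∃ a : k, z = A.ι (A.prL z) + a • A.c + A.prD z • A.d := by
  obtain ⟨l, a, b, rfl⟩ := A.exists_eq z
  exact ⟨a, by rw [prL_apply, prD_apply]⟩

theorem lie_eq (z w : M) :
    ⁅z, w⁆ = A.ι (⁅A.prL z, A.prL w⁆ + A.prD z • G.δ (A.prL w) - A.prD w • G.δ (A.prL z)) +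
      form k L (G.δ (A.prL z)) (A.prL w) • A.c := by
  obtain ⟨l, a, b, rfl⟩ := A.exists_eq z
  obtain ⟨l', a', b', rfl⟩ := A.exists_eq w
  have h : ⁅A.ι l, A.d⁆ = -A.ι (G.δ l) := by rw [← lie_skew, A.d_lie]
  rw [prL_apply, prL_apply, prD_apply, prD_apply]
  simp only [add_lie, lie_add, smul_lie, lie_smul, A.c_lie, A.lie_c,
    A.ι_lie, A.d_lie, h, lie_self, map_add, map_sub, map_smul]
  module

theorem prL_lie (z w : M) : A.prL ⁅z, w⁆ =
    ⁅A.prL z, A.prL w⁆ + A.prD z • G.δ (A.prL w) - A.prD w • G.δ (A.prL z) := by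
  rw [A.lie_eq, ← add_zero (A.ι _ + _), ← zero_smul k A.d, A.prL_apply]

theorem prD_lie (z w : M) : A.prD ⁅z, w⁆ = 0 := by
  rw [A.lie_eq, ← add_zero (A.ι _ + _), ← zero_smul k A.d, A.prD_apply]

theorem iSup_jointEigenspace {𝔪 : LieSubalgebra k M} (h : IsDiagonalizableSubalgebra 𝔪)
    (hD : ∀ z ∈ 𝔪, A.prD z = 0) :
    ⨆ α, jointEigenspace (A.prL ∘ₗ 𝔪.toSubmodule.subtype) α = ⊤ := by
  set a : 𝔪 →ₗ[k] L := A.prL ∘ₗ 𝔪.toSubmodule.subtype with ha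
  have key : ∀ v : M, ∃ w : M, (∀ z ∈ 𝔪, ⁅z, w⁆ = 0) ∧ A.prD v = A.prD w ∧
      A.prL v - A.prL w ∈ ⨆ α, jointEigenspace a α := by
    refine h.induction (P := fun v => ∃ w : M, (∀ z ∈ 𝔪, ⁅z, w⁆ = 0) ∧ A.prD v = A.prD w ∧
      A.prL v - A.prL w ∈ ⨆ α, jointEigenspace a α) (fun α v hv => ?_) ?_ ?_
    · by_cases hα : α = 0
      · refine ⟨v, fun z hz => by simpa [hα] using hv ⟨z, hz⟩, rfl, ?_⟩
        rw [sub_self]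
        exact zero_mem _
      · obtain ⟨z, hz⟩ : ∃ z, α z ≠ 0 := by
          by_contra! h'
          exact hα (LinearMap.ext h')
        have hv0 : A.prD v = 0 := by
          have := congrArg A.prD (hv z)
          rw [prD_lie, map_smul, smul_eq_mul, eq_comm, mul_eq_zero] at this
          exact this.resolve_left hz
        refine ⟨0, fun _ _ => lie_zero _, by rw [hv0, map_zero], ?_⟩
        rw [map_zero, sub_zero]
        refine Submodule.mem_iSup_of_mem α fun z => ?_
        have := congrArg A.prL (hv z)
        rw [prL_lie, hD z z.2, hv0, zero_smul, zero_smul, add_zero, sub_zero, map_smul] at this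
        exact this
    · exact ⟨0, fun _ _ => lie_zero _, rfl, by rw [sub_self]; exact zero_mem _⟩
    · rintro v v' ⟨w, h1, h2, h3⟩ ⟨w', h1', h2', h3'⟩
      refine ⟨w + w', fun z hz => by rw [lie_add, h1 z hz, h1' z hz, add_zero],
        by rw [map_add, map_add, h2, h2'], ?_⟩
      rw [map_add, map_add, add_sub_add_comm]
      exact add_mem h3 h3'
  rw [eq_top_iff]
  intro l _
  obtain ⟨w, h1, h2, h3⟩ := key (A.ι l)
  rw [prD_ι] at h2
  have hw : A.prL w ∈ jointEigenspace a 0 := by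
    intro z
    have := congrArg A.prL (h1 z z.2)
    rw [prL_lie, hD z z.2, ← h2, zero_smul, zero_smul, add_zero, sub_zero, map_zero] at this
    rw [LinearMap.zero_apply, zero_smul]
    exact this
  rw [prL_ι] at h3
  have := add_mem h3 (Submodule.mem_iSup_of_mem 0 hw)
  rwa [sub_add_cancel] at this

/-- The abelian subalgebra spanned by an abelian subalgebra and an element commuting with it. -/
def _root_.LieSubalgebra.adjoin (𝔪 : LieSubalgebra k M) (D : M)
    (h : ∀ z ∈ 𝔪, ∀ w ∈ 𝔪, ⁅z, w⁆ = 0) (hD : ∀ z ∈ 𝔪, ⁅z, D⁆ = 0) : LieSubalgebra k M where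
  carrier := {w | ∃ z ∈ 𝔪, ∃ r : k, w = z + r • D}
  add_mem' := by
    rintro _ _ ⟨z, hz, r, rfl⟩ ⟨z', hz', r', rfl⟩
    exact ⟨z + z', add_mem hz hz', r + r', by module⟩
  zero_mem' := ⟨0, zero_mem _, 0, by simp⟩
  smul_mem' := by
    rintro s _ ⟨z, hz, r, rfl⟩
    exact ⟨s • z, 𝔪.smul_mem s hz, s * r, by module⟩
  lie_mem' := by
    rintro _ _ ⟨z, hz, r, rfl⟩ ⟨z', hz', r', rfl⟩
    refine ⟨0, zero_mem _, 0, ?_⟩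
    have : ⁅D, z'⁆ = 0 := by rw [← lie_skew, hD z' hz', neg_zero]
    simp [h z hz z' hz', hD z hz, this]

/-- A diagonalizable subalgebra without degree derivation component extends to one containing an
element with such a component. -/
theorem exists_isDiagonalizableSubalgebra [IsAlgClosed k] [CharZero k]
    [Module.Finite k[T;T⁻¹] L] {𝔪 : LieSubalgebra k M} (h : IsDiagonalizableSubalgebra 𝔪)
    (hD : ∀ z ∈ 𝔪, A.prD z = 0) :
    ∃ 𝔪' : LieSubalgebra k M, IsDiagonalizableSubalgebra 𝔪' ∧ 𝔪 ≤ 𝔪' ∧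
      ∃ z ∈ 𝔪', A.prD z ≠ 0 := by
  have hcomm : ∀ z w : 𝔪, ⁅A.prL z, A.prL w⁆ = 0 := by
    intro z w
    have := congrArg A.prL (h.lie_eq_zero z.2 w.2)
    rwa [prL_lie, hD z z.2, hD w w.2, zero_smul, zero_smul, add_zero, sub_zero, map_zero] at this
  obtain ⟨x, hx, hind⟩ := G.exists_derivation (a := A.prL ∘ₗ 𝔪.toSubmodule.subtype) hcomm
    (A.iSup_jointEigenspace h hD)
  replace hx : ∀ z ∈ 𝔪, G.δ (A.prL z) + ⁅x, A.prL z⁆ = 0 := fun z hz => hx ⟨z, hz⟩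
  set D : M := A.ι x + A.d with hDdef
  have hDL : A.prL D = x := by simpa [hDdef] using A.prL_apply x 0 1
  have hDD : A.prD D = 1 := by simpa [hDdef] using A.prD_apply x 0 1
  have hDcomm : ∀ z ∈ 𝔪, ⁅z, D⁆ = 0 := by
    intro z hz
    refine h.lie_eq_zero_of_lie_lie hz ?_
    have h0 : ⁅A.prL z, x⁆ - G.δ (A.prL z) = 0 := by
      rw [← lie_skew, ← neg_eq_zero, ← hx z hz]
      abel
    rw [A.lie_eq z D, hDL, hDD, hD z hz, zero_smul, add_zero, one_smul, h0, map_zero, zero_add,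
      lie_smul, A.lie_c, smul_zero]
  have hab : ∀ z ∈ 𝔪, ∀ w ∈ 𝔪, ⁅z, w⁆ = 0 := fun z hz w hw => h.lie_eq_zero hz hw
  set 𝔪' := 𝔪.adjoin D hab hDcomm with h𝔪'
  have hle : 𝔪 ≤ 𝔪' := fun z hz => ⟨z, hz, 0, by simp⟩
  have hDmem : D ∈ 𝔪' := ⟨0, zero_mem _, 1, by simp⟩
  have hab' : ∀ z ∈ 𝔪', ∀ w ∈ 𝔪', ⁅z, w⁆ = 0 := by
    rintro _ ⟨z, hz, r, rfl⟩ _ ⟨z', hz', r', rfl⟩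
    have : ⁅D, z'⁆ = 0 := by rw [← lie_skew, hDcomm z' hz', neg_zero]
    simp [hab z hz z' hz', hDcomm z hz, this]
  refine ⟨𝔪', ?_, hle, D, hDmem, by rw [hDD]; exact one_ne_zero⟩
  set S : Submodule k M := ⨆ α : Module.Dual k 𝔪', adWeightSpace 𝔪' α with hS
  have hcS : A.c ∈ S := mem_iSup_adWeightSpace fun z _ => ⟨0, by rw [A.lie_c, zero_smul]⟩
  have hDS : D ∈ S := mem_iSup_adWeightSpace fun z hz => ⟨0, by rw [hab' z hz D hDmem, zero_smul]⟩
  have hιS : ∀ l, A.ι l ∈ S := by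
    refine hind (fun l => A.ι l ∈ S) (fun α μ l hl hμ => ?_) (by simp) fun v w hv hw => by
      rw [map_add]
      exact add_mem hv hw
    have hzl : ∀ z : 𝔪, ⁅(z : M), A.ι l⁆ =
        α z • A.ι l + form k L (G.δ (A.prL z)) l • A.c := by
      intro z
      have hl' : ⁅A.prL z, l⁆ = α z • l := hl z
      rw [A.lie_eq, A.prL_ι, A.prD_ι, hD z z.2, zero_smul, zero_smul, add_zero, sub_zero, hl',
        map_smul]
    have hDl : ⁅D, A.ι l⁆ = μ • A.ι l + form k L (G.δ x) l • A.c := by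
      rw [A.lie_eq, A.prL_ι, A.prD_ι, hDL, hDD, zero_smul, one_smul, sub_zero, add_comm ⁅x, l⁆, hμ,
        map_smul]
    have hact : ∀ w ∈ 𝔪', ∃ a b : k, ⁅w, A.ι l⁆ = a • A.ι l + b • A.c := by
      rintro _ ⟨z, hz, r, rfl⟩
      refine ⟨α ⟨z, hz⟩ + r * μ, form k L (G.δ (A.prL z)) l + r * form k L (G.δ x) l, ?_⟩
      rw [add_lie, smul_lie, hzl ⟨z, hz⟩, hDl]
      module
    by_cases hw : ∃ w ∈ 𝔪', ∃ a b : k, a ≠ 0 ∧ ⁅w, A.ι l⁆ = a • A.ι l + b • A.c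
    · obtain ⟨w, hw, a, b, ha, hwl⟩ := hw
      have hv : A.ι l + (b / a) • A.c ∈ S := by
        have h1 : ⁅w, A.ι l + (b / a) • A.c⁆ = a • (A.ι l + (b / a) • A.c) := by
          rw [lie_add, lie_smul, A.lie_c, smul_zero, add_zero, hwl, smul_add, smul_smul,
            mul_div_cancel₀ _ ha]
        refine mem_iSup_adWeightSpace fun z hz => ?_
        obtain ⟨a', b', hz'⟩ := hact z hz
        refine ⟨a', smul_right_injective M ha ?_⟩
        have h2 := leibniz_lie w z (A.ι l + (b / a) • A.c)
        rw [hab' w hw z hz, zero_lie, zero_add, h1, lie_smul] at h2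
        change a • ⁅z, A.ι l + (b / a) • A.c⁆ = a • a' • (A.ι l + (b / a) • A.c)
        rw [← h2, smul_comm a a', ← h1]
        simp only [lie_add, lie_smul, A.lie_c, smul_zero, add_zero, hz']
      have := sub_mem hv (S.smul_mem (b / a) hcS)
      rwa [add_sub_cancel_right] at this
    · push Not at hw
      have hzero : ∀ w ∈ 𝔪', ∀ a b : k, ⁅w, A.ι l⁆ = a • A.ι l + b • A.c → a = 0 := by
        intro w hw' a b hwl
        by_contra ha
        exact hw w hw' a b ha hwl
      have hμ0 := hzero D hDmem _ _ hDl
      have hDl0 : ⁅D, A.ι l⁆ = 0 := by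
        rw [hμ0, zero_smul] at hμ
        rw [hDl, hμ0, zero_smul, zero_add, G.form_δ_left, eq_neg_of_add_eq_zero_left hμ, map_neg,
          ← form_lie, lie_self, map_zero, LinearMap.zero_apply, neg_zero, neg_zero, zero_smul]
      refine mem_iSup_adWeightSpace fun w hw' => ⟨0, ?_⟩
      obtain ⟨z, hz, r, rfl⟩ := hw'
      have hz0 : ⁅z, A.ι l⁆ = 0 := by
        refine h.lie_eq_zero_of_lie_lie hz ?_
        rw [hzl ⟨z, hz⟩, hzero z (hle hz) _ _ (hzl ⟨z, hz⟩), zero_smul, zero_add, lie_smul,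
          A.lie_c, smul_zero]
      rw [add_lie, smul_lie, hz0, hDl0, smul_zero, add_zero, zero_smul]
  change S = ⊤
  rw [eq_top_iff]
  intro v _
  obtain ⟨l, a, b, rfl⟩ := A.exists_eq v
  have hd : A.d ∈ S := by
    have := sub_mem hDS (hιS x)
    rwa [hDdef, add_sub_cancel_left] at this
  exact add_mem (add_mem (hιS l) (S.smul_mem a hcS)) (S.smul_mem b hd)

theorem exists_mem_of_isMAD [IsAlgClosed k] [CharZero k] [Module.Finite k[T;T⁻¹] L]
    {𝔪 : LieSubalgebra k M} (h : IsMAD 𝔪) : ∃ z ∈ 𝔪, A.prD z ≠ 0 := by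
  by_contra! h0
  obtain ⟨𝔪', h1, h2, z, hz, hz0⟩ := A.exists_isDiagonalizableSubalgebra h.1 h0
  rw [h.2 𝔪' h1 h2] at hz
  exact hz0 (h0 z hz)

end AffineExtension

/-- The affine extension given on generators of the twisted loop algebra. -/
def TwistedLoop.affineExtension {k 𝔤 L M : Type} [Field k] [LieRing 𝔤] [LieAlgebra k 𝔤] [LieRing L]
    [LieAlgebra k[T;T⁻¹] L] [LieAlgebra k L] [IsScalarTower k k[T;T⁻¹] L] {m : ℕ}
    (H : TwistedLoop k 𝔤 L m) [IsAlgClosed k] [CharZero k] [FiniteDimensional k 𝔤]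
    [LieAlgebra.IsKilling k 𝔤] [LieRing M] [LieAlgebra k M] (c d : M) (ι : L →ₗ[k] M)
    (hc : ∀ z : M, ⁅c, z⁆ = 0)
    (hd : ∀ (p : ℤ) (y : 𝔤), H.σ y = H.ζ ^ p • y → ⁅d, ι (H.u p y)⁆ = (p : k) • ι (H.u p y))
    (hbr : ∀ (p q : ℤ) (y z : 𝔤), H.σ y = H.ζ ^ p • y → H.σ z = H.ζ ^ q • z →
      ⁅ι (H.u p y), ι (H.u q z)⁆ = ι (H.u (p + q) ⁅y, z⁆) +
        (if p + q = 0 then (p : k) * killingForm k 𝔤 y z else 0) • c)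
    (hdec : ∀ z : M, ∃ (l : L) (a b : k), z = ι l + a • c + b • d)
    (huniq : ∀ (l : L) (a b : k), ι l + a • c + b • d = 0 → l = 0 ∧ a = 0 ∧ b = 0) :
    AffineExtension H.loopGrading M where
  c := c
  d := d
  ι := ι
  c_lie := hc
  d_lie l := by
    refine H.induction_u (P := fun l => ⁅d, ι l⁆ = ι (H.deg l)) (fun p y hy => ?_) (by simp)
      (fun v w hv hw => by simp only [map_add, lie_add, hv, hw]) l
    rw [hd p y (H.mem_piece.mp hy), H.deg_u hy, map_smul]
  ι_lie x y := by
    refine H.induction_u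
      (P := fun x => ⁅ι x, ι y⁆ = ι ⁅x, y⁆ + form k L (H.deg x) y • c) (fun p x hx => ?_) (by simp)
      (fun v w hv hw => by
        simp only [map_add, add_lie, LinearMap.add_apply, hv, hw]
        module) x
    refine H.induction_u (P := fun y => ⁅ι (H.u p x), ι y⁆ =
      ι ⁅H.u p x, y⁆ + form k L (H.deg (H.u p x)) y • c) (fun q y hy => ?_) (by simp)
      (fun v w hv hw => by
        simp only [map_add, lie_add, hv, hw]
        module) y
    rw [hbr p q x y (H.mem_piece.mp hx) (H.mem_piece.mp hy), H.lie_u hx hy, H.deg_u hx, map_smul,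
      LinearMap.smul_apply, form_eq_killingForm, H.killingForm_u hx hy, smul_eq_mul, mul_ite,
      mul_zero]
  exists_eq := hdec
  unique := huniq

/-- No MAD of `L̂(𝔤,σ)` is contained in `L̃(𝔤,σ) = L(𝔤,σ) ⊕ kc`;
equivalently, every MAD contains an element `x' + a•c + b•d` with `x' ∈ L(𝔤,σ)` and
`b ≠ 0`. -/
theorem mad_not_in_core
    -- the base field
    (k : Type) [Field k] [IsAlgClosed k] [CharZero k]
    -- the simple finite-dimensional Lie algebra 𝔤
    (𝔤 : Type) [LieRing 𝔤] [LieAlgebra k 𝔤] [FiniteDimensional k 𝔤]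
    [LieAlgebra.IsSimple k 𝔤]
    -- the order m of σ and a primitive m-th root of unity ζ
    (m : ℕ) (hm : 0 < m)
    (σ : 𝔤 ≃ₗ⁅k⁆ 𝔤) (hσ : ∀ y : 𝔤, (⇑σ)^[m] y = y)
    (ζ : k) (hζ : IsPrimitiveRoot ζ m)
    -- the twisted loop algebra L(𝔤,σ) = ⊕_{i∈ℤ} 𝔤_ī ⊗ sⁱ, an R-Lie algebra for
    -- R = k[t^{±1}] = LaurentPolynomial k (with t = sᵐ);
    -- `u p y` represents `y ⊗ sᵖ` for `y ∈ 𝔤_p̄`, i.e. `σ y = ζ^p • y`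
    (Lg : Type) [LieRing Lg] [LieAlgebra (LaurentPolynomial k) Lg]
    [LieAlgebra k Lg] [IsScalarTower k (LaurentPolynomial k) Lg]
    (u : ℤ → 𝔤 →ₗ[k] Lg)
    (hu_bracket : ∀ (p q : ℤ) (y z : 𝔤), σ y = ζ ^ p • y → σ z = ζ ^ q • z →
      ⁅u p y, u q z⁆ = u (p + q) ⁅y, z⁆)
    (hu_t : ∀ (p : ℤ) (y : 𝔤), σ y = ζ ^ p • y →
      (T 1 : LaurentPolynomial k) • u p y = u (p + (m : ℤ)) y)
    (hu_span : ∀ l : Lg, ∃ f : ℤ →₀ 𝔤, (∀ i, σ (f i) = ζ ^ i • f i) ∧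
      l = f.sum fun i yi => u i yi)
    (hu_ind : ∀ f : ℤ →₀ 𝔤, (∀ i, σ (f i) = ζ ^ i • f i) →
      (f.sum fun i yi => u i yi) = 0 → f = 0)
    -- the twisted affine Kac–Moody algebra L̂(𝔤,σ) = L(𝔤,σ) ⊕ kc ⊕ kd
    (Lhat : Type) [LieRing Lhat] [LieAlgebra k Lhat]
    (c d : Lhat) (ι : Lg →ₗ[k] Lhat)
    (hc : ∀ z : Lhat, ⁅c, z⁆ = 0)
    (hd : ∀ (p : ℤ) (y : 𝔤), σ y = ζ ^ p • y →
      ⁅d, ι (u p y)⁆ = (p : k) • ι (u p y))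
    (hbr : ∀ (p q : ℤ) (y z : 𝔤), σ y = ζ ^ p • y → σ z = ζ ^ q • z →
      ⁅ι (u p y), ι (u q z)⁆ =
        ι (u (p + q) ⁅y, z⁆) +
          (if p + q = 0 then (p : k) * killingForm k 𝔤 y z else 0) • c)
    (hdec : ∀ z : Lhat, ∃ (l : Lg) (a b : k), z = ι l + a • c + b • d)
    (huniq : ∀ (l : Lg) (a b : k), ι l + a • c + b • d = 0 → l = 0 ∧ a = 0 ∧ b = 0)
    :
    ∀ 𝔪 : LieSubalgebra k Lhat, IsMAD 𝔪 →
      ¬ (𝔪.toSubmodule ≤ LinearMap.range ι ⊔ Submodule.span k {c}) ∧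
      ∃ z ∈ 𝔪, ∃ (l : Lg) (a b : k), b ≠ 0 ∧ z = ι l + a • c + b • d := by
  have := LieAlgebra.HasTrivialRadical.instIsKilling (R := k) (L := 𝔤)
  let H : TwistedLoop k 𝔤 Lg m :=
    { m_pos := hm, σ := σ, iterate_σ := hσ, ζ := ζ, isPrimitiveRoot := hζ, u := u
      u_lie := hu_bracket, T_u := hu_t, u_span := hu_span, u_ind := hu_ind }
  have := H.module_finite
  let A := H.affineExtension c d ι hc hd hbr hdec huniq
  intro 𝔪 h𝔪
  obtain ⟨z, hz, hz0⟩ := A.exists_mem_of_isMAD h𝔪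
  refine ⟨fun hle => hz0 ?_, z, hz, ?_⟩
  · obtain ⟨_, ⟨l, rfl⟩, v, hv, rfl⟩ := Submodule.mem_sup.mp (hle hz)
    obtain ⟨a, rfl⟩ := Submodule.mem_span_singleton.mp hv
    have := A.prD_apply l a 0
    rwa [zero_smul, add_zero] at this
  · obtain ⟨a, ha⟩ := A.exists_coords z
    exact ⟨A.prL z, a, A.prD z, hz0, ha⟩
end
end

section
/- In the setup below, the zero weight space is nonzero: A₀ = {y ∈ A : O_x(y) = 0} ≠ 0. -/
open LaurentPolynomial TensorProduct

noncomputable section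

/-- The weight space `A_w = {y ∈ A | O_x(y) = w • y}` of the operator `O_x` induced on `A`
by `ad(x)` (the bracket `⁅x, ℓ y⁆` equals `w • ℓ y` modulo the centre `k•c`). -/
def weightSubmodule {k A Lhat : Type} [Field k] [AddCommGroup A] [Module k A]
    [LieRing Lhat] [LieAlgebra k Lhat]
    (ℓ : A →ₗ[k] Lhat) (x c : Lhat) (w : k) : Submodule k A where
  carrier := {y | ∃ μ : k, ⁅x, ℓ y⁆ = w • ℓ y + μ • c}
  add_mem' := by
    rintro a b ⟨μa, ha⟩ ⟨μb, hb⟩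
    exact ⟨μa + μb, by rw [map_add, lie_add, ha, hb]; module⟩
  zero_mem' := ⟨0, by simp⟩
  smul_mem' := by
    rintro t a ⟨μ, h⟩
    exact ⟨t * μ, by rw [map_smul, lie_smul, h]; module⟩

section Kreknin

variable {L G : Type*} [LieRing L] [AddCommGroup G]

/-- The family of brackets of a family `V` of additive subgroups of a Lie ring: in degree `g` it is
generated by the brackets of elements of degrees `a` and `b` with `a + b = g`. -/
def bracketFamily (V : G → AddSubgroup L) (g : G) : AddSubgroup L :=
  AddSubgroup.closure {z | ∃ a b x y, a + b = g ∧ x ∈ V a ∧ y ∈ V b ∧ z = ⁅x, y⁆}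

/-- The iterated brackets of homogeneous elements of a family `V` whose degrees have rank at
least `n`. -/
inductive IsMonomialOfRank (ρ : G → ℕ) (n : ℕ) (V : G → AddSubgroup L) : G → L → Prop
  | of {a : G} {x : L} : n ≤ ρ a → x ∈ V a → IsMonomialOfRank ρ n V a x
  | lie {a b : G} {x y : L} : IsMonomialOfRank ρ n V a x → IsMonomialOfRank ρ n V b y →
      IsMonomialOfRank ρ n V (a + b) ⁅x, y⁆

/-- The homogeneous components of the Lie subring generated by the `V a` with `n ≤ ρ a`. -/
def rankFamily (ρ : G → ℕ) (n : ℕ) (V : G → AddSubgroup L) (g : G) : AddSubgroup L :=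
  AddSubgroup.closure {x | IsMonomialOfRank ρ n V g x}

/-- A family `V` of additive subgroups of a Lie ring is a ranked grading if it is compatible with
brackets, and if whenever `V a`, `V b` and `V (a + b)` are nonzero, the ranks of `a` and `b` are
both larger, or both smaller, than that of `a + b`. -/
structure IsRankedGrading (ρ : G → ℕ) (V : G → AddSubgroup L) : Prop where
  lie_mem : ∀ {a b x y}, x ∈ V a → y ∈ V b → ⁅x, y⁆ ∈ V (a + b)
  rank_lt : ∀ {a b}, V a ≠ ⊥ → V b ≠ ⊥ → V (a + b) ≠ ⊥ →
    (ρ (a + b) < ρ a ∧ ρ (a + b) < ρ b) ∨ (ρ a < ρ (a + b) ∧ ρ b < ρ (a + b))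

variable {ρ : G → ℕ} {V : G → AddSubgroup L}

theorem lie_mem_bracketFamily {a b : G} {x y : L} (hx : x ∈ V a) (hy : y ∈ V b) :
    ⁅x, y⁆ ∈ bracketFamily V (a + b) :=
  AddSubgroup.subset_closure ⟨a, b, x, y, rfl, hx, hy, rfl⟩

theorem IsRankedGrading.bracketFamily_le (hV : IsRankedGrading ρ V) (g : G) :
    bracketFamily V g ≤ V g := by
  refine (AddSubgroup.closure_le _).2 ?_
  rintro _ ⟨a, b, x, y, rfl, hx, hy, rfl⟩
  exact hV.lie_mem hx hy

theorem IsRankedGrading.bracketFamily (hV : IsRankedGrading ρ V) :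
    IsRankedGrading ρ (bracketFamily V) where
  lie_mem hx hy := lie_mem_bracketFamily (hV.bracketFamily_le _ hx) (hV.bracketFamily_le _ hy)
  rank_lt ha hb hab := hV.rank_lt (ne_bot_of_le_ne_bot ha (hV.bracketFamily_le _))
    (ne_bot_of_le_ne_bot hb (hV.bracketFamily_le _))
    (ne_bot_of_le_ne_bot hab (hV.bracketFamily_le _))

theorem IsRankedGrading.iterate_bracketFamily (hV : IsRankedGrading ρ V) (s : ℕ) :
    IsRankedGrading ρ (_root_.bracketFamily^[s] V) := by
  induction s with
  | zero => exact hV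
  | succ s ih => rw [Function.iterate_succ_apply']; exact ih.bracketFamily

theorem IsRankedGrading.iterate_bracketFamily_le (hV : IsRankedGrading ρ V) (s : ℕ) (g : G) :
    _root_.bracketFamily^[s] V g ≤ V g := by
  induction s with
  | zero => exact le_rfl
  | succ s ih =>
    rw [Function.iterate_succ_apply']
    exact ((hV.iterate_bracketFamily s).bracketFamily_le g).trans ih

theorem lie_mem_rankFamily {n : ℕ} {a b : G} {x y : L} (hx : x ∈ rankFamily ρ n V a)
    (hy : y ∈ rankFamily ρ n V b) : ⁅x, y⁆ ∈ rankFamily ρ n V (a + b) := by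
  induction hx using AddSubgroup.closure_induction with
  | zero => simp
  | add x x' _ _ hx hx' => rw [add_lie]; exact add_mem hx hx'
  | neg x _ hx => rw [neg_lie]; exact neg_mem hx
  | mem x hx =>
    induction hy using AddSubgroup.closure_induction with
    | zero => simp
    | add y y' _ _ hy hy' => rw [lie_add]; exact add_mem hy hy'
    | neg y _ hy => rw [lie_neg]; exact neg_mem hy
    | mem y hy => exact AddSubgroup.subset_closure (hx.lie hy)

theorem IsRankedGrading.lie_mem_rankFamily_succ (hV : IsRankedGrading ρ V) {n : ℕ} {a : G} {x : L}
    (hx : IsMonomialOfRank ρ n V a x) {b : G} {y : L} (hy : y ∈ V b) (hab : ρ (a + b) = n) :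
    ⁅x, y⁆ ∈ rankFamily ρ (n + 1) V (a + b) := by
  induction hx generalizing b y with
  | @of a x ha hx =>
    by_cases hxy : ⁅x, y⁆ = 0
    · rw [hxy]; exact zero_mem _
    have h₁ : V a ≠ ⊥ := fun h => hxy (by rw [(AddSubgroup.eq_bot_iff_forall _).1 h x hx, zero_lie])
    have h₂ : V b ≠ ⊥ := fun h => hxy (by rw [(AddSubgroup.eq_bot_iff_forall _).1 h y hy, lie_zero])
    have h₃ : V (a + b) ≠ ⊥ := fun h =>
      hxy ((AddSubgroup.eq_bot_iff_forall _).1 h _ (hV.lie_mem hx hy))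
    have := hV.rank_lt h₁ h₂ h₃
    exact AddSubgroup.subset_closure (.lie (.of (by omega) hx) (.of (by omega) hy))
  | @lie a₁ a₂ x₁ x₂ h₁ h₂ ih₁ ih₂ =>
    have hmem : ∀ {a x}, IsMonomialOfRank ρ n V a x → x ∈ V a := by
      intro a x h
      induction h with
      | of _ h => exact h
      | lie _ _ h h' => exact hV.lie_mem h h'
    rw [lie_lie]
    have e₁ : a₁ + a₂ + b = a₁ + (a₂ + b) := add_assoc _ _ _
    have e₂ : a₁ + a₂ + b = a₂ + (a₁ + b) := by abel
    refine sub_mem ?_ ?_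
    · rw [e₁] at hab ⊢
      exact ih₁ (hV.lie_mem (hmem h₂) hy) hab
    · rw [e₂] at hab ⊢
      exact ih₂ (hV.lie_mem (hmem h₁) hy) hab

theorem IsRankedGrading.exists_iterate_bracketFamily_le_rankFamily (n : ℕ) :
    ∃ s, ∀ V : G → AddSubgroup L, IsRankedGrading ρ V →
      ∀ g, _root_.bracketFamily^[s] V g ≤ rankFamily ρ n V g := by
  induction n with
  | zero => exact ⟨0, fun V _ g x hx => AddSubgroup.subset_closure (.of (Nat.zero_le _) hx)⟩
  | succ n ih =>
    obtain ⟨s, hs⟩ := ih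
    refine ⟨s + (s + 1), fun V hV g => ?_⟩
    set W := _root_.bracketFamily^[s + 1] V with hW
    have hWV : ∀ a, W a ≤ V a := hV.iterate_bracketFamily_le (s + 1)
    have hWn : ∀ a, ρ a = n → W a ≤ rankFamily ρ (n + 1) V a := by
      intro a ha
      rw [hW, Function.iterate_succ_apply']
      refine (AddSubgroup.closure_le _).2 ?_
      rintro _ ⟨a, b, x, y, rfl, hx, hy, rfl⟩
      replace hx := hs V hV a hx
      replace hy := hV.iterate_bracketFamily_le s b hy
      induction hx using AddSubgroup.closure_induction with
      | zero => simp
      | add x x' _ _ hx hx' => rw [add_lie]; exact add_mem hx hx'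
      | neg x _ hx => rw [neg_lie]; exact neg_mem hx
      | mem x hx => exact hV.lie_mem_rankFamily_succ hx hy ha
    rw [Function.iterate_add_apply]
    refine (hs W (hV.iterate_bracketFamily (s + 1)) g).trans ((AddSubgroup.closure_le _).2 ?_)
    intro x hx
    induction hx with
    | @of a x ha hx =>
      rcases ha.eq_or_lt with ha | ha
      · exact hWn a ha.symm hx
      · exact AddSubgroup.subset_closure (.of ha (hWV a hx))
    | lie _ _ hx hy => exact lie_mem_rankFamily hx hy

/-- A form of **Kreknin's theorem**: a Lie ring with a ranked grading of bounded rank is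
solvable. -/
theorem IsRankedGrading.isSolvable (hV : IsRankedGrading ρ V) (htop : ⨆ g, V g = ⊤) {N : ℕ}
    (hN : ∀ g, ρ g < N) : LieAlgebra.IsSolvable L := by
  obtain ⟨s, hs⟩ := exists_iterate_bracketFamily_le_rankFamily (L := L) (ρ := ρ) N
  have hbot : ∀ g, _root_.bracketFamily^[s] V g = ⊥ := by
    refine fun g => eq_bot_iff.2 ((hs V hV g).trans ((AddSubgroup.closure_le _).2 ?_))
    intro x hx
    suffices False from this.elim
    change IsMonomialOfRank ρ N V g x at hx
    induction hx with
    | of h _ => exact absurd h (not_le.2 (hN _))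
    | lie _ _ h _ => exact h
  have hle : ∀ r, ∀ x ∈ LieAlgebra.derivedSeries ℤ L r, x ∈ ⨆ g, _root_.bracketFamily^[r] V g := by
    intro r
    induction r with
    | zero => intro x _; rw [Function.iterate_zero, id_def, htop]; trivial
    | succ r ih =>
      intro x hx
      rw [LieAlgebra.derivedSeries_def, LieAlgebra.derivedSeriesOfIdeal_succ,
        ← LieSubmodule.mem_toSubmodule, LieSubmodule.lieIdeal_oper_eq_linear_span'] at hx
      induction hx using Submodule.span_induction with
      | zero => exact zero_mem _
      | add _ _ _ _ hx hy => exact add_mem hx hy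
      | smul n _ _ hx => exact zsmul_mem hx n
      | mem z hz =>
        obtain ⟨x, hx, y, hy, rfl⟩ := hz
        replace hx := ih x hx
        replace hy := ih y hy
        refine AddSubgroup.iSup_induction _ (C := fun x => ⁅x, y⁆ ∈ _) hx (fun a x hx => ?_)
          (by simp) fun x x' hx hx' => by rw [add_lie]; exact add_mem hx hx'
        refine AddSubgroup.iSup_induction _ (C := fun y => ⁅x, y⁆ ∈ _) hy (fun b y hy => ?_)
          (by simp) fun y y' hy hy' => by rw [lie_add]; exact add_mem hy hy'
        rw [Function.iterate_succ_apply']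
        exact AddSubgroup.mem_iSup_of_mem (a + b) (lie_mem_bracketFamily hx hy)
  refine .mk (R := ℤ) (k := s) (eq_bot_iff.2 fun x hx => ?_)
  simpa [hbot] using hle s x hx

end Kreknin

section WeightGrading

variable {k : Type*} [Field k] [CharZero k]

theorem exists_ratLinearMap_real (F : Finset k) {m : k} (hm : m ≠ 0) :
    ∃ φ : k →ₗ[ℚ] ℝ, φ m = 1 ∧ ∀ w ∈ F, ∀ n : ℤ, φ w = n → w = n * m := by
  classical
  set S : Submodule ℚ k := Submodule.span ℚ (insert m F : Finset k) with hS
  have hF : ∀ w ∈ insert m F, w ∈ S := fun w hw => Submodule.subset_span hw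
  obtain ⟨f, hf⟩ : ∃ f : S →ₗ[ℚ] ℝ, Function.Injective f := by
    refine Module.Free.exists_linearMap_injective_of_lift_rank_lt ?_
    rw [Real.rank_rat_real, Cardinal.lift_continuum]
    refine lt_of_lt_of_le ?_ Cardinal.aleph0_le_continuum
    rw [Cardinal.lift_lt_aleph0]
    exact Module.rank_lt_aleph0 ℚ S
  obtain ⟨g, hg⟩ := LinearMap.exists_extend f
  have hgf : ∀ v (hv : v ∈ S), g v = f ⟨v, hv⟩ := fun v hv => by rw [← hg]; rfl
  have hmS := hF m (Finset.mem_insert_self m F)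
  have hgm : g m ≠ 0 := by
    intro h
    rw [hgf m hmS, map_eq_zero_iff f hf] at h
    exact hm (congrArg Subtype.val h)
  refine ⟨(LinearMap.mulLeft ℚ (g m)⁻¹) ∘ₗ g, by simp [hgm], fun w hw n hn => ?_⟩
  have hwS := hF w (Finset.mem_insert_of_mem hw)
  have hgw : g w = g ((n : ℚ) • m) := by
    simp only [LinearMap.comp_apply, LinearMap.mulLeft_apply] at hn
    rw [map_smul, Rat.smul_def, Rat.cast_intCast, ← hn]
    field_simp
  rw [hgf w hwS, hgf _ (S.smul_mem _ hmS), hf.eq_iff] at hgw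
  simpa [Rat.smul_def] using congrArg Subtype.val hgw

/-- A Lie ring graded by `k`, such that the weights form finitely many classes modulo `m` and no
integral multiple of `m` is a weight, is solvable. -/
theorem isSolvable_of_finite_weights_mod {L : Type*} [LieRing L] {m : k} (hm : m ≠ 0)
    (V : k → AddSubgroup L) (hV : ∀ {a b x y}, x ∈ V a → y ∈ V b → ⁅x, y⁆ ∈ V (a + b))
    (htop : ⨆ w, V w = ⊤) (F : Finset k)
    (hF : ∀ w, V w ≠ ⊥ → ∃ v ∈ F, ∃ n : ℤ, w = v + n * m)
    (h₀ : ∀ n : ℤ, V (n * m) = ⊥) : LieAlgebra.IsSolvable L := by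
  classical
  obtain ⟨φ, hφm, hφ⟩ := exists_ratLinearMap_real F hm
  have hφn : ∀ n : ℤ, φ (n * m) = n := fun n => by
    have : (n * m : k) = n • m := by simp
    rw [this, map_zsmul, hφm]
    simp
  set θ : k → ℝ := fun w => Int.fract (φ w) with hθ
  set E : Finset ℝ := F.image θ with hE
  have hθE : ∀ w, V w ≠ ⊥ → θ w ∈ E := by
    intro w hw
    obtain ⟨v, hv, n, rfl⟩ := hF w hw
    refine Finset.mem_image.2 ⟨v, hv, ?_⟩
    simp only [hθ, map_add, hφn, Int.fract_add_intCast]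
  have hθpos : ∀ w, V w ≠ ⊥ → 0 < θ w := by
    intro w hw
    refine (Int.fract_nonneg _).lt_of_ne' fun h => hw ?_
    obtain ⟨v, hv, n, rfl⟩ := hF w hw
    rw [map_add, hφn, Int.fract_add_intCast, Int.fract_eq_iff] at h
    obtain ⟨-, -, z, hz⟩ := h
    rw [hφ v hv z (by simpa using hz), ← add_mul, ← Int.cast_add, h₀]
  set ρ : k → ℕ := fun w => (E.filter (· < θ w)).card with hρ
  have hρ_lt : ∀ {v w}, V v ≠ ⊥ → θ v < θ w → ρ v < ρ w := by
    intro v w hv hvw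
    refine Finset.card_lt_card (Finset.ssubset_iff_of_subset ?_ |>.2 ⟨θ v, ?_, ?_⟩)
    · intro r hr
      rw [Finset.mem_filter] at hr ⊢
      exact ⟨hr.1, hr.2.trans hvw⟩
    · exact Finset.mem_filter.2 ⟨hθE v hv, hvw⟩
    · simp
  have hVρ : IsRankedGrading ρ V := by
    refine ⟨hV, fun {a b} ha hb hab => ?_⟩
    have ha₁ : θ a < 1 := Int.fract_lt_one _
    have hb₁ : θ b < 1 := Int.fract_lt_one _
    obtain ⟨z, hz⟩ := Int.fract_add (φ a) (φ b)
    rw [← map_add] at hz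
    change θ (a + b) - θ a - θ b = z at hz
    have hab₁ : θ (a + b) < 1 := Int.fract_lt_one _
    have hz₁ : z < 1 := by
      have : (z : ℝ) < 1 := by linarith [hθpos a ha, hθpos b hb]
      exact_mod_cast this
    have hz₂ : -2 < z := by
      have : (-2 : ℝ) < z := by linarith [hθpos (a + b) hab]
      exact_mod_cast this
    obtain rfl | rfl : z = 0 ∨ z = -1 := by omega
    · push_cast at hz
      exact .inr ⟨hρ_lt ha (by linarith [hθpos b hb]), hρ_lt hb (by linarith [hθpos a ha])⟩
    · push_cast at hz
      exact .inl ⟨hρ_lt hab (by linarith), hρ_lt hab (by linarith)⟩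
  exact hVρ.isSolvable htop fun w => Nat.lt_succ_of_le (Finset.card_filter_le E _)

/-- A Lie algebra `A` of finite type over the Laurent polynomials, with a weight space
decomposition in which multiplication by `T n` shifts the weights by `n * m`, is solvable if its
zero weight space vanishes. -/
theorem isSolvable_of_weightSpace_zero_eq_bot {A : Type*} [LieRing A]
    [LieAlgebra (LaurentPolynomial k) A] [Module k A] [IsScalarTower k (LaurentPolynomial k) A]
    [Module.Finite (LaurentPolynomial k) A] {m : k} (hm : m ≠ 0) (V : k → Submodule k A)
    (hV : ∀ {a b x y}, x ∈ V a → y ∈ V b → ⁅x, y⁆ ∈ V (a + b))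
    (htop : ⨆ w, V w = ⊤) (hind : iSupIndep V)
    (hT : ∀ (n : ℤ) {w y}, y ∈ V w → (T n : LaurentPolynomial k) • y ∈ V (w + n * m))
    (h₀ : V 0 = ⊥) : LieAlgebra.IsSolvable A := by
  classical
  obtain ⟨S, hS⟩ := Module.Finite.fg_top (R := LaurentPolynomial k) (M := A)
  have hfin : ∀ y : A, ∃ s : Finset k, y ∈ ⨆ w ∈ s, V w := fun y =>
    Submodule.exists_finset_of_mem_iSup V (htop ▸ Submodule.mem_top)
  choose s hs using hfin
  set F := S.biUnion s with hF
  set P : Set k := {w | ∃ v ∈ F, ∃ n : ℤ, w = v + n * m} with hP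
  set W : Submodule k A := ⨆ w ∈ P, V w with hW
  have hVW : ∀ w ∈ P, V w ≤ W := fun w hw => le_iSup₂_of_le w hw le_rfl
  have hTW : ∀ (n : ℤ), ∀ y ∈ W, (T n : LaurentPolynomial k) • y ∈ W := by
    intro n y hy
    rw [hW, ← iSup_subtype''] at hy
    induction hy using Submodule.iSup_induction' with
    | zero => rw [smul_zero]; exact zero_mem _
    | add x y _ _ hx hy => rw [smul_add]; exact add_mem hx hy
    | mem w y hy =>
      obtain ⟨w, v, hv, l, rfl⟩ := w
      exact hVW _ ⟨v, hv, l + n, by push_cast; ring⟩ (hT n hy)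
  have hRW : ∀ (r : LaurentPolynomial k), ∀ y ∈ W, r • y ∈ W := by
    intro r y hy
    induction r using LaurentPolynomial.induction_on' with
    | add p q hp hq => rw [add_smul]; exact add_mem hp hq
    | C_mul_T n a =>
      rw [← LaurentPolynomial.smul_eq_C_mul, smul_assoc]
      exact W.smul_mem a (hTW n y hy)
  have hWtop : W = ⊤ := by
    refine eq_top_iff.2 fun y _ => ?_
    have hy : y ∈ Submodule.span (LaurentPolynomial k) (S : Set A) := hS ▸ Submodule.mem_top
    induction hy using Submodule.span_induction with
    | zero => exact zero_mem _
    | add _ _ _ _ hx hy => exact add_mem (hx trivial) (hy trivial)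
    | smul r x _ hx => exact hRW r x (hx trivial)
    | mem y hy =>
      refine (iSup₂_le fun w hw => hVW w ?_ : ⨆ w ∈ s y, V w ≤ W) (hs y)
      exact ⟨w, Finset.mem_biUnion.2 ⟨y, hy, hw⟩, 0, by simp⟩
  refine isSolvable_of_finite_weights_mod hm (fun w => (V w).toAddSubgroup) hV ?_ F ?_ ?_
  · refine eq_top_iff.2 fun y _ => ?_
    have hy : y ∈ ⨆ w, V w := htop ▸ Submodule.mem_top
    induction hy using Submodule.iSup_induction' with
    | zero => exact zero_mem _
    | add _ _ _ _ hx hy => exact add_mem (hx trivial) (hy trivial)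
    | mem w y hy => exact AddSubgroup.mem_iSup_of_mem w hy
  · intro w hw
    by_contra h
    refine hw ?_
    have := hind.disjoint_biSup (x := w) (y := P) h
    rw [← hW, hWtop, disjoint_top] at this
    rw [this]
    rfl
  · refine fun n => (AddSubgroup.eq_bot_iff_forall _).2 fun y hy => ?_
    have h := hT (-n) (show y ∈ V (n * m) from hy)
    rw [Int.cast_neg, neg_mul, add_neg_cancel, h₀, Submodule.mem_bot] at h
    have := congrArg (fun z => (T n : LaurentPolynomial k) • z) h
    rwa [smul_smul, ← LaurentPolynomial.T_add, add_neg_cancel, LaurentPolynomial.T_zero, one_smul,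
      smul_zero] at this

end WeightGrading

theorem iSupIndep.submodule_comap {R M N ι : Type*} [Ring R] [AddCommGroup M] [AddCommGroup N]
    [Module R M] [Module R N] {p : ι → Submodule R N} (hp : iSupIndep p) {f : M →ₗ[R] N}
    (hf : Function.Injective f) : iSupIndep fun i => (p i).comap f := by
  intro i
  rw [Submodule.disjoint_def]
  intro x hx hx'
  rw [← map_eq_zero_iff f hf]
  refine Submodule.disjoint_def.1 (hp i) _ hx ?_
  have := Submodule.mem_map_of_mem (f := f) hx'
  simp only [Submodule.map_iSup] at this
  exact iSup₂_mono (fun l _ => Submodule.map_comap_le f (p l)) this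

/-- A free module of finite rank over a domain vanishes if its generic fibre is both solvable and
semisimple as a Lie algebra. -/
theorem subsingleton_of_isSolvable_of_isSemisimple_fractionRing {R A : Type*} [CommRing R]
    [IsDomain R] [LieRing A] [LieAlgebra R A] [Module.Free R A] [Module.Finite R A]
    [LieAlgebra.IsSolvable A]
    (hss : LieAlgebra.IsSemisimple (FractionRing R) (FractionRing R ⊗[R] A)) :
    Subsingleton A := by
  have h : (⊤ : LieIdeal (FractionRing R) (FractionRing R ⊗[R] A)) = ⊥ := by
    rw [← LieAlgebra.radical_eq_top_of_isSolvable (R := FractionRing R),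
      LieAlgebra.HasTrivialRadical.radical_eq_bot]
  have : Subsingleton (FractionRing R ⊗[R] A) := by
    refine ⟨fun a b => ?_⟩
    have hz : ∀ a : FractionRing R ⊗[R] A, a = 0 := fun a => by
      rw [← LieSubmodule.mem_bot (R := FractionRing R) (L := FractionRing R ⊗[R] A), ← h]
      exact LieSubmodule.mem_top a
    rw [hz a, hz b]
  rw [← Module.finrank_eq_zero_iff_of_free (R := R),
    ← Module.finrank_baseChange (R := FractionRing R)]
  exact Module.finrank_zero_of_subsingleton

/-- In the stated setup, the zero weight space
`A₀ = {y ∈ A : O_x(y) = 0}` is nonzero. -/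
theorem zero_weight_space_ne_bot
    -- the base field
    (k : Type) [Field k] [IsAlgClosed k] [CharZero k]
    -- the simple finite-dimensional Lie algebra 𝔤
    (𝔤 : Type) [LieRing 𝔤] [LieAlgebra k 𝔤] [FiniteDimensional k 𝔤]
    [LieAlgebra.IsSimple k 𝔤]
    -- the order m of σ and a primitive m-th root of unity ζ
    (m : ℕ) (hm : 0 < m)
    (σ : 𝔤 ≃ₗ⁅k⁆ 𝔤) (hσ : ∀ y : 𝔤, (⇑σ)^[m] y = y)
    (ζ : k) (hζ : IsPrimitiveRoot ζ m)
    -- the twisted loop algebra L(𝔤,σ) = ⊕_{i∈ℤ} 𝔤_ī ⊗ sⁱ, an R-Lie algebra for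
    -- R = k[t^{±1}] = LaurentPolynomial k (with t = sᵐ);
    -- `u p y` represents `y ⊗ sᵖ` for `y ∈ 𝔤_p̄`, i.e. `σ y = ζ^p • y`
    (Lg : Type) [LieRing Lg] [LieAlgebra (LaurentPolynomial k) Lg]
    [LieAlgebra k Lg] [IsScalarTower k (LaurentPolynomial k) Lg]
    (u : ℤ → 𝔤 →ₗ[k] Lg)
    (hu_bracket : ∀ (p q : ℤ) (y z : 𝔤), σ y = ζ ^ p • y → σ z = ζ ^ q • z →
      ⁅u p y, u q z⁆ = u (p + q) ⁅y, z⁆)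
    (hu_t : ∀ (p : ℤ) (y : 𝔤), σ y = ζ ^ p • y →
      (T 1 : LaurentPolynomial k) • u p y = u (p + (m : ℤ)) y)
    (hu_span : ∀ l : Lg, ∃ f : ℤ →₀ 𝔤, (∀ i, σ (f i) = ζ ^ i • f i) ∧
      l = f.sum fun i yi => u i yi)
    (hu_ind : ∀ f : ℤ →₀ 𝔤, (∀ i, σ (f i) = ζ ^ i • f i) →
      (f.sum fun i yi => u i yi) = 0 → f = 0)
    -- the twisted affine Kac–Moody algebra L̂(𝔤,σ) = L(𝔤,σ) ⊕ kc ⊕ kd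
    (Lhat : Type) [LieRing Lhat] [LieAlgebra k Lhat]
    (c d : Lhat) (ι : Lg →ₗ[k] Lhat)
    (hc : ∀ z : Lhat, ⁅c, z⁆ = 0)
    (hd : ∀ (p : ℤ) (y : 𝔤), σ y = ζ ^ p • y →
      ⁅d, ι (u p y)⁆ = (p : k) • ι (u p y))
    (hbr : ∀ (p q : ℤ) (y z : 𝔤), σ y = ζ ^ p • y → σ z = ζ ^ q • z →
      ⁅ι (u p y), ι (u q z)⁆ =
        ι (u (p + q) ⁅y, z⁆) +
          (if p + q = 0 then (p : k) * killingForm k 𝔤 y z else 0) • c)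
    (hdec : ∀ z : Lhat, ∃ (l : Lg) (a b : k), z = ι l + a • c + b • d)
    (huniq : ∀ (l : Lg) (a b : k), ι l + a • c + b • d = 0 → l = 0 ∧ a = 0 ∧ b = 0)
    -- the invariant nondegenerate bilinear form (·,·) on L̂(𝔤,σ)
    (B : LinearMap.BilinForm k Lhat)
    (hBsymm : ∀ z w : Lhat, B z w = B w z)
    (hBinv : ∀ z w y : Lhat, B ⁅z, w⁆ y = B z ⁅w, y⁆)
    (hBval : ∀ (p q : ℤ) (y z : 𝔤), σ y = ζ ^ p • y → σ z = ζ ^ q • z →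
      B (ι (u p y)) (ι (u q z)) = if p + q = 0 then killingForm k 𝔤 y z else 0)
    (hBc : ∀ l : Lg, B c (ι l) = 0) (hBd : ∀ l : Lg, B d (ι l) = 0)
    (hBcc : B c c = 0) (hBdd : B d d = 0) (hBcd : B c d = 1)
    -- the R-Lie subalgebra A of L(𝔤,σ), free of finite rank over R,
    -- with A ⊗_R K semisimple over the fraction field K of R
    (A : Type) [LieRing A] [LieAlgebra (LaurentPolynomial k) A]
    [Module k A] [IsScalarTower k (LaurentPolynomial k) A]
    [Module.Free (LaurentPolynomial k) A] [Module.Finite (LaurentPolynomial k) A]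
    (hss : LieAlgebra.IsSemisimple (FractionRing (LaurentPolynomial k))
      (FractionRing (LaurentPolynomial k) ⊗[LaurentPolynomial k] A))
    (j : A →ₗ⁅LaurentPolynomial k⁆ Lg) (hj : Function.Injective j)
    -- the embedding ℓ = ι ∘ j of A into L̂(𝔤,σ)
    (ℓ : A →ₗ[k] Lhat) (hℓ : ∀ a : A, ℓ a = ι (j a))
    -- Â = A ⊕ kc ⊕ kd, a subalgebra of L̂(𝔤,σ) on which the form is nondegenerate
    (Ahat : Submodule k Lhat)
    (hAhat : Ahat = LinearMap.range ℓ ⊔ Submodule.span k {c} ⊔ Submodule.span k {d})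
    (hA_closed : ∀ z ∈ Ahat, ∀ w ∈ Ahat, ⁅z, w⁆ ∈ Ahat)
    (hBnd : ∀ z ∈ Ahat, (∀ w ∈ Ahat, B z w = 0) → z = 0)
    -- the element x = x' + d with 0 ≠ x' ∈ A, with ad(x) k-diagonalizable on Â
    (x' : A) (hx'0 : x' ≠ 0) (x : Lhat) (hx : x = ℓ x' + d)
    (hdiag : ∀ z ∈ Ahat, z ∈ ⨆ w : k,
      Ahat ⊓ Module.End.eigenspace (LieAlgebra.ad k Lhat x) w)
    :
    weightSubmodule ℓ x c 0 ≠ ⊥ := by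
  intro hbot
  have hζ₀ : ζ ≠ 0 := hζ.ne_zero hm.ne'
  have hmk : (m : k) ≠ 0 := Nat.cast_ne_zero.2 hm.ne'
  have hper : ∀ (p n : ℤ) (y : 𝔤), σ y = ζ ^ p • y → σ y = ζ ^ (p + n * m) • y := by
    intro p n y hy
    rw [zpow_add₀ hζ₀, mul_comm n, zpow_mul, zpow_natCast, hζ.pow_eq_one, one_zpow, mul_one, hy]
  have hTu : ∀ (n p : ℤ) (y : 𝔤), σ y = ζ ^ p • y →
      (T n : LaurentPolynomial k) • u p y = u (p + n * m) y := by
    intro n p y hy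
    induction n with
    | zero => simp
    | succ i ih =>
      rw [add_comm (i : ℤ) 1, LaurentPolynomial.T_add, mul_smul, ih, hu_t _ _ (hper _ _ _ hy)]
      congr 2
      ring
    | pred i ih =>
      rw [sub_eq_neg_add, LaurentPolynomial.T_add, mul_smul, ih]
      have h := hu_t _ _ (hper p (-i - 1) y hy)
      rw [show p + (-(i : ℤ) - 1) * m + m = p + -(i : ℤ) * m by ring] at h
      rw [← h, smul_smul, ← LaurentPolynomial.T_add, neg_add_cancel, LaurentPolynomial.T_zero,
        one_smul]
      congr 2
      ring
  have hLind : ∀ P : Lg → Prop, P 0 → (∀ a b, P a → P b → P (a + b)) →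
      (∀ p y, σ y = ζ ^ p • y → P (u p y)) → ∀ l, P l := by
    intro P h0 hadd hu l
    obtain ⟨f, hf, rfl⟩ := hu_span l
    exact Finset.sum_induction _ P hadd h0 fun i _ => hu i _ (hf i)
  have hι : Function.Injective ι := by
    rw [injective_iff_map_eq_zero]
    intro l hl
    exact (huniq l 0 0 (by simp [hl])).1
  have hδ : ∀ l, ∃ l', ⁅d, ι l⁆ = ι l' := by
    refine hLind _ ⟨0, by simp⟩ ?_ fun p y hy => ⟨(p : k) • u p y, by rw [hd p y hy, map_smul]⟩
    rintro a b ⟨a', ha⟩ ⟨b', hb⟩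
    exact ⟨a' + b', by rw [map_add, lie_add, ha, hb, map_add]⟩
  choose δ₀ hδ₀ using hδ
  let δ : Lg →ₗ[k] Lg :=
    { toFun := δ₀
      map_add' := fun a b => hι (by rw [← hδ₀, map_add, lie_add, hδ₀, hδ₀, map_add])
      map_smul' := fun r a => hι (by
        rw [← hδ₀, map_smul, lie_smul, hδ₀, RingHom.id_apply, map_smul]) }
  have hδ : ∀ l, ⁅d, ι l⁆ = ι (δ l) := hδ₀
  have hδu : ∀ p y, σ y = ζ ^ p • y → δ (u p y) = (p : k) • u p y := fun p y hy =>
    hι (by rw [← hδ, hd p y hy, map_smul])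
  have hsmul : ∀ (r : LaurentPolynomial k) (t : k) (l : Lg), r • t • l = t • r • l := by
    intro r t l
    rw [← algebraMap_smul (LaurentPolynomial k) t l, smul_smul, mul_comm, mul_smul, algebraMap_smul]
  have hδT : ∀ (n : ℤ) (l : Lg), δ ((T n : LaurentPolynomial k) • l) =
      (T n : LaurentPolynomial k) • δ l + (n * m : k) • (T n : LaurentPolynomial k) • l := by
    intro n
    refine hLind _ (by simp) (fun a b ha hb => ?_) fun p y hy => ?_
    · rw [smul_add, map_add, ha, hb, map_add]
      simp only [smul_add]
      abel
    · rw [hδu p y hy, hsmul, hTu n p y hy, hδu _ _ (hper p n y hy)]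
      push_cast
      rw [add_smul]
  have hιbr : ∀ a b, ∃ μ : k, ⁅ι a, ι b⁆ = ι ⁅a, b⁆ + μ • c := by
    intro a b
    refine hLind (fun a => ∃ μ : k, ⁅ι a, ι b⁆ = ι ⁅a, b⁆ + μ • c) ⟨0, by simp⟩ ?_ ?_ a
    · rintro a a' ⟨μ, h⟩ ⟨μ', h'⟩
      exact ⟨μ + μ', by rw [map_add, add_lie, add_lie, map_add, h, h']; module⟩
    intro p y hy
    refine hLind (fun b => ∃ μ : k, ⁅ι (u p y), ι b⁆ = ι ⁅u p y, b⁆ + μ • c) ⟨0, by simp⟩ ?_ ?_ b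
    · rintro b b' ⟨μ, h⟩ ⟨μ', h'⟩
      exact ⟨μ + μ', by rw [map_add, lie_add, lie_add, map_add, h, h']; module⟩
    intro q z hz
    exact ⟨_, by rw [hbr p q y z hy hz, hu_bracket p q y z hy hz]⟩
  have hcr : ∀ z : Lhat, ⁅z, c⁆ = 0 := fun z => by rw [← lie_skew, hc, neg_zero]
  have hδlie : ∀ a b, δ ⁅a, b⁆ = ⁅δ a, b⁆ + ⁅a, δ b⁆ := by
    intro a b
    obtain ⟨μ, h⟩ := hιbr a b
    obtain ⟨μ₁, h₁⟩ := hιbr (δ a) b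
    obtain ⟨μ₂, h₂⟩ := hιbr a (δ b)
    have hJ := leibniz_lie d (ι a) (ι b)
    rw [h, lie_add, lie_smul, hcr, smul_zero, add_zero, hδ, hδ, hδ, h₁, h₂] at hJ
    refine sub_eq_zero.1 (huniq _ (-μ₁ - μ₂) 0 ?_).1
    rw [map_sub, hJ, map_add]
    module
  let D : Module.End k Lg := LieAlgebra.ad k Lg (j x') + δ
  have hD : ∀ l, D l = ⁅j x', l⁆ + δ l := fun _ => rfl
  have hxι : ∀ l, ∃ μ : k, ⁅x, ι l⁆ = ι (D l) + μ • c := by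
    intro l
    obtain ⟨μ, h⟩ := hιbr (j x') l
    exact ⟨μ, by rw [hx, hℓ, add_lie, h, hδ, hD, map_add]; module⟩
  have hxd : ⁅x, d⁆ = -ι (δ (j x')) := by
    rw [hx, hℓ, add_lie, lie_self, add_zero, ← lie_skew, hδ]
  let jk : A →ₗ[k] Lg := (j : A →ₗ[LaurentPolynomial k] Lg).restrictScalars k
  have hjk : ∀ a, jk a = j a := fun _ => rfl
  let V : k → Submodule k A := fun w => (D.eigenspace w).comap jk
  have hVmem : ∀ w y, y ∈ V w ↔ D (j y) = w • j y := by
    intro w y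
    rw [Submodule.mem_comap, Module.End.mem_eigenspace_iff, hjk]
  have hVlie : ∀ {a b y z}, y ∈ V a → z ∈ V b → ⁅y, z⁆ ∈ V (a + b) := by
    intro a b y z hy hz
    rw [hVmem] at hy hz ⊢
    rw [j.map_lie, hD, hδlie, leibniz_lie, add_add_add_comm, ← add_lie, ← lie_add, ← hD, ← hD, hy,
      hz, smul_lie, lie_smul, add_smul]
  have hVT : ∀ (n : ℤ) {w y}, y ∈ V w → (T n : LaurentPolynomial k) • y ∈ V (w + n * m) := by
    intro n w y hy
    rw [hVmem] at hy ⊢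
    rw [map_smul, hD, hδT, lie_smul, ← add_assoc, ← smul_add, ← hD, hy, hsmul, add_smul]
  have hV₀ : V 0 = ⊥ := by
    rw [eq_bot_iff, ← hbot]
    intro y hy
    rw [hVmem] at hy
    obtain ⟨μ, h⟩ := hxι (j y)
    exact ⟨μ, by rw [hℓ, h, hy, map_smul]⟩
  have hsplit : ∀ z ∈ Ahat, ∃ a ∈ ⨆ w, V w, ∃ z₀, ⁅x, z₀⁆ = 0 ∧ z = ℓ a + z₀ := by
    intro z hz
    replace hz := hdiag z hz
    induction hz using Submodule.iSup_induction' with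
    | zero => exact ⟨0, zero_mem _, 0, by simp, by simp⟩
    | add z z' _ _ h h' =>
      obtain ⟨a, ha, z₀, hz₀, rfl⟩ := h
      obtain ⟨a', ha', z₀', hz₀', rfl⟩ := h'
      exact ⟨a + a', add_mem ha ha', z₀ + z₀', by rw [lie_add, hz₀, hz₀', add_zero],
        by rw [map_add]; abel⟩
    | mem w z hz =>
      obtain ⟨hzA, hzw⟩ := hz
      replace hzw : ⁅x, z⁆ = w • z := Module.End.mem_eigenspace_iff.1 hzw
      by_cases hw : w = 0
      · exact ⟨0, zero_mem _, z, by rw [hzw, hw, zero_smul], by simp⟩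
      rw [hAhat] at hzA
      obtain ⟨z', hz', _, hβ, rfl⟩ := Submodule.mem_sup.1 hzA
      obtain ⟨_, ⟨a, rfl⟩, _, hα, rfl⟩ := Submodule.mem_sup.1 hz'
      obtain ⟨β, rfl⟩ := Submodule.mem_span_singleton.1 hβ
      obtain ⟨α, rfl⟩ := Submodule.mem_span_singleton.1 hα
      obtain ⟨μ, h⟩ := hxι (j a)
      rw [lie_add, lie_add, lie_smul, lie_smul, hcr, hxd, hℓ, h] at hzw
      obtain ⟨h₁, -, h₂⟩ := huniq (D (j a) - β • δ (j x') - w • j a) (μ - w * α) (-(w * β)) (by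
        rw [map_sub, map_sub, map_smul, map_smul]
        rw [← sub_eq_zero] at hzw
        rw [← hzw]
        module)
      have hβ₀ : β = 0 := by simpa [hw] using h₂
      subst hβ₀
      refine ⟨a, Submodule.mem_iSup_of_mem w ((hVmem w a).2 ?_), α • c, ?_, by simp⟩
      · simpa [sub_eq_zero] using h₁
      · rw [lie_smul, hcr, smul_zero]
  have hVtop : ⨆ w, V w = ⊤ := by
    refine eq_top_iff.2 fun y _ => ?_
    have hy : ℓ y ∈ Ahat := by
      rw [hAhat]
      exact Submodule.mem_sup_left (Submodule.mem_sup_left ⟨y, rfl⟩)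
    obtain ⟨a, ha, z₀, hz₀, h⟩ := hsplit _ hy
    rw [← sub_eq_iff_eq_add', ← map_sub] at h
    rw [← h, hℓ] at hz₀
    obtain ⟨μ, hμ⟩ := hxι (j (y - a))
    have h₁ := (huniq (D (j (y - a))) μ 0 (by rw [← hμ, hz₀]; simp)).1
    rw [← sub_add_cancel y a]
    exact add_mem (Submodule.mem_iSup_of_mem 0 ((hVmem _ _).2 (by rw [h₁, zero_smul]))) ha
  have := isSolvable_of_weightSpace_zero_eq_bot hmk V hVlie hVtop
    (D.eigenspaces_iSupIndep.submodule_comap hj) hVT hV₀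
  have := subsingleton_of_isSolvable_of_isSemisimple_fractionRing hss
  exact hx'0 (Subsingleton.elim _ _)
end
end

section
/- In the setup below, let κ denote the Killing form of the R-Lie algebra A (the R-bilinear form κ(y,z) = Tr_R(ad(y)∘ad(z))). If w₁ and w₂ are weights of O_x such that w₁ + w₂ ∉ mℤ, then κ(y,z) = 0 for all y ∈ A_{w₁} and z ∈ A_{w₂}. -/
open LaurentPolynomial TensorProduct

noncomputable section

/-- Let `O` be additive and satisfy the Leibniz rule over an additive map `E` of the scalars.
Then the trace of the commutator of `O` with a linear map `φ` is `E` of the trace of `φ`. -/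
theorem trace_commutator_of_leibniz {R M : Type*} [CommRing R] [AddCommGroup M] [Module R M]
    [Module.Free R M] [Module.Finite R M] (E : R →+ R) (O : M →+ M)
    (hO : ∀ (f : R) (a : M), O (f • a) = f • O a + E f • a)
    (φ ψ : M →ₗ[R] M) (h : ∀ a, ψ a = O (φ a) - φ (O a)) :
    LinearMap.trace R M ψ = E (LinearMap.trace R M φ) := by
  classical
  let b := Module.Free.chooseBasis R M
  have hcoord (i : Module.Free.ChooseBasisIndex R M) : b.repr (ψ (b i)) i =
      E (b.repr (φ (b i)) i) + ∑ j, b.repr (φ (b i)) j * b.repr (O (b j)) i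
        - ∑ j, b.repr (O (b i)) j * b.repr (φ (b j)) i := by
    have h₁ : O (φ (b i)) =
        ∑ j, (b.repr (φ (b i)) j • O (b j) + E (b.repr (φ (b i)) j) • b j) := by
      conv_lhs => rw [← b.sum_repr (φ (b i)), map_sum]
      simp only [hO]
    have h₂ : φ (O (b i)) = ∑ j, b.repr (O (b i)) j • φ (b j) := by
      conv_lhs => rw [← b.sum_repr (O (b i)), map_sum]
      simp only [map_smul]
    rw [h, h₁, h₂]
    simp [Finset.sum_add_distrib, Finsupp.single_apply, add_comm]
  rw [LinearMap.trace_eq_matrix_trace R b, LinearMap.trace_eq_matrix_trace R b, Matrix.trace,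
    Matrix.trace, map_sum]
  simp only [Matrix.diag_apply, LinearMap.toMatrix_apply, hcoord, Finset.sum_sub_distrib,
    Finset.sum_add_distrib]
  rw [Finset.sum_comm (f := fun i j => b.repr (O (b i)) j * b.repr (φ (b j)) i)]
  simp only [mul_comm, add_sub_cancel_right]

/-- The derivation `r • T d/dT` of the Laurent polynomial ring, as a linear map. -/
def scaledEuler {k : Type*} [Field k] (r : k) : LaurentPolynomial k →ₗ[k] LaurentPolynomial k :=
  (Finsupp.lsum k fun n : ℤ => (r * n) • AddMonoidAlgebra.lsingle n) ∘ₗ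
    (AddMonoidAlgebra.coeffLinearEquiv k).toLinearMap

theorem scaledEuler_C_mul_T {k : Type*} [Field k] (r a : k) (n : ℤ) :
    scaledEuler r (C a * T n) = (r * n) • (C a * T n) := by
  rw [← single_eq_C_mul_T]
  change Finsupp.lsum k _ (Finsupp.single n a) = _
  rw [Finsupp.lsum_single]
  rfl

theorem coeff_scaledEuler {k : Type*} [Field k] (r : k) (f : LaurentPolynomial k) (n : ℤ) :
    (scaledEuler r f).coeff n = r * n * f.coeff n := by
  induction f using LaurentPolynomial.induction_on' with
  | add p q hp hq => simp [hp, hq, mul_add]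
  | C_mul_T i a =>
    rw [scaledEuler_C_mul_T, ← single_eq_C_mul_T]
    by_cases h : i = n <;> simp [h, -single_eq_C_mul_T]

theorem eq_zero_of_scaledEuler_eq_smul {k : Type*} [Field k] {r w : k} {f : LaurentPolynomial k}
    (hf : scaledEuler r f = w • f) (hw : ∀ n : ℤ, w ≠ r * n) : f = 0 := by
  ext n
  have h := congrArg (fun g : LaurentPolynomial k => g.coeff n) hf
  simp only [coeff_scaledEuler, AddMonoidAlgebra.coeff_smul_apply, smul_eq_mul] at h
  have h' : (w - r * n) * f.coeff n = 0 := by linear_combination -h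
  simpa [sub_ne_zero.mpr (hw n)] using h'

/-- If `O` is a derivation of a free Lie algebra over the Laurent polynomials lying over
`r • T d/dT`, the Killing form pairs the eigenspaces of `O` for `w₁` and `w₂` to zero unless
`w₁ + w₂` is an integer multiple of `r`. -/
theorem killingForm_eq_zero_of_derivation {k A : Type*} [Field k] [LieRing A]
    [LieAlgebra (LaurentPolynomial k) A] [Module.Free (LaurentPolynomial k) A]
    [Module.Finite (LaurentPolynomial k) A] (r : k) (O : A →+ A)
    (hO : ∀ (f : LaurentPolynomial k) (a : A), O (f • a) = f • O a + scaledEuler r f • a)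
    (hO_lie : ∀ a b : A, O ⁅a, b⁆ = ⁅O a, b⁆ + ⁅a, O b⁆)
    {w₁ w₂ : k} (hw : ∀ n : ℤ, w₁ + w₂ ≠ r * n) {y z : A}
    (hy : O y = (C w₁ : LaurentPolynomial k) • y)
    (hz : O z = (C w₂ : LaurentPolynomial k) • z) :
    killingForm (LaurentPolynomial k) A y z = 0 := by
  apply eq_zero_of_scaledEuler_eq_smul (r := r) (w := w₁ + w₂) _ hw
  let φ := LieAlgebra.ad (LaurentPolynomial k) A y ∘ₗ LieAlgebra.ad (LaurentPolynomial k) A z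
  have h := trace_commutator_of_leibniz (scaledEuler r).toAddMonoidHom O hO φ
    ((C (w₁ + w₂) : LaurentPolynomial k) • φ) (by
      intro a
      rw [LinearMap.smul_apply]
      simp only [φ, LinearMap.comp_apply, LieAlgebra.ad_apply, hO_lie, hy,
        hz, smul_lie, lie_smul, lie_add, map_add, add_smul]
      abel)
  rw [LieModule.traceForm_apply_apply, smul_eq_C_mul]
  rw [map_smul, smul_eq_mul] at h
  exact h.symm

/-- If `w₁, w₂` are weights of `O_x` with `w₁ + w₂ ∉ mℤ`, then the
Killing form `κ` of the `R`-Lie algebra `A` vanishes on `A_{w₁} × A_{w₂}`. -/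
theorem killing_form_orthogonality
    -- the base field
    (k : Type) [Field k] [IsAlgClosed k] [CharZero k]
    -- the simple finite-dimensional Lie algebra 𝔤
    (𝔤 : Type) [LieRing 𝔤] [LieAlgebra k 𝔤] [FiniteDimensional k 𝔤]
    [LieAlgebra.IsSimple k 𝔤]
    -- the order m of σ and a primitive m-th root of unity ζ
    (m : ℕ) (hm : 0 < m)
    (σ : 𝔤 ≃ₗ⁅k⁆ 𝔤) (hσ : ∀ y : 𝔤, (⇑σ)^[m] y = y)
    (ζ : k) (hζ : IsPrimitiveRoot ζ m)
    -- the twisted loop algebra L(𝔤,σ) = ⊕_{i∈ℤ} 𝔤_ī ⊗ sⁱ, an R-Lie algebra for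
    -- R = k[t^{±1}] = LaurentPolynomial k (with t = sᵐ);
    -- `u p y` represents `y ⊗ sᵖ` for `y ∈ 𝔤_p̄`, i.e. `σ y = ζ^p • y`
    (Lg : Type) [LieRing Lg] [LieAlgebra (LaurentPolynomial k) Lg]
    [LieAlgebra k Lg] [IsScalarTower k (LaurentPolynomial k) Lg]
    (u : ℤ → 𝔤 →ₗ[k] Lg)
    (hu_bracket : ∀ (p q : ℤ) (y z : 𝔤), σ y = ζ ^ p • y → σ z = ζ ^ q • z →
      ⁅u p y, u q z⁆ = u (p + q) ⁅y, z⁆)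
    (hu_t : ∀ (p : ℤ) (y : 𝔤), σ y = ζ ^ p • y →
      (T 1 : LaurentPolynomial k) • u p y = u (p + (m : ℤ)) y)
    (hu_span : ∀ l : Lg, ∃ f : ℤ →₀ 𝔤, (∀ i, σ (f i) = ζ ^ i • f i) ∧
      l = f.sum fun i yi => u i yi)
    (hu_ind : ∀ f : ℤ →₀ 𝔤, (∀ i, σ (f i) = ζ ^ i • f i) →
      (f.sum fun i yi => u i yi) = 0 → f = 0)
    -- the twisted affine Kac–Moody algebra L̂(𝔤,σ) = L(𝔤,σ) ⊕ kc ⊕ kd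
    (Lhat : Type) [LieRing Lhat] [LieAlgebra k Lhat]
    (c d : Lhat) (ι : Lg →ₗ[k] Lhat)
    (hc : ∀ z : Lhat, ⁅c, z⁆ = 0)
    (hd : ∀ (p : ℤ) (y : 𝔤), σ y = ζ ^ p • y →
      ⁅d, ι (u p y)⁆ = (p : k) • ι (u p y))
    (hbr : ∀ (p q : ℤ) (y z : 𝔤), σ y = ζ ^ p • y → σ z = ζ ^ q • z →
      ⁅ι (u p y), ι (u q z)⁆ =
        ι (u (p + q) ⁅y, z⁆) +
          (if p + q = 0 then (p : k) * killingForm k 𝔤 y z else 0) • c)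
    (hdec : ∀ z : Lhat, ∃ (l : Lg) (a b : k), z = ι l + a • c + b • d)
    (huniq : ∀ (l : Lg) (a b : k), ι l + a • c + b • d = 0 → l = 0 ∧ a = 0 ∧ b = 0)
    -- the invariant nondegenerate bilinear form (·,·) on L̂(𝔤,σ)
    (B : LinearMap.BilinForm k Lhat)
    (hBsymm : ∀ z w : Lhat, B z w = B w z)
    (hBinv : ∀ z w y : Lhat, B ⁅z, w⁆ y = B z ⁅w, y⁆)
    (hBval : ∀ (p q : ℤ) (y z : 𝔤), σ y = ζ ^ p • y → σ z = ζ ^ q • z →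
      B (ι (u p y)) (ι (u q z)) = if p + q = 0 then killingForm k 𝔤 y z else 0)
    (hBc : ∀ l : Lg, B c (ι l) = 0) (hBd : ∀ l : Lg, B d (ι l) = 0)
    (hBcc : B c c = 0) (hBdd : B d d = 0) (hBcd : B c d = 1)
    -- the R-Lie subalgebra A of L(𝔤,σ), free of finite rank over R,
    -- with A ⊗_R K semisimple over the fraction field K of R
    (A : Type) [LieRing A] [LieAlgebra (LaurentPolynomial k) A]
    [Module k A] [IsScalarTower k (LaurentPolynomial k) A]
    [Module.Free (LaurentPolynomial k) A] [Module.Finite (LaurentPolynomial k) A]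
    (hss : LieAlgebra.IsSemisimple (FractionRing (LaurentPolynomial k))
      (FractionRing (LaurentPolynomial k) ⊗[LaurentPolynomial k] A))
    (j : A →ₗ⁅LaurentPolynomial k⁆ Lg) (hj : Function.Injective j)
    -- the embedding ℓ = ι ∘ j of A into L̂(𝔤,σ)
    (ℓ : A →ₗ[k] Lhat) (hℓ : ∀ a : A, ℓ a = ι (j a))
    -- Â = A ⊕ kc ⊕ kd, a subalgebra of L̂(𝔤,σ) on which the form is nondegenerate
    (Ahat : Submodule k Lhat)
    (hAhat : Ahat = LinearMap.range ℓ ⊔ Submodule.span k {c} ⊔ Submodule.span k {d})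
    (hA_closed : ∀ z ∈ Ahat, ∀ w ∈ Ahat, ⁅z, w⁆ ∈ Ahat)
    (hBnd : ∀ z ∈ Ahat, (∀ w ∈ Ahat, B z w = 0) → z = 0)
    -- the element x = x' + d with 0 ≠ x' ∈ A, with ad(x) k-diagonalizable on Â
    (x' : A) (hx'0 : x' ≠ 0) (x : Lhat) (hx : x = ℓ x' + d)
    (hdiag : ∀ z ∈ Ahat, z ∈ ⨆ w : k,
      Ahat ⊓ Module.End.eigenspace (LieAlgebra.ad k Lhat x) w)
    :
    ∀ w₁ w₂ : k, weightSubmodule ℓ x c w₁ ≠ ⊥ → weightSubmodule ℓ x c w₂ ≠ ⊥ →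
      (¬ ∃ n : ℤ, w₁ + w₂ = (((m : ℤ) * n : ℤ) : k)) →
      ∀ y ∈ weightSubmodule ℓ x c w₁, ∀ z ∈ weightSubmodule ℓ x c w₂,
        killingForm (LaurentPolynomial k) A y z = 0 := by
  intro w₁ w₂ _ _ hw y hy z hz
  have hζm (n : ℤ) : ζ ^ (n * (m : ℤ)) = 1 := by
    rw [mul_comm, zpow_mul, zpow_natCast, hζ.pow_eq_one, one_zpow]
  have hζ0 : ζ ≠ 0 := hζ.ne_zero hm.ne'
  have hσ_shift (p n : ℤ) (y : 𝔤) (hy : σ y = ζ ^ p • y) :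
      σ y = ζ ^ (p + n * (m : ℤ)) • y := by
    rw [zpow_add₀ hζ0, hζm, mul_one, hy]
  have hLg_ind (P : Lg → Prop) (h0 : P 0) (hadd : ∀ a b, P a → P b → P (a + b))
      (hu : ∀ (p : ℤ) (y : 𝔤), σ y = ζ ^ p • y → P (u p y)) (l : Lg) : P l := by
    obtain ⟨f, hf, rfl⟩ := hu_span l
    exact Finset.sum_induction _ P hadd h0 fun i _ => hu i _ (hf i)
  have hu_T (n p : ℤ) (y : 𝔤) (hy : σ y = ζ ^ p • y) :
      (T n : LaurentPolynomial k) • u p y = u (p + n * (m : ℤ)) y := by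
    induction n using Int.induction_on with
    | zero => simp
    | succ n ih =>
      rw [add_comm (n : ℤ), T_add, mul_smul, ih, hu_t _ _ (hσ_shift p n y hy)]
      congr 1
      ring_nf
    | pred n ih =>
      have h := hu_t _ _ (hσ_shift p (-n - 1) y hy)
      rw [show p + (-(n : ℤ) - 1) * m + m = p + -n * m by ring, ← ih] at h
      rw [show (-(n : ℤ) - 1) = -1 + -n by ring, T_add, mul_smul, ← h, ← mul_smul, ← T_add]
      rw [show (-1 : ℤ) + 1 = 0 by norm_num, T_zero, one_smul]
      congr 1
      ring_nf
  have hι_inj {a b : Lg} {μ : k} (h : ι a = ι b + μ • c) : a = b ∧ μ = 0 := by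
    obtain ⟨h₁, h₂, -⟩ := huniq (a - b) (-μ) 0 (by rw [map_sub, h]; module)
    exact ⟨sub_eq_zero.mp h₁, neg_eq_zero.mp h₂⟩
  have hι_inj' {a b : Lg} (h : ι a = ι b) : a = b := (hι_inj (μ := 0) (by simpa using h)).1
  have hd_exists (l : Lg) : ∃ l', ι l' = ⁅d, ι l⁆ := by
    induction l using hLg_ind with
    | h0 => exact ⟨0, by simp⟩
    | hadd a b ha hb =>
      obtain ⟨a', ha⟩ := ha
      obtain ⟨b', hb⟩ := hb
      exact ⟨a' + b', by simp [ha, hb]⟩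
    | hu p y hy => exact ⟨(p : k) • u p y, by rw [hd p y hy, map_smul]⟩
  choose D₀ hD₀ using hd_exists
  let D : Lg →ₗ[k] Lg :=
    { toFun := D₀
      map_add' := fun a b => hι_inj' (by simp [hD₀])
      map_smul' := fun a b => hι_inj' (by simp [hD₀]) }
  have hD (l : Lg) : ι (D l) = ⁅d, ι l⁆ := hD₀ l
  have hD_u (p : ℤ) (y : 𝔤) (hy : σ y = ζ ^ p • y) : D (u p y) = (p : k) • u p y :=
    hι_inj' (by rw [hD, hd p y hy, map_smul])
  have hC_Lg (a : k) (l : Lg) : (C a : LaurentPolynomial k) • l = a • l := by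
    rw [C_eq_algebraMap, algebraMap_smul]
  have hD_T (n : ℤ) (l : Lg) : D ((T n : LaurentPolynomial k) • l) =
      (T n : LaurentPolynomial k) • D l + ((m : k) * n) • (T n : LaurentPolynomial k) • l := by
    induction l using hLg_ind with
    | h0 => simp
    | hadd a b ha hb =>
      simp only [smul_add, map_add, ha, hb]
      abel
    | hu p y hy =>
      rw [hD_u p y hy, ← hC_Lg (p : k), smul_comm (T n : LaurentPolynomial k), hC_Lg,
        hu_T n p y hy, hD_u _ y (hσ_shift p n y hy), ← add_smul]
      push_cast
      rw [mul_comm (m : k)]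
  have hD_smul (f : LaurentPolynomial k) (l : Lg) :
      D (f • l) = f • D l + scaledEuler (m : k) f • l := by
    induction f using LaurentPolynomial.induction_on' with
    | add p q hp hq =>
      simp only [add_smul, map_add, hp, hq]
      abel
    | C_mul_T n a =>
      rw [scaledEuler_C_mul_T, mul_smul, hC_Lg, map_smul, hD_T, smul_eq_C_mul]
      simp only [mul_smul, hC_Lg, smul_add]
      rw [smul_comm a (T n : LaurentPolynomial k), smul_comm a (m : k), smul_comm a (n : k)]
  have hι_lie (a b : Lg) : ∃ μ : k, ⁅ι a, ι b⁆ = ι ⁅a, b⁆ + μ • c := by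
    induction a using hLg_ind with
    | h0 => exact ⟨0, by simp⟩
    | hadd a₁ a₂ h₁ h₂ =>
      obtain ⟨μ₁, h₁⟩ := h₁
      obtain ⟨μ₂, h₂⟩ := h₂
      exact ⟨μ₁ + μ₂, by rw [map_add, add_lie, h₁, h₂, add_lie, map_add]; module⟩
    | hu p y hy =>
      induction b using hLg_ind with
      | h0 => exact ⟨0, by simp⟩
      | hadd a₁ a₂ h₁ h₂ =>
        obtain ⟨μ₁, h₁⟩ := h₁
        obtain ⟨μ₂, h₂⟩ := h₂
        exact ⟨μ₁ + μ₂, by rw [map_add, lie_add, h₁, h₂, lie_add, map_add]; module⟩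
      | hu q z hz => exact ⟨_, by rw [hbr p q y z hy hz, hu_bracket p q y z hy hz]⟩
  have hc' (l : Lhat) : ⁅l, c⁆ = 0 := by rw [← lie_skew, hc, neg_zero]
  have hD_lie (a b : Lg) : D ⁅a, b⁆ = ⁅D a, b⁆ + ⁅a, D b⁆ := by
    obtain ⟨μ, h⟩ := hι_lie a b
    obtain ⟨μ₁, h₁⟩ := hι_lie (D a) b
    obtain ⟨μ₂, h₂⟩ := hι_lie a (D b)
    refine (hι_inj (μ := μ₁ + μ₂) ?_).1
    have h₃ : ι ⁅a, b⁆ = ⁅ι a, ι b⁆ - μ • c := by rw [h]; module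
    rw [hD, h₃, lie_sub, lie_smul, hc', smul_zero, sub_zero, leibniz_lie, ← hD, ← hD, h₁, h₂,
      map_add]
    module
  have hx_lie (a : A) : ∃ μ : k, ⁅x, ℓ a⁆ = ι (⁅j x', j a⁆ + D (j a)) + μ • c := by
    obtain ⟨μ, h⟩ := hι_lie (j x') (j a)
    exact ⟨μ, by rw [hx, add_lie, hℓ, hℓ, h, ← hD, map_add]; abel⟩
  have hℓ_mem (a : A) : ℓ a ∈ Ahat := by
    rw [hAhat]
    exact Submodule.mem_sup_left (Submodule.mem_sup_left ⟨a, rfl⟩)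
  have hd_mem : d ∈ Ahat := by
    rw [hAhat]
    exact Submodule.mem_sup_right (Submodule.mem_span_singleton_self d)
  have hO_exists (a : A) : ∃ b : A, j b = ⁅j x', j a⁆ + D (j a) := by
    have h := hA_closed x (hx ▸ Ahat.add_mem (hℓ_mem x') hd_mem) _ (hℓ_mem a)
    obtain ⟨μ, hμ⟩ := hx_lie a
    rw [hAhat, Submodule.mem_sup] at h
    obtain ⟨v, hv, w, hw, hvw⟩ := h
    obtain ⟨β, rfl⟩ := Submodule.mem_span_singleton.mp hw
    obtain ⟨v₁, ⟨b, rfl⟩, v₂, hv₂, rfl⟩ := Submodule.mem_sup.mp hv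
    obtain ⟨α, rfl⟩ := Submodule.mem_span_singleton.mp hv₂
    refine ⟨b, sub_eq_zero.mp (huniq _ (α - μ) β ?_).1⟩
    rw [hμ, hℓ] at hvw
    rw [map_sub, ← sub_eq_zero.mpr hvw]
    module
  choose O₀ hO₀ using hO_exists
  let O : A →+ A := AddMonoidHom.mk' O₀ fun a b => hj (by
    simp only [map_add, hO₀, lie_add]
    abel)
  have hO (a : A) : j (O a) = ⁅j x', j a⁆ + D (j a) := hO₀ a
  have hO_weight {w : k} {a : A} (ha : a ∈ weightSubmodule ℓ x c w) :
      O a = (C w : LaurentPolynomial k) • a := by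
    obtain ⟨μ, hμ⟩ := ha
    obtain ⟨ν, hν⟩ := hx_lie a
    apply hj
    rw [hO, map_smul, hC_Lg]
    refine (hι_inj (μ := μ - ν) ?_).1
    rw [hν, hℓ] at hμ
    rw [map_smul, eq_sub_of_add_eq hμ]
    module
  refine killingForm_eq_zero_of_derivation (m : k) O (fun f a => hj ?_) (fun a b => hj ?_)
    (fun n h => hw ⟨n, by rw [h]; push_cast; rfl⟩) (hO_weight hy) (hO_weight hz)
  · simp only [map_add, map_smul, hO, hD_smul, lie_smul, smul_add]
    abel
  · simp only [map_add, LieHom.map_lie, hO, hD_lie, leibniz_lie (j x'), lie_add, add_lie]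
    abel
end
end
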